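/- In the discharging of H defined by rules R1–R5 applied to the initial charge (every j-face charged with weight j), every minor 5-face f of H has final weight w(f) ≥ 10/3. -/

import Mathlib

open scoped Classical

noncomputable section

/-- A plane embedding (drawing) of a simple graph: vertices are mapped to distinct
points of the plane, every edge is drawn as a simple arc joining the points of its two
endvertices, arcs contain no vertex points other than their endpoints, and two distinct
arcs meet only in common endpoints. -/
structure PlaneEmbedding {V : Type*} (G : SimpleGraph V) where
  pos : V → ℝ × ℝ
  arc : V → V → Set (ℝ × ℝ)
  pos_injective : Function.Injective pos
  arc_symm : ∀ u v, arc u v = arc v u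
  arc_curve : ∀ u v, G.Adj u v → ∃ γ : ℝ → ℝ × ℝ,
      ContinuousOn γ (Set.Icc 0 1) ∧ Set.InjOn γ (Set.Icc 0 1) ∧
      γ 0 = pos u ∧ γ 1 = pos v ∧ γ '' Set.Icc 0 1 = arc u v
  arc_vertex : ∀ u v, G.Adj u v → ∀ w, pos w ∈ arc u v → w = u ∨ w = v
  arc_inter : ∀ u v x y, G.Adj u v → G.Adj x y → s(u, v) ≠ s(x, y) →
      arc u v ∩ arc x y ⊆ Set.range pos

/-- A graph is planar if it admits a plane embedding. -/
def SimpleGraph.IsPlanar {V : Type*} (G : SimpleGraph V) : Prop :=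
  Nonempty (PlaneEmbedding G)

/-- A graph is 3-connected if it has at least four vertices and deleting any set of at
most two vertices leaves a connected graph. -/
def ThreeConnected {V : Type*} [Fintype V] (G : SimpleGraph V) : Prop :=
  4 ≤ Fintype.card V ∧
    ∀ S : Finset V, S.card ≤ 2 → (G.induce ((↑S : Set V)ᶜ)).Connected

/-- `S` is a separator of `G`: deleting it leaves a disconnected graph. -/
def IsSeparator {V : Type*} [Fintype V] (G : SimpleGraph V) (S : Finset V) : Prop :=
  ¬ (G.induce ((↑S : Set V)ᶜ)).Connected

/-- A separator `S` is trivial if some component of `G - S` is a single vertex, i.e.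
some vertex outside `S` has all of its neighbours inside `S`. -/
def TrivialSeparator {V : Type*} [Fintype V] (G : SimpleGraph V) (S : Finset V) : Prop :=
  ∃ v : V, v ∉ S ∧ ∀ w : V, G.Adj v w → w ∈ S

/-- A graph is essentially 4-connected if it is 3-connected and every 3-separator is
trivial. -/
def EssentiallyFourConnected {V : Type*} [Fintype V] (G : SimpleGraph V) : Prop :=
  ThreeConnected G ∧
    ∀ S : Finset V, S.card = 3 → IsSeparator G S → TrivialSeparator G S

/-- A cycle `C` of `G` is isolating if every component of `G - V(C)` is a single vertex
of degree 3 in `G`, i.e. every vertex not on `C` has degree 3 in `G` and all of its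
neighbours on `C`. -/
def IsIsolating {V : Type*} [Fintype V] (G : SimpleGraph V) {x : V} (C : G.Walk x x) : Prop :=
  ∀ v : V, v ∉ C.support →
    (Finset.univ.filter fun w => G.Adj v w).card = 3 ∧ ∀ w : V, G.Adj v w → w ∈ C.support

/-- `C` is a longest isolating cycle of `G`. -/
def IsLongestIsolatingCycle {V : Type*} [Fintype V] (G : SimpleGraph V) {x : V}
    (C : G.Walk x x) : Prop :=
  C.IsCycle ∧ IsIsolating G C ∧
    ∀ (y : V) (C' : G.Walk y y), C'.IsCycle → IsIsolating G C' → C'.length ≤ C.length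

section PlaneSetup

variable {V : Type*} [Fintype V] {G : SimpleGraph V}

/-- The chords of the cycle `C`: edges of `G` not on `C` joining two vertices of `C`. -/
def chordSet {x : V} (C : G.Walk x x) : Set (Sym2 V) :=
  {e | e ∈ G.edgeSet ∧ e ∉ C.edges ∧ ∀ v ∈ e, v ∈ C.support}

/-- The plane graph `H` obtained from `G` by deleting all chords of `C`. -/
def Hgraph {x : V} (C : G.Walk x x) : SimpleGraph V :=
  G.deleteEdges (chordSet C)

/-- The arc drawing an edge, as a function of the unordered edge. -/
def arcSet (emb : PlaneEmbedding G) : Sym2 V → Set (ℝ × ℝ) :=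
  Sym2.lift ⟨emb.arc, emb.arc_symm⟩

/-- The point set of the drawing of the subgraph of `H'` induced on the vertex set `s`
(in the embedding `emb` of `G`). -/
def drawingOn (emb : PlaneEmbedding G) (H' : SimpleGraph V) (s : Set V) : Set (ℝ × ℝ) :=
  emb.pos '' s ∪
    ⋃ (u : V) (v : V) (_ : H'.Adj u v) (_ : u ∈ s) (_ : v ∈ s), emb.arc u v

/-- The drawing of `H`. -/
def drawingH (emb : PlaneEmbedding G) {x : V} (C : G.Walk x x) : Set (ℝ × ℝ) :=
  drawingOn emb (Hgraph C) Set.univ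

/-- `f` is a face of the drawing `D`: a connected component of its complement. -/
def IsFaceOf (D : Set (ℝ × ℝ)) (f : Set (ℝ × ℝ)) : Prop :=
  ∃ z : ℝ × ℝ, z ∉ D ∧ f = connectedComponentIn Dᶜ z

/-- The drawing of the cycle `C`. -/
def drawC (emb : PlaneEmbedding G) {x : V} (C : G.Walk x x) : Set (ℝ × ℝ) :=
  ⋃ e ∈ C.edges, arcSet emb e

/-- The open region strictly inside the closed curve given by `C`: the points off the
curve whose connected component in the complement is bounded. -/
def insideC (emb : PlaneEmbedding G) {x : V} (C : G.Walk x x) : Set (ℝ × ℝ) :=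
  {z | z ∉ drawC emb C ∧ Bornology.IsBounded (connectedComponentIn (drawC emb C)ᶜ z)}

/-- The vertices of `G` strictly inside `C`. -/
def Vminus (emb : PlaneEmbedding G) {x : V} (C : G.Walk x x) : Finset V :=
  Finset.univ.filter fun v => v ∉ C.support ∧ emb.pos v ∈ insideC emb C

/-- The vertices of `G` strictly outside `C`:  `V⁺ = V - V(C) - V⁻`. -/
def Vplus (emb : PlaneEmbedding G) {x : V} (C : G.Walk x x) : Finset V :=
  Finset.univ.filter fun v => v ∉ C.support ∧ v ∉ Vminus emb C

/-- A face `f` is incident with the vertex `v`. -/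
def incVertex (emb : PlaneEmbedding G) (f : Set (ℝ × ℝ)) (v : V) : Prop :=
  emb.pos v ∈ closure f

/-- A face `f` is incident with the edge `e` (the arc of `e` lies on the boundary). -/
def incEdge (emb : PlaneEmbedding G) (f : Set (ℝ × ℝ)) (e : Sym2 V) : Prop :=
  arcSet emb e ⊆ closure f

/-- A minor face of the drawing `D`: a face incident with exactly one vertex of
`V⁻ ∪ V⁺`. -/
def MinorFaceOf (emb : PlaneEmbedding G) {x : V} (C : G.Walk x x)
    (D : Set (ℝ × ℝ)) (f : Set (ℝ × ℝ)) : Prop :=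
  IsFaceOf D f ∧ ∃! v : V, v ∈ Vminus emb C ∪ Vplus emb C ∧ incVertex emb f v

/-- `M⁻`: the minor faces of `H⁻ = H - V⁺`. -/
def Mminus (emb : PlaneEmbedding G) {x : V} (C : G.Walk x x) : Set (Set (ℝ × ℝ)) :=
  {f | MinorFaceOf emb C (drawingOn emb (Hgraph C) ((↑(Vplus emb C) : Set V)ᶜ)) f}

/-- `M⁺`: the minor faces of `H⁺ = H - V⁻`. -/
def Mplus (emb : PlaneEmbedding G) {x : V} (C : G.Walk x x) : Set (Set (ℝ × ℝ)) :=
  {f | MinorFaceOf emb C (drawingOn emb (Hgraph C) ((↑(Vminus emb C) : Set V)ᶜ)) f}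

/-- A minor face of `H`. -/
def MinorFaceH (emb : PlaneEmbedding G) {x : V} (C : G.Walk x x) (f : Set (ℝ × ℝ)) : Prop :=
  MinorFaceOf emb C (drawingH emb C) f

/-- A major face of `H`: a face of `H` that is not minor. -/
def MajorFaceH (emb : PlaneEmbedding G) {x : V} (C : G.Walk x x) (f : Set (ℝ × ℝ)) : Prop :=
  IsFaceOf (drawingH emb C) f ∧ ¬ MinorFaceH emb C f

/-- The number of `C`-edges of a face `f` (so `f` is a `j`-face when this equals `j`). -/
def numCEdges (emb : PlaneEmbedding G) {x : V} (C : G.Walk x x) (f : Set (ℝ × ℝ)) : ℕ :=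
  (C.edges.toFinset.filter fun e => incEdge emb f e).card

/-- `m_{f,f'}`: the number of common `C`-edges of the faces `f` and `f'`. -/
def mEdges (emb : PlaneEmbedding G) {x : V} (C : G.Walk x x)
    (f f' : Set (ℝ × ℝ)) : ℕ :=
  (C.edges.toFinset.filter fun e => incEdge emb f e ∧ incEdge emb f' e).card

/-- `f'` is opposite to `f` (with respect to some `C`-edge incident with both). -/
def OppositeFaces (emb : PlaneEmbedding G) {x : V} (C : G.Walk x x)
    (f f' : Set (ℝ × ℝ)) : Prop :=
  f ≠ f' ∧ ∃ e ∈ C.edges, incEdge emb f e ∧ incEdge emb f' e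

/-- `e` is the middle `C`-edge of the face `f` (for a 3-face, the `C`-edge sharing an
endvertex with every other `C`-edge of `f`). -/
def IsMiddleCEdge (emb : PlaneEmbedding G) {x : V} (C : G.Walk x x)
    (f : Set (ℝ × ℝ)) (e : Sym2 V) : Prop :=
  e ∈ C.edges ∧ incEdge emb f e ∧
    ∀ e' ∈ C.edges, incEdge emb f e' → e' ≠ e → ∃ v : V, v ∈ e ∧ v ∈ e'

/-- The total weight sent from the face `f` to the face `f'` by the discharging rules
R1–R5 (each rule applied exactly once). -/
def sendWeight (emb : PlaneEmbedding G) {x : V} (C : G.Walk x x)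
    (f f' : Set (ℝ × ℝ)) : ℚ :=
  -- R1: a major face sends `m_{f,f'}` to every opposite minor face
  (if MajorFaceH emb C f ∧ MinorFaceH emb C f' ∧ OppositeFaces emb C f f'
    then (mEdges emb C f f' : ℚ) else 0)
  -- R2: a minor face sends `(2/3)·m_{f,f'}` to every opposite minor 2-face
  + (if MinorFaceH emb C f ∧ MinorFaceH emb C f' ∧ numCEdges emb C f' = 2 ∧
        OppositeFaces emb C f f'
    then 2 / 3 * (mEdges emb C f f' : ℚ) else 0)
  -- R3: a minor face sends 1 to every minor 3-face opposite with respect to its middle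
  -- `C`-edge
  + (if MinorFaceH emb C f ∧ MinorFaceH emb C f' ∧ numCEdges emb C f' = 3 ∧ f ≠ f' ∧
        (∃ e : Sym2 V, IsMiddleCEdge emb C f' e ∧ incEdge emb f e)
    then 1 else 0)
  -- R4
  + (if MinorFaceH emb C f ∧ 4 ≤ numCEdges emb C f ∧ MinorFaceH emb C f' ∧
        numCEdges emb C f' = 4 ∧ OppositeFaces emb C f' f ∧ mEdges emb C f' f = 2 ∧
        (∃ f₂ : Set (ℝ × ℝ), MinorFaceH emb C f₂ ∧
          (numCEdges emb C f₂ = 2 ∨ numCEdges emb C f₂ = 3) ∧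
          OppositeFaces emb C f' f₂ ∧ mEdges emb C f' f₂ = 2)
    then 2 / 3 else 0)
  -- R5
  + (if MinorFaceH emb C f ∧ 4 ≤ numCEdges emb C f ∧ MinorFaceH emb C f' ∧
        numCEdges emb C f' = 5 ∧ OppositeFaces emb C f' f ∧ mEdges emb C f' f = 2 ∧
        (∃ g₁ g₂ : Set (ℝ × ℝ), g₁ ≠ g₂ ∧
          MinorFaceH emb C g₁ ∧ numCEdges emb C g₁ = 2 ∧ OppositeFaces emb C f' g₁ ∧
          MinorFaceH emb C g₂ ∧ numCEdges emb C g₂ = 2 ∧ OppositeFaces emb C f' g₂)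
    then 1 / 3 else 0)

/-- The final weight of a face `f` after discharging: the initial charge `j` of a
`j`-face, minus everything sent, plus everything received. -/
def wFace (emb : PlaneEmbedding G) {x : V} (C : G.Walk x x) (f : Set (ℝ × ℝ)) : ℚ :=
  (numCEdges emb C f : ℚ) - (∑ᶠ f' : Set (ℝ × ℝ), sendWeight emb C f f')
    + ∑ᶠ f' : Set (ℝ × ℝ), sendWeight emb C f' f

end PlaneSetup

/-- `h` has a continuous logarithm on `K`. -/
def HasLogOn {X : Type*} [TopologicalSpace X] (K : Set X) (h : X → ℂ) : Prop :=
  ∃ L : X → ℂ, ContinuousOn L K ∧ ∀ z ∈ K, Complex.exp (L z) = h z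

namespace HasLogOn

variable {X : Type*} [TopologicalSpace X] {K K₁ K₂ : Set X} {g h : X → ℂ}

theorem mono (hK : HasLogOn K₂ h) (hs : K₁ ⊆ K₂) : HasLogOn K₁ h := by
  obtain ⟨L, hL, he⟩ := hK
  exact ⟨L, hL.mono hs, fun z hz => he z (hs hz)⟩

theorem congr (hK : HasLogOn K h) (hg : ∀ z ∈ K, h z = g z) : HasLogOn K g := by
  obtain ⟨L, hL, he⟩ := hK
  exact ⟨L, hL, fun z hz => (he z hz).trans (hg z hz)⟩

theorem mul (h₁ : HasLogOn K h) (h₂ : HasLogOn K g) : HasLogOn K fun z => h z * g z := by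
  obtain ⟨L, hL, he⟩ := h₁
  obtain ⟨M, hM, hf⟩ := h₂
  exact ⟨fun z => L z + M z, hL.add hM, fun z hz => by rw [Complex.exp_add, he z hz, hf z hz]⟩

theorem inv (h₁ : HasLogOn K h) : HasLogOn K fun z => (h z)⁻¹ := by
  obtain ⟨L, hL, he⟩ := h₁
  exact ⟨fun z => -L z, hL.neg, fun z hz => by rw [Complex.exp_neg, he z hz]⟩

/-- Logarithms of functions whose values lie in the slit plane. -/
theorem of_slitPlane (hc : ContinuousOn h K) (hs : ∀ z ∈ K, h z ∈ Complex.slitPlane) :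
    HasLogOn K h :=
  ⟨fun z => Complex.log (h z), hc.clog hs,
    fun z hz => Complex.exp_log (Complex.slitPlane_ne_zero (hs z hz))⟩

end HasLogOn

/-- A continuous function with values in `2πiℤ` on a preconnected set is constant. -/
theorem eq_of_exp_eq_one {X : Type*} [TopologicalSpace X] {K : Set X} (hK : IsPreconnected K)
    {D : X → ℂ} (hD : ContinuousOn D K) (he : ∀ z ∈ K, Complex.exp (D z) = 1)
    {x y : X} (hx : x ∈ K) (hy : y ∈ K) : D x = D y := by
  have hpi : (2 * Real.pi * Complex.I : ℂ) ≠ 0 := Complex.two_pi_I_ne_zero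
  let φ : X → ℝ := fun z => (D z / (2 * Real.pi * Complex.I)).re
  have hφ : ContinuousOn φ K := Complex.continuous_re.comp_continuousOn (hD.div_const _)
  have hinter : ∀ z ∈ K, ∃ n : ℤ, D z = n * (2 * Real.pi * Complex.I) ∧ φ z = n := by
    intro z hz
    obtain ⟨n, hn⟩ := Complex.exp_eq_one_iff.1 (he z hz)
    refine ⟨n, hn, ?_⟩
    simp only [φ, hn, mul_div_assoc, div_self hpi, mul_one, Complex.intCast_re]
  have hconn : (φ '' K).OrdConnected := (hK.image φ hφ).ordConnected
  obtain ⟨n, hn, hn'⟩ := hinter x hx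
  obtain ⟨m, hm, hm'⟩ := hinter y hy
  have key : ∀ n m : ℤ, (n : ℝ) ∈ φ '' K → (m : ℝ) ∈ φ '' K → ¬ n < m := by
    intro n m h1 h2 hlt
    have h3 : (n : ℝ) + 1 ≤ m := by exact_mod_cast hlt
    obtain ⟨z, hz, hz'⟩ := hconn.out h1 h2 (show (n : ℝ) + 1 / 2 ∈ Set.Icc (n : ℝ) m from
      ⟨by linarith, by linarith⟩)
    obtain ⟨k, -, hk⟩ := hinter z hz
    rw [hk] at hz'
    have h4 : (n : ℝ) < k := by linarith
    have h5 : (k : ℝ) < n + 1 := by linarith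
    have h6 : n < k := by exact_mod_cast h4
    have h7 : k < n + 1 := by exact_mod_cast h5
    omega
  have hnm : n = m := by
    have h1 : (n : ℝ) ∈ φ '' K := ⟨x, hx, hn'⟩
    have h2 : (m : ℝ) ∈ φ '' K := ⟨y, hy, hm'⟩
    have := key n m h1 h2
    have := key m n h2 h1
    omega
  rw [hn, hm, hnm]

/-- Logarithms agreeing up to a constant on the intersection of two closed sets glue. -/
theorem HasLogOn.union_of_const {X : Type*} [TopologicalSpace X] {K₁ K₂ : Set X} {h : X → ℂ}
    (h₁ : IsClosed K₁) (h₂ : IsClosed K₂) {L M : X → ℂ} (hL : ContinuousOn L K₁)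
    (hM : ContinuousOn M K₂) (heL : ∀ z ∈ K₁, Complex.exp (L z) = h z)
    (heM : ∀ z ∈ K₂, Complex.exp (M z) = h z) (hne : ∀ z ∈ K₁ ∩ K₂, h z ≠ 0)
    (hc : ∀ x ∈ K₁ ∩ K₂, ∀ y ∈ K₁ ∩ K₂, L x - M x = L y - M y) :
    HasLogOn (K₁ ∪ K₂) h := by
  obtain ⟨k, hk, hkc⟩ : ∃ k : ℂ, Complex.exp k = 1 ∧ ∀ x ∈ K₁ ∩ K₂, L x = M x + k := by
    rcases (K₁ ∩ K₂).eq_empty_or_nonempty with he | ⟨x, hx⟩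
    · exact ⟨0, Complex.exp_zero, by simp [he]⟩
    · refine ⟨L x - M x, ?_, fun y hy => ?_⟩
      · rw [Complex.exp_sub, heL x hx.1, heM x hx.2, div_self (hne x hx)]
      · rw [hc x hx y hy]; ring
  refine ⟨fun z => if z ∈ K₁ then L z else M z + k, ?_, ?_⟩
  · refine ContinuousOn.union_of_isClosed ?_ ?_ h₁ h₂
    · exact hL.congr fun z hz => by simp [hz]
    · refine (hM.add (continuousOn_const (c := k))).congr fun z hz => ?_
      by_cases hz1 : z ∈ K₁
      · simp [hz1, hkc z ⟨hz1, hz⟩]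
      · simp [hz1]
  · intro z hz
    by_cases hz1 : z ∈ K₁
    · simp [hz1, heL z hz1]
    · simp [hz1, Complex.exp_add, hk, heM z (hz.resolve_left hz1)]

theorem HasLogOn.union {X : Type*} [TopologicalSpace X] {K₁ K₂ : Set X} {h : X → ℂ}
    (h₁ : IsClosed K₁) (h₂ : IsClosed K₂) (hL : HasLogOn K₁ h) (hM : HasLogOn K₂ h)
    (hK : IsPreconnected (K₁ ∩ K₂)) : HasLogOn (K₁ ∪ K₂) h := by
  obtain ⟨L, hLc, hLe⟩ := hL
  obtain ⟨M, hMc, hMe⟩ := hM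
  have hne : ∀ z ∈ K₁ ∩ K₂, h z ≠ 0 := fun z hz => hLe z hz.1 ▸ Complex.exp_ne_zero _
  refine HasLogOn.union_of_const h₁ h₂ hLc hMc hLe hMe hne fun x hx y hy => ?_
  refine eq_of_exp_eq_one (D := fun z => L z - M z) hK
    ((hLc.mono Set.inter_subset_left).sub (hMc.mono Set.inter_subset_right)) ?_ hx hy
  intro z hz
  rw [Complex.exp_sub, hLe z hz.1, hMe z hz.2, div_self (hne z hz)]

/-- A continuous nonvanishing function on a compact set which is star-shaped about the origin
has a continuous logarithm. -/
theorem hasLogOn_of_starConvex {E : Type*} [NormedAddCommGroup E] [NormedSpace ℝ E] {D : Set E}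
    (hD : IsCompact D) (h0 : StarConvex ℝ 0 D) {F : E → ℂ} (hF : ContinuousOn F D)
    (hne : ∀ z ∈ D, F z ≠ 0) : HasLogOn D F := by
  rcases D.eq_empty_or_nonempty with rfl | hDne
  · exact ⟨fun _ => 0, continuousOn_empty _, by simp⟩
  have hmem : ∀ z ∈ D, ∀ t : ℝ, 0 ≤ t → t ≤ 1 → t • z ∈ D := by
    intro z hz t ht0 ht1
    exact h0.smul_mem hz ht0 ht1
  obtain ⟨z₀, hz₀, hmin⟩ := hD.exists_isMinOn hDne hF.norm
  set m := ‖F z₀‖ with hm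
  have hmpos : 0 < m := norm_pos_iff.2 (hne z₀ hz₀)
  have huc : UniformContinuousOn F D := hD.uniformContinuousOn_of_continuous hF
  obtain ⟨δ, hδ, hδF⟩ := Metric.uniformContinuousOn_iff.1 huc m hmpos
  obtain ⟨R, hR⟩ := hD.isBounded.exists_norm_le
  obtain ⟨N, hN⟩ := exists_nat_gt (R / δ)
  have hR0 : 0 ≤ R := (norm_nonneg _).trans (hR z₀ hz₀)
  have hNpos : (0 : ℝ) < N := lt_of_le_of_lt (div_nonneg hR0 hδ.le) hN
  have hpt : ∀ k : ℕ, k ≤ N → ∀ z ∈ D, ((k : ℝ) / N) • z ∈ D := fun k hk z hz =>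
    hmem z hz _ (by positivity) (by rw [div_le_one hNpos]; exact_mod_cast hk)
  have hcont : ∀ k : ℕ, k ≤ N → ContinuousOn (fun z => F (((k : ℝ) / N) • z)) D := fun k hk =>
    hF.comp (continuous_const_smul _).continuousOn fun z hz => hpt k hk z hz
  have key : ∀ k : ℕ, k ≤ N → HasLogOn D fun z => F (((k : ℝ) / N) • z) := by
    intro k
    induction k with
    | zero =>
      intro _
      have h00 : (0 : E) ∈ D := by simpa using hmem z₀ hz₀ 0 le_rfl zero_le_one
      exact ⟨fun _ => Complex.log (F 0), continuousOn_const, fun z hz => by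
        simp [Complex.exp_log (hne 0 h00)]⟩
    | succ k ih =>
      intro hk
      have hk' : k ≤ N := by omega
      have hstep : HasLogOn D fun z =>
          F ((((k + 1 : ℕ) : ℝ) / N) • z) / F (((k : ℝ) / N) • z) := by
        refine HasLogOn.of_slitPlane ((hcont _ hk).div (hcont _ hk')
          fun z hz => hne _ (hpt k hk' z hz)) fun z hz => ?_
        have hne' := hne _ (hpt k hk' z hz)
        refine Complex.mem_slitPlane_of_norm_lt_one (z := _ - 1) ?_ |> fun h => by simpa using h
        rw [div_sub_one hne', norm_div, div_lt_one (norm_pos_iff.2 hne')]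
        have hle : m ≤ ‖F (((k : ℝ) / N) • z)‖ := hmin (hpt k hk' z hz)
        refine lt_of_lt_of_le ?_ hle
        rw [← dist_eq_norm]
        have hd := hδF _ (hpt (k + 1) hk z hz) _ (hpt k hk' z hz)
        push_cast at hd
        refine hd ?_
        rw [dist_eq_norm, ← sub_smul, norm_smul]
        have : ((k : ℝ) + 1) / N - k / N = 1 / N := by ring
        rw [this, Real.norm_of_nonneg (by positivity)]
        have h1 : R < N * δ := by rwa [div_lt_iff₀ hδ] at hN
        rw [one_div, inv_mul_lt_iff₀ hNpos]
        exact lt_of_le_of_lt (hR z hz) h1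
      refine (hstep.mul (ih hk')).congr fun z hz => ?_
      exact div_mul_cancel₀ _ (hne _ (hpt k hk' z hz))
  refine (key N le_rfl).congr fun z _ => ?_
  rw [div_self hNpos.ne', one_smul]

/-- The complex coordinate on the plane. -/
def cx (z : ℝ × ℝ) : ℂ := ⟨z.1, z.2⟩

theorem continuous_cx : Continuous cx := Complex.equivRealProdCLM.symm.continuous

theorem cx_injective : Function.Injective cx := Complex.equivRealProdCLM.symm.injective

theorem cx_sub_ne_zero {z w : ℝ × ℝ} (h : z ≠ w) : cx z - cx w ≠ 0 :=
  sub_ne_zero.2 fun h' => h (cx_injective h')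

/-- The Möbius function with zero `a` and pole `b`. -/
def ratio (a b z : ℝ × ℝ) : ℂ := (cx z - cx a) / (cx z - cx b)

theorem ratio_mul_ratio {a b c z : ℝ × ℝ} (hb : z ≠ b) :
    ratio a b z * ratio b c z = ratio a c z := by
  have := cx_sub_ne_zero hb
  simp only [ratio]
  field_simp

theorem ratio_inv (a b z : ℝ × ℝ) : (ratio a b z)⁻¹ = ratio b a z := by
  simp [ratio, inv_div]

theorem ratio_ne_zero {a b z : ℝ × ℝ} (ha : z ≠ a) (hb : z ≠ b) : ratio a b z ≠ 0 :=
  div_ne_zero (cx_sub_ne_zero ha) (cx_sub_ne_zero hb)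

theorem continuousOn_ratio {K : Set (ℝ × ℝ)} {a b : ℝ × ℝ} (hb : b ∉ K) :
    ContinuousOn (ratio a b) K := by
  refine ContinuousOn.div (continuous_cx.sub continuous_const).continuousOn
    (continuous_cx.sub continuous_const).continuousOn fun z hz => ?_
  exact cx_sub_ne_zero fun h => hb (h ▸ hz)

theorem hasLogOn_ratio_of_isPreconnected {K U : Set (ℝ × ℝ)} (hK : IsClosed K)
    (hU : IsPreconnected U) (hUK : Disjoint U K) {a b : ℝ × ℝ} (ha : a ∈ U) (hb : b ∈ U) :
    HasLogOn K (ratio a b) := by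
  have hnot : ∀ x ∈ U, ∀ z ∈ K, z ≠ x := fun x hx z hz h =>
    Set.disjoint_left.1 hUK hx (h ▸ hz)
  refine hU.induction₂ (fun a b => HasLogOn K (ratio a b)) ?_ ?_ ?_ ha hb
  · intro x hx
    have hxK : Kᶜ ∈ nhds x := hK.isOpen_compl.mem_nhds fun h => hnot x hx x h rfl
    have hcomp : cx ⁻¹' (Metric.ball (cx x) 1) ∈ nhds x :=
      continuous_cx.continuousAt.preimage_mem_nhds (Metric.ball_mem_nhds _ one_pos)
    have h1 : IsClosed (cx '' K) := by
      have : cx '' K = Complex.equivRealProdCLM.symm.toHomeomorph '' K := rfl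
      rw [this]
      exact (Homeomorph.isClosed_image _).2 hK
    have hx1 : (cx '' K)ᶜ ∈ nhds (cx x) := by
      refine h1.isOpen_compl.mem_nhds ?_
      rintro ⟨z, hz, hzx⟩
      exact hnot x hx z hz (cx_injective hzx)
    obtain ⟨ε, hε, hball⟩ := Metric.mem_nhds_iff.1 hx1
    have hev : cx ⁻¹' (Metric.ball (cx x) (ε / 2)) ∈ nhds x :=
      continuous_cx.continuousAt.preimage_mem_nhds (Metric.ball_mem_nhds _ (half_pos hε))
    filter_upwards [mem_nhdsWithin_of_mem_nhds hev, self_mem_nhdsWithin] with y hy hyU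
    refine HasLogOn.of_slitPlane (continuousOn_ratio fun h => hnot y hyU y h rfl) fun z hz => ?_
    have hne := cx_sub_ne_zero (hnot y hyU z hz)
    have hd : ε ≤ dist (cx z) (cx x) := by
      by_contra hlt
      exact hball (Metric.mem_ball.2 (not_le.1 hlt)) ⟨z, hz, rfl⟩
    have hd2 : dist (cx y) (cx x) < ε / 2 := hy
    have hd3 : dist (cx y) (cx x) < dist (cx z) (cx y) := by
      have := dist_triangle (cx z) (cx y) (cx x)
      linarith
    have : ratio x y z = 1 + (cx y - cx x) / (cx z - cx y) := by
      simp only [ratio]; field_simp; ring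
    rw [this]
    refine Complex.mem_slitPlane_of_norm_lt_one ?_
    rw [norm_div, div_lt_one (norm_pos_iff.2 hne), ← dist_eq_norm, ← dist_eq_norm]
    exact hd3
  · intro x y z _ hy _ h1 h2
    exact (h1.mul h2).congr fun w hw => ratio_mul_ratio (hnot y hy w hw)
  · intro x y _ _ h1
    exact h1.inv.congr fun w _ => ratio_inv x y w

/-- The circle of radius `r` about `a`. -/
def circ (a : ℝ × ℝ) (r : ℝ) : Set (ℝ × ℝ) := {z | ‖cx z - cx a‖ = r}

theorem isCompact_cx_preimage {T : Set ℂ} (h : IsCompact T) : IsCompact (cx ⁻¹' T) :=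
  Complex.equivRealProdCLM.symm.toHomeomorph.isCompact_preimage.2 h

theorem isCompact_circ (a : ℝ × ℝ) (r : ℝ) : IsCompact (circ a r) := by
  have : circ a r = cx ⁻¹' Metric.sphere (cx a) r := by
    ext z; simp [circ]
  rw [this]
  exact isCompact_cx_preimage (isCompact_sphere _ _)

theorem eq_zero_of_hasLogOn_circ {a : ℝ × ℝ} {r : ℝ} (hr : 0 < r) {n : ℤ}
    (h : HasLogOn (circ a r) fun z => (cx z - cx a) ^ n) : n = 0 := by
  obtain ⟨L, hL, he⟩ := h
  let c : ℝ → ℝ × ℝ := fun t => (a.1 + r * Real.cos t, a.2 + r * Real.sin t)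
  have hc : Continuous c := by fun_prop
  have hcx : ∀ t, cx (c t) - cx a = r * Complex.exp (t * Complex.I) := by
    intro t
    apply Complex.ext <;> simp [cx, c, Complex.exp_ofReal_mul_I_re, Complex.exp_ofReal_mul_I_im]
  have hmem : ∀ t, c t ∈ circ a r := by
    intro t
    simp only [circ, Set.mem_ofPred_eq, hcx, norm_mul, Complex.norm_exp_ofReal_mul_I, mul_one]
    simp [abs_of_pos hr]
  have hrne : (r : ℂ) ≠ 0 := by exact_mod_cast hr.ne'
  have key := eq_of_exp_eq_one (K := (Set.univ : Set ℝ)) isPreconnected_univ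
    (D := fun t : ℝ => L (c t) - n * (t * Complex.I) - n * Complex.log r)
    (by
      refine ContinuousOn.sub (ContinuousOn.sub ?_ ?_) continuousOn_const
      · exact hL.comp hc.continuousOn fun t _ => hmem t
      · fun_prop)
    (by
      intro t _
      have het : Complex.exp (L (c t)) = (cx (c t) - cx a) ^ n := he _ (hmem t)
      rw [Complex.exp_sub, Complex.exp_sub, het, hcx, mul_zpow, Complex.exp_int_mul,
        Complex.exp_int_mul, Complex.exp_log hrne]
      have h1 : Complex.exp (t * Complex.I) ^ n ≠ 0 := zpow_ne_zero _ (Complex.exp_ne_zero _)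
      have h2 : (r : ℂ) ^ n ≠ 0 := zpow_ne_zero _ hrne
      field_simp)
    (Set.mem_univ 0) (Set.mem_univ (2 * Real.pi))
  have hcc : c (2 * Real.pi) = c 0 := by simp [c]
  simp only [hcc] at key
  have h3 : (n : ℂ) * (2 * Real.pi * Complex.I) = 0 := by
    push_cast at key
    linear_combination key
  have := (mul_eq_zero.1 h3).resolve_right Complex.two_pi_I_ne_zero
  exact_mod_cast this

theorem not_hasLogOn_ratio_circ {p q : ℝ × ℝ} {r : ℝ} (hr : 0 < r) (hq : r < ‖cx q - cx p‖) :
    ¬ HasLogOn (circ p r) (ratio p q) := by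
  intro h
  have hpq : cx p - cx q ≠ 0 := by
    rw [← norm_pos_iff, norm_sub_rev]; linarith
  have hne : ∀ z ∈ circ p r, cx z - cx q ≠ 0 := by
    intro z hz h0
    have : cx z = cx q := sub_eq_zero.1 h0
    have hz' : ‖cx z - cx p‖ = r := hz
    rw [this] at hz'
    linarith
  have h2 : HasLogOn (circ p r) fun z => (cx z - cx q) / (cx p - cx q) := by
    refine HasLogOn.of_slitPlane ?_ fun z hz => ?_
    · exact ((continuous_cx.sub continuous_const).div_const _).continuousOn
    · have : (cx z - cx q) / (cx p - cx q) = 1 + (cx z - cx p) / (cx p - cx q) := by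
        field_simp; ring
      rw [this]
      refine Complex.mem_slitPlane_of_norm_lt_one ?_
      have hz' : ‖cx z - cx p‖ = r := hz
      rw [norm_div, div_lt_one (norm_pos_iff.2 hpq), hz', norm_sub_rev (cx p)]
      exact hq
  have h3 : HasLogOn (circ p r) fun _ => cx p - cx q :=
    ⟨fun _ => Complex.log (cx p - cx q), continuousOn_const, fun _ _ => Complex.exp_log hpq⟩
  have := eq_zero_of_hasLogOn_circ (a := p) hr (n := 1) (((h.mul h2).mul h3).congr fun z hz => by
    have := hne z hz
    simp only [ratio, zpow_one]
    field_simp)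
  exact one_ne_zero this

namespace IsFaceOf

variable {D D' f g U : Set (ℝ × ℝ)}

theorem isPreconnected (hf : IsFaceOf D f) : IsPreconnected f := by
  obtain ⟨z, -, rfl⟩ := hf
  exact isPreconnected_connectedComponentIn

theorem isOpen (hD : IsClosed D) (hf : IsFaceOf D f) : IsOpen f := by
  obtain ⟨z, -, rfl⟩ := hf
  exact hD.isOpen_compl.connectedComponentIn

theorem nonempty (hf : IsFaceOf D f) : f.Nonempty := by
  obtain ⟨z, hz, rfl⟩ := hf
  exact ⟨z, mem_connectedComponentIn hz⟩

theorem disjoint (hf : IsFaceOf D f) : Disjoint f D := by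
  obtain ⟨z, -, rfl⟩ := hf
  exact Set.disjoint_left.2 fun x hx => connectedComponentIn_subset _ _ hx

theorem notMem (hf : IsFaceOf D f) {z : ℝ × ℝ} (hz : z ∈ f) : z ∉ D :=
  Set.disjoint_left.1 hf.disjoint hz

theorem eq_component (hf : IsFaceOf D f) {z : ℝ × ℝ} (hz : z ∈ f) :
    f = connectedComponentIn Dᶜ z := by
  obtain ⟨w, -, rfl⟩ := hf
  exact connectedComponentIn_eq hz

theorem eq_of_mem (hf : IsFaceOf D f) (hg : IsFaceOf D g) {z : ℝ × ℝ} (hz : z ∈ f)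
    (hz' : z ∈ g) : f = g := by
  rw [hf.eq_component hz, hg.eq_component hz']

theorem subset_of_isPreconnected (hf : IsFaceOf D f) (hU : IsPreconnected U)
    (hUD : Disjoint U D) {z : ℝ × ℝ} (hz : z ∈ f) (hzU : z ∈ U) : U ⊆ f := by
  rw [hf.eq_component hz]
  exact hU.subset_connectedComponentIn hzU (Set.disjoint_left.1 hUD)

theorem closure_subset (hD : IsClosed D) (hf : IsFaceOf D f) : closure f ⊆ f ∪ D := by
  intro z hz
  by_contra h
  rw [Set.mem_union, not_or] at h
  have hg : IsFaceOf D (connectedComponentIn Dᶜ z) := ⟨z, h.2, rfl⟩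
  obtain ⟨w, hw, hwf⟩ := mem_closure_iff.1 hz _ (hg.isOpen hD) (mem_connectedComponentIn h.2)
  exact h.1 (by rw [hf.eq_of_mem hg hwf hw]; exact mem_connectedComponentIn h.2)

theorem notMem_closure_of_mem (hD : IsClosed D) (hf : IsFaceOf D f) (hg : IsFaceOf D g)
    (hfg : f ≠ g) {z : ℝ × ℝ} (hz : z ∈ g) : z ∉ closure f := by
  intro h
  rcases hf.closure_subset hD h with h | h
  · exact hfg (hf.eq_of_mem hg h hz)
  · exact hg.notMem hz h

theorem of_notMem {z : ℝ × ℝ} (hz : z ∉ D) : IsFaceOf D (connectedComponentIn Dᶜ z) :=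
  ⟨z, hz, rfl⟩

theorem exists_superset (hf : IsFaceOf D f) (h : D' ⊆ D) : ∃ g, IsFaceOf D' g ∧ f ⊆ g := by
  obtain ⟨z, hz⟩ := hf.nonempty
  have hz' : z ∉ D' := fun h' => hf.notMem hz (h h')
  exact ⟨_, of_notMem hz', hf.isPreconnected.subset_connectedComponentIn hz
    fun w hw hw' => hf.notMem hw (h hw')⟩

theorem subset_of_mem (hf : IsFaceOf D f) (hg : IsFaceOf D' g) (h : D' ⊆ D) {z : ℝ × ℝ}
    (hz : z ∈ f) (hz' : z ∈ g) : f ⊆ g :=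
  hg.subset_of_isPreconnected hf.isPreconnected (hf.disjoint.mono_right h) hz' hz

/-- A face stays a face when the drawing is reduced away from its boundary. -/
theorem of_frontier (hD : IsClosed D) (hf : IsFaceOf D f) (h : D' ⊆ D)
    (hfr : closure f ∩ D ⊆ D') : IsFaceOf D' f := by
  obtain ⟨g, hg, hfg⟩ := hf.exists_superset h
  suffices g ⊆ f by rwa [hfg.antisymm this]
  obtain ⟨z, hz⟩ := hf.nonempty
  refine hg.isPreconnected.subset_of_closure_inter_subset (hf.isOpen hD)
    ⟨z, hfg hz, hz⟩ ?_
  rintro w ⟨hw, hwg⟩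
  rcases hf.closure_subset hD hw with h1 | h1
  · exact h1
  · exact absurd (hfr ⟨hw, h1⟩) (hg.notMem hwg)

/-- A face stays a face when the drawing is extended outside of it. -/
theorem of_disjoint (hf : IsFaceOf D' f) (h : D' ⊆ D) (hd : Disjoint f D) : IsFaceOf D f := by
  obtain ⟨z, hz⟩ := hf.nonempty
  have hzD : z ∉ D := Set.disjoint_left.1 hd hz
  refine ⟨z, hzD, Set.Subset.antisymm
    (hf.isPreconnected.subset_connectedComponentIn hz (Set.disjoint_left.1 hd)) ?_⟩
  rw [hf.eq_component hz]
  exact connectedComponentIn_mono z (Set.compl_subset_compl.2 h)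

end IsFaceOf

theorem isPreconnected_norm_gt (R : ℝ) : IsPreconnected {z : ℝ × ℝ | R < ‖z‖} := by
  rcases lt_or_ge R 0 with hR | hR
  · have : {z : ℝ × ℝ | R < ‖z‖} = Set.univ := by
      ext z; simpa using hR.trans_le (norm_nonneg z)
    rw [this]; exact isPreconnected_univ
  have hrank : 1 < Module.rank ℝ (ℝ × ℝ) := by
    rw [rank_prod']; simp
    norm_num
  have h1 : IsPreconnected (Set.Ioi R ×ˢ Metric.sphere (0 : ℝ × ℝ) 1) :=
    isPreconnected_Ioi.prod (isPreconnected_sphere hrank _ _)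
  have h2 := h1.image (fun q => q.1 • q.2) (by fun_prop)
  convert h2 using 1
  ext z
  simp only [Set.mem_ofPred_eq, Set.mem_image, Set.mem_prod, Set.mem_Ioi,
    mem_sphere_zero_iff_norm]
  constructor
  · intro hz
    have hz0 : (0 : ℝ) < ‖z‖ := lt_of_le_of_lt hR hz
    refine ⟨(‖z‖, ‖z‖⁻¹ • z), ⟨hz, ?_⟩, ?_⟩
    · show ‖‖z‖⁻¹ • z‖ = 1
      rw [norm_smul, norm_inv, norm_norm, inv_mul_cancel₀ hz0.ne']
    · show ‖z‖ • ‖z‖⁻¹ • z = z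
      rw [smul_smul, mul_inv_cancel₀ hz0.ne', one_smul]
  · rintro ⟨⟨t, w⟩, ⟨ht, hw⟩, rfl⟩
    dsimp only at ht hw ⊢
    rw [norm_smul, hw, mul_one]
    exact ht.trans_le (le_abs_self t)

theorem isBounded_of_ne {K f g : Set (ℝ × ℝ)} (hK : IsCompact K) (hf : IsFaceOf K f)
    (hg : IsFaceOf K g) (hfg : f ≠ g) : Bornology.IsBounded f ∨ Bornology.IsBounded g := by
  obtain ⟨R, hR⟩ := hK.isBounded.exists_norm_le
  have hd : Disjoint {z : ℝ × ℝ | R < ‖z‖} K :=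
    Set.disjoint_left.2 fun z hz hzK => (hR z hzK).not_gt hz
  by_contra! h
  have key : ∀ f, IsFaceOf K f → ¬ Bornology.IsBounded f → {z : ℝ × ℝ | R < ‖z‖} ⊆ f := by
    intro f hf hb
    have : ∃ z ∈ f, R < ‖z‖ := by
      by_contra! h
      exact hb (isBounded_iff_forall_norm_le.2 ⟨R, h⟩)
    obtain ⟨z, hz, hzR⟩ := this
    exact hf.subset_of_isPreconnected (isPreconnected_norm_gt R) hd hz hzR
  obtain ⟨z, hz, hzR⟩ : ∃ z ∈ f, R < ‖z‖ := by
    by_contra! h'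
    exact h.1 (isBounded_iff_forall_norm_le.2 ⟨R, h'⟩)
  exact hfg (hf.eq_of_mem hg hz (key g hg h.2 hzR))

/-- A bounded face detects the order of vanishing of a function with a logarithm on its
boundary. -/
theorem eq_zero_of_hasLogOn_of_isBounded {K U : Set (ℝ × ℝ)} (hK : IsCompact K)
    (hU : IsFaceOf K U) (hb : Bornology.IsBounded U) {a : ℝ × ℝ} (ha : a ∈ U)
    {P : ℝ × ℝ → ℂ} (hP : ContinuousOn P (closure U)) (hP0 : ∀ z ∈ closure U, P z ≠ 0) {n : ℤ}
    (h : HasLogOn K fun z => (cx z - cx a) ^ n * P z) : n = 0 := by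
  obtain ⟨L, hL, he⟩ := h
  obtain ⟨M, hM⟩ := ContinuousMap.exists_restrict_eq hK.isClosed
    (⟨K.domRestrict L, continuousOn_iff_continuous_domRestrict.1 hL⟩ : C(K, ℂ))
  have hM' : ∀ z ∈ K, M z = L z := fun z hz => by
    exact congrArg (fun φ => φ ⟨z, hz⟩) hM
  have hUo := hU.isOpen hK.isClosed
  let F : ℝ × ℝ → ℂ := fun z => if z ∈ U then Complex.exp (M z) / P z else (cx z - cx a) ^ n
  have hane : ∀ z, z ∉ U → cx z - cx a ≠ 0 := fun z hz =>
    cx_sub_ne_zero fun h => hz (h ▸ ha)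
  have hFU : ∀ z ∈ closure U, F z = Complex.exp (M z) / P z := by
    intro z hz
    by_cases hzU : z ∈ U
    · simp [F, hzU]
    · have hzK := (hU.closure_subset hK.isClosed hz).resolve_left hzU
      have : Complex.exp (L z) = (cx z - cx a) ^ n * P z := he z hzK
      simp only [F, hzU, if_false]
      rw [hM' z hzK, this, mul_div_cancel_right₀ _ (hP0 z hz)]
  have hFc : Continuous F := by
    rw [← continuousOn_univ]
    have : (Set.univ : Set (ℝ × ℝ)) = closure U ∪ Uᶜ := by
      ext z
      by_cases hzU : z ∈ U
      · simp [subset_closure hzU]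
      · simp [hzU]
    rw [this]
    refine ContinuousOn.union_of_isClosed ?_ ?_ isClosed_closure hUo.isClosed_compl
    · exact ((Complex.continuous_exp.comp M.continuous).continuousOn.div hP hP0).congr hFU
    · have : ContinuousOn (fun z => (cx z - cx a) ^ n) Uᶜ := by
        intro z hz
        have h1 : ContinuousAt (fun z => cx z - cx a) z :=
          (continuous_cx.sub continuous_const).continuousAt
        exact (h1.zpow₀ n (Or.inl (hane z hz))).continuousWithinAt
      exact this.congr fun z hz => by simp only [F]; rw [if_neg hz]
  have hF0 : ∀ z, F z ≠ 0 := by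
    intro z
    by_cases hzU : z ∈ U
    · rw [hFU z (subset_closure hzU)]
      exact div_ne_zero (Complex.exp_ne_zero _) (hP0 z (subset_closure hzU))
    · simp only [F, hzU, if_false]
      exact zpow_ne_zero _ (hane z hzU)
  obtain ⟨r, hr0, hr⟩ : ∃ r : ℝ, 0 < r ∧ ∀ z ∈ circ a r, z ∉ U := by
    have hbd : Bornology.IsBounded ((fun z => cx z - cx a) '' closure U) := by
      refine IsCompact.isBounded (IsCompact.image hb.isCompact_closure ?_)
      exact continuous_cx.sub continuous_const
    obtain ⟨ρ, hρ⟩ := hbd.exists_norm_le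
    refine ⟨max ρ 0 + 1, by positivity, fun z hz hzU => ?_⟩
    have h1 := hρ _ ⟨z, subset_closure hzU, rfl⟩
    have h2 : ‖cx z - cx a‖ = max ρ 0 + 1 := hz
    have := le_max_left ρ 0
    linarith
  obtain ⟨R, hR⟩ := (isCompact_circ a r).isBounded.exists_norm_le
  have hlog : HasLogOn (Metric.closedBall (0 : ℝ × ℝ) (max R 0)) F := by
    refine hasLogOn_of_starConvex (isCompact_closedBall _ _) ?_ hFc.continuousOn fun z _ => hF0 z
    exact (convex_closedBall _ _).starConvex (by simp)
  have hlog' : HasLogOn (circ a r) F := hlog.mono fun z hz => by simpa using Or.inl (hR z hz)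
  exact eq_zero_of_hasLogOn_circ hr0 (hlog'.congr fun z hz => by simp [F, hr z hz])

theorem eq_of_hasLogOn_ratio {K f g : Set (ℝ × ℝ)} (hK : IsCompact K) (hf : IsFaceOf K f)
    (hg : IsFaceOf K g) {a b : ℝ × ℝ} (ha : a ∈ f) (hb : b ∈ g) (h : HasLogOn K (ratio a b)) :
    f = g := by
  by_contra hfg
  have key : ∀ f g, IsFaceOf K f → IsFaceOf K g → f ≠ g → ∀ a b, a ∈ f → b ∈ g →
      HasLogOn K (ratio a b) → ¬ Bornology.IsBounded f := by
    intro f g hf hg hfg a b ha hb h hbd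
    have hne : ∀ z ∈ closure f, cx z - cx b ≠ 0 := fun z hz => cx_sub_ne_zero fun h =>
      hf.notMem_closure_of_mem hK.isClosed hg hfg hb (h ▸ hz)
    have := eq_zero_of_hasLogOn_of_isBounded hK hf hbd ha (P := fun z => (cx z - cx b)⁻¹)
      (ContinuousOn.inv₀ (continuous_cx.sub continuous_const).continuousOn hne)
      (fun z hz => inv_ne_zero (hne z hz)) (n := 1)
      (h.congr fun z _ => by simp [ratio, div_eq_mul_inv])
    exact one_ne_zero this
  rcases isBounded_of_ne hK hf hg hfg with hbd | hbd
  · exact key f g hf hg hfg a b ha hb h hbd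
  · exact key g f hg hf (Ne.symm hfg) b a hb ha (h.inv.congr fun z _ => ratio_inv a b z) hbd

/-- Adding a compact set that meets `K` in a preconnected set and carries all logarithms does
not separate any face of `K`. -/
theorem eq_of_dangling {K A f g h : Set (ℝ × ℝ)} (hK : IsCompact K) (hA : IsCompact A)
    (hlog : ∀ a b, a ∉ A → b ∉ A → HasLogOn A (ratio a b)) (hKA : IsPreconnected (K ∩ A))
    (hf : IsFaceOf K f) (hg : IsFaceOf (K ∪ A) g) (hh : IsFaceOf (K ∪ A) h)
    (hgf : g ⊆ f) (hhf : h ⊆ f) : g = h := by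
  obtain ⟨a, ha⟩ := hg.nonempty
  obtain ⟨b, hb⟩ := hh.nonempty
  refine eq_of_hasLogOn_ratio (hK.union hA) hg hh ha hb ?_
  refine HasLogOn.union hK.isClosed hA.isClosed ?_ ?_ hKA
  · exact hasLogOn_ratio_of_isPreconnected hK.isClosed hf.isPreconnected hf.disjoint
      (hgf ha) (hhf hb)
  · exact hlog a b (fun h => hg.notMem ha (Or.inr h)) (fun h => hh.notMem hb (Or.inr h))

theorem face_eq_of_dangling {K A f g : Set (ℝ × ℝ)} (hK : IsCompact K) (hA : IsCompact A)
    (hlog : ∀ a b, a ∉ A → b ∉ A → HasLogOn A (ratio a b)) (hKA : IsPreconnected (K ∩ A))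
    (hf : IsFaceOf K f) (hg : IsFaceOf (K ∪ A) g) (hgf : g ⊆ f) : g = f \ A := by
  refine Set.Subset.antisymm (fun z hz => ⟨hgf hz, fun h => hg.notMem hz (Or.inr h)⟩) ?_
  rintro z ⟨hz, hzA⟩
  have hzK : z ∉ K ∪ A := fun h => h.elim (hf.notMem hz) hzA
  have hh := IsFaceOf.of_notMem hzK
  have hzh := mem_connectedComponentIn (F := (K ∪ A)ᶜ) hzK
  rw [eq_of_dangling hK hA hlog hKA hf hg hh hgf
    (hh.subset_of_mem hf Set.subset_union_left hzh hz)]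
  exact hzh

/-- A compact subset of a preconnected open set lies in a compact preconnected subset. -/
theorem exists_compact_preconnected {U T : Set (ℝ × ℝ)} (hU : IsOpen U) (hUc : IsPreconnected U)
    (hT : IsCompact T) (hTU : T ⊆ U) :
    ∃ Q, IsCompact Q ∧ IsPreconnected Q ∧ T ⊆ Q ∧ Q ⊆ U := by
  rcases U.eq_empty_or_nonempty with rfl | ⟨x₀, hx₀⟩
  · exact ⟨∅, isCompact_empty, isPreconnected_empty, hTU, le_rfl⟩
  have hpc : IsPathConnected U := hU.isConnected_iff_isPathConnected.1 ⟨⟨x₀, hx₀⟩, hUc⟩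
  have hex : ∀ x ∈ U, ∃ ε > 0, Metric.closedBall x ε ⊆ U := fun x hx =>
    Metric.nhds_basis_closedBall.mem_iff.1 (hU.mem_nhds hx)
  have : ∀ x ∈ U, ∃ Q, IsCompact Q ∧ IsPreconnected Q ∧ x₀ ∈ Q ∧ Q ∈ nhds x ∧ Q ⊆ U := by
    intro x hx
    obtain ⟨ε, hε, hball⟩ := hex x hx
    obtain ⟨γ, hγ⟩ := hpc.joinedIn x₀ hx₀ x hx
    refine ⟨Metric.closedBall x ε ∪ Set.range γ,
      (isCompact_closedBall _ _).union (isCompact_range γ.continuous), ?_, ?_, ?_, ?_⟩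
    · refine IsPreconnected.union x (Metric.mem_closedBall_self hε.le) ⟨1, γ.target⟩
        (convex_closedBall _ _).isPreconnected (isPreconnected_range γ.continuous)
    · exact Or.inr ⟨0, γ.source⟩
    · exact Filter.mem_of_superset (Metric.closedBall_mem_nhds x hε) Set.subset_union_left
    · exact Set.union_subset hball (by rintro _ ⟨t, rfl⟩; exact hγ t)
  choose! Q hQc hQp hQ0 hQn hQU using this
  obtain ⟨t, ht, hTt⟩ := hT.elim_nhds_subcover Q fun x hx => hQn x (hTU hx)
  refine ⟨{x₀} ∪ ⋃ x ∈ t, Q x, isCompact_singleton.union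
    (t.finite_toSet.isCompact_biUnion fun x hx => hQc x (hTU (ht x hx))), ?_,
    hTt.trans Set.subset_union_right, ?_⟩
  · have h1 : {x₀} ∪ ⋃ x ∈ t, Q x = ⋃₀ (insert {x₀} (Q '' t)) := by
      simp [Set.sUnion_insert, Set.sUnion_image]
    rw [h1]
    refine isPreconnected_sUnion x₀ _ ?_ ?_
    · rintro s (rfl | ⟨x, hx, rfl⟩)
      · exact rfl
      · exact hQ0 x (hTU (ht x hx))
    · rintro s (rfl | ⟨x, hx, rfl⟩)
      · exact isPreconnected_singleton
      · exact hQp x (hTU (ht x hx))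
  · refine Set.union_subset (by simpa using hx₀)
      (Set.iUnion₂_subset fun x hx => hQU x (hTU (ht x hx)))

/-- `A` is a simple arc from `p` to `q`. -/
def IsArc (A : Set (ℝ × ℝ)) (p q : ℝ × ℝ) : Prop :=
  ∃ γ : ℝ → ℝ × ℝ, ContinuousOn γ (Set.Icc 0 1) ∧ Set.InjOn γ (Set.Icc 0 1) ∧
    γ 0 = p ∧ γ 1 = q ∧ γ '' Set.Icc 0 1 = A

theorem isArc_image_Icc {γ : ℝ → ℝ × ℝ} (hc : ContinuousOn γ (Set.Icc 0 1))
    (hi : Set.InjOn γ (Set.Icc 0 1)) {s t : ℝ} (hs : 0 ≤ s) (hst : s < t) (ht : t ≤ 1) :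
    IsArc (γ '' Set.Icc s t) (γ s) (γ t) := by
  have hmaps : Set.MapsTo (fun u : ℝ => s + u * (t - s)) (Set.Icc 0 1) (Set.Icc 0 1) := by
    rintro u ⟨h0, h1⟩
    constructor
    · nlinarith
    · nlinarith
  refine ⟨fun u => γ (s + u * (t - s)), hc.comp (by fun_prop) hmaps, ?_, by simp, by simp, ?_⟩
  · intro u hu v hv huv
    have := hi (hmaps hu) (hmaps hv) huv
    have h2 : u * (t - s) = v * (t - s) := by linarith
    exact mul_right_cancel₀ (sub_pos.2 hst).ne' h2
  · ext z
    constructor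
    · rintro ⟨u, ⟨h0, h1⟩, rfl⟩
      exact ⟨_, ⟨by nlinarith, by nlinarith⟩, rfl⟩
    · rintro ⟨u, ⟨h0, h1⟩, rfl⟩
      have hpos := sub_pos.2 hst
      refine ⟨(u - s) / (t - s), ⟨by apply div_nonneg <;> linarith, ?_⟩, ?_⟩
      · rw [div_le_one hpos]; linarith
      · dsimp only
        rw [div_mul_cancel₀ _ hpos.ne']; congr 1; ring

namespace IsArc

variable {A B : Set (ℝ × ℝ)} {p q : ℝ × ℝ}

theorem isCompact (h : IsArc A p q) : IsCompact A := by
  obtain ⟨γ, hc, -, -, -, rfl⟩ := h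
  exact isCompact_Icc.image_of_continuousOn hc

theorem isPreconnected (h : IsArc A p q) : IsPreconnected A := by
  obtain ⟨γ, hc, -, -, -, rfl⟩ := h
  exact isPreconnected_Icc.image γ hc

theorem left_mem (h : IsArc A p q) : p ∈ A := by
  obtain ⟨γ, hc, -, rfl, -, rfl⟩ := h
  exact ⟨0, by simp, rfl⟩

theorem right_mem (h : IsArc A p q) : q ∈ A := by
  obtain ⟨γ, hc, -, -, rfl, rfl⟩ := h
  exact ⟨1, by simp, rfl⟩

theorem ne (h : IsArc A p q) : p ≠ q := by
  obtain ⟨γ, hc, hi, rfl, rfl, rfl⟩ := h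
  intro h
  exact zero_ne_one (hi (by simp) (by simp) h)

theorem diff_endpoints {γ : ℝ → ℝ × ℝ} (hi : Set.InjOn γ (Set.Icc 0 1)) :
    γ '' Set.Icc 0 1 \ {γ 0, γ 1} = γ '' Set.Ioo 0 1 := by
  ext z
  constructor
  · rintro ⟨⟨t, ht, rfl⟩, hz⟩
    simp only [Set.mem_insert_iff, Set.mem_singleton_iff, not_or] at hz
    refine ⟨t, ⟨lt_of_le_of_ne ht.1 ?_, lt_of_le_of_ne ht.2 ?_⟩, rfl⟩
    · rintro rfl; exact hz.1 rfl
    · rintro rfl; exact hz.2 rfl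
  · rintro ⟨t, ht, rfl⟩
    refine ⟨⟨t, Set.Ioo_subset_Icc_self ht, rfl⟩, ?_⟩
    simp only [Set.mem_insert_iff, Set.mem_singleton_iff, not_or]
    constructor
    · intro h
      exact ht.1.ne' (hi (Set.Ioo_subset_Icc_self ht) (by simp) h)
    · intro h
      exact ht.2.ne (hi (Set.Ioo_subset_Icc_self ht) (by simp) h)

theorem isPreconnected_diff (h : IsArc A p q) : IsPreconnected (A \ {p, q}) := by
  obtain ⟨γ, hc, hi, rfl, rfl, rfl⟩ := h
  rw [diff_endpoints hi]
  exact isPreconnected_Ioo.image γ (hc.mono Set.Ioo_subset_Icc_self)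

theorem diff_nonempty (h : IsArc A p q) : (A \ {p, q}).Nonempty := by
  obtain ⟨γ, hc, hi, rfl, rfl, rfl⟩ := h
  rw [diff_endpoints hi]
  exact ⟨γ (1 / 2), 1 / 2, by norm_num, rfl⟩

theorem subset_closure_diff (h : IsArc A p q) : A ⊆ closure (A \ {p, q}) := by
  obtain ⟨γ, hc, hi, rfl, rfl, rfl⟩ := h
  rw [diff_endpoints hi]
  have : Set.Icc (0 : ℝ) 1 = closure (Set.Ioo 0 1) := (closure_Ioo zero_ne_one).symm
  rw [this] at hc ⊢
  exact hc.image_closure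

theorem hasLogOn (h : IsArc A p q) {F : ℝ × ℝ → ℂ} (hF : ContinuousOn F A)
    (h0 : ∀ z ∈ A, F z ≠ 0) : HasLogOn A F := by
  obtain ⟨γ, hc, hi, rfl, rfl, rfl⟩ := h
  obtain ⟨L, hL, he⟩ := hasLogOn_of_starConvex (D := Set.Icc (0 : ℝ) 1) (F := F ∘ γ) isCompact_Icc
    ((convex_Icc 0 1).starConvex (by simp)) (hF.comp hc fun t ht => ⟨t, ht, rfl⟩)
    fun t ht => h0 _ ⟨t, ht, rfl⟩
  have hce : Topology.IsClosedEmbedding ((Set.Icc (0 : ℝ) 1).domRestrict γ) :=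
    (continuousOn_iff_continuous_domRestrict.1 hc).isClosedEmbedding
      (Set.injOn_iff_injective.1 hi)
  refine ⟨fun z => L (Function.invFunOn γ (Set.Icc 0 1) z), ?_, ?_⟩
  · refine continuousOn_iff_isClosed.2 fun t ht => ?_
    obtain ⟨u, hu, hut⟩ := continuousOn_iff_isClosed.1 hL t ht
    refine ⟨γ '' (L ⁻¹' t ∩ Set.Icc 0 1), ?_, ?_⟩
    · rw [hut]
      exact ((isCompact_Icc.inter_left hu).image_of_continuousOn
        (hc.mono Set.inter_subset_right)).isClosed
    · ext z
      constructor
      · rintro ⟨hz, s, hs, rfl⟩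
        refine ⟨⟨s, ⟨?_, hs⟩, rfl⟩, s, hs, rfl⟩
        simpa [hi.leftInvOn_invFunOn hs] using hz
      · rintro ⟨⟨s, hs, rfl⟩, -⟩
        refine ⟨?_, s, hs.2, rfl⟩
        simpa [hi.leftInvOn_invFunOn hs.2] using hs.1
  · rintro _ ⟨s, hs, rfl⟩
    simpa [hi.leftInvOn_invFunOn hs] using he s hs

theorem hasLogOn_ratio (h : IsArc A p q) (a b : ℝ × ℝ) (ha : a ∉ A) (hb : b ∉ A) :
    HasLogOn A (ratio a b) :=
  h.hasLogOn (continuousOn_ratio hb) fun _ hz =>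
    ratio_ne_zero (fun h => ha (h ▸ hz)) fun h => hb (h ▸ hz)

end IsArc

/-- An arc attached at both of its endpoints to a compact connected set. -/
structure AttachedArc (B A : Set (ℝ × ℝ)) (p q : ℝ × ℝ) : Prop where
  isCompact : IsCompact B
  isPreconnected : IsPreconnected B
  isArc : IsArc A p q
  inter : A ∩ B = {p, q}

namespace AttachedArc

variable {A B f₀ g : Set (ℝ × ℝ)} {p q : ℝ × ℝ}

theorem left_mem (h : AttachedArc B A p q) : p ∈ B :=
  (h.inter.symm ▸ Set.mem_insert p {q} : p ∈ A ∩ B).2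

theorem right_mem (h : AttachedArc B A p q) : q ∈ B :=
  (h.inter.symm ▸ Set.mem_insert_of_mem p rfl : q ∈ A ∩ B).2

theorem disjoint_diff (h : AttachedArc B A p q) : Disjoint (A \ {p, q}) B :=
  Set.disjoint_left.2 fun _ hz hzB => hz.2 (h.inter ▸ ⟨hz.1, hzB⟩)

theorem union_isCompact (h : AttachedArc B A p q) : IsCompact (B ∪ A) :=
  h.isCompact.union h.isArc.isCompact

theorem exists_face (h : AttachedArc B A p q) : ∃ f₀, IsFaceOf B f₀ ∧ A \ {p, q} ⊆ f₀ := by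
  obtain ⟨z, hz⟩ := h.isArc.diff_nonempty
  have hzB : z ∉ B := Set.disjoint_left.1 h.disjoint_diff hz
  exact ⟨_, IsFaceOf.of_notMem hzB, h.isArc.isPreconnected_diff.subset_connectedComponentIn hz
    (Set.disjoint_left.1 h.disjoint_diff)⟩

/-- Every face contained in the face that hosts the arc has the whole arc on its boundary. -/
theorem subset_closure (h : AttachedArc B A p q) (hf₀ : IsFaceOf B f₀)
    (hAf : A \ {p, q} ⊆ f₀) (hg : IsFaceOf (B ∪ A) g) (hgf : g ⊆ f₀) : A ⊆ closure g := by
  refine h.isArc.subset_closure_diff.trans (closure_minimal ?_ isClosed_closure)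
  have hK := h.union_isCompact
  have hABmem : ∀ z ∈ A, z ∈ B → z = p ∨ z = q := fun z hzA hzB => by
    have : z ∈ A ∩ B := ⟨hzA, hzB⟩
    rwa [h.inter] at this
  obtain ⟨γ, hc, hi, hp, hq, hA⟩ := h.isArc
  rw [← hA, ← hp, ← hq, IsArc.diff_endpoints hi]
  rintro _ ⟨t, ht, rfl⟩
  by_contra hx
  have hcat : ContinuousAt γ t := hc.continuousAt (Icc_mem_nhds ht.1 ht.2)
  have hn : γ ⁻¹' (closure g)ᶜ ∩ Set.Ioo 0 1 ∈ nhds t :=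
    Filter.inter_mem (hcat.preimage_mem_nhds (isClosed_closure.isOpen_compl.mem_nhds hx))
      (Ioo_mem_nhds ht.1 ht.2)
  obtain ⟨ε, hε, hball⟩ := Metric.nhds_basis_closedBall.mem_iff.1 hn
  have hs1 := hball (show t - ε ∈ Metric.closedBall t ε by
    simp [Real.closedBall_eq_Icc]; linarith)
  have hs2 := hball (show t + ε ∈ Metric.closedBall t ε by
    simp [Real.closedBall_eq_Icc]; linarith)
  set s₁ := t - ε with hs₁
  set s₂ := t + ε with hs₂
  have h01 : 0 < s₁ := hs1.2.1
  have h21 : s₂ < 1 := hs2.2.2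
  have hA1 := isArc_image_Icc hc hi le_rfl h01 (by linarith)
  have hA2 := isArc_image_Icc hc hi (by linarith) h21 le_rfl
  set A₁ := γ '' Set.Icc 0 s₁
  set A₂ := γ '' Set.Icc s₂ 1
  have hsub1 : A₁ ⊆ A := hA ▸ Set.image_mono (Set.Icc_subset_Icc le_rfl (by linarith))
  have hsub2 : A₂ ⊆ A := hA ▸ Set.image_mono (Set.Icc_subset_Icc (by linarith) le_rfl)
  have hBA1 : IsPreconnected (B ∩ A₁) := by
    refine Set.Subsingleton.isPreconnected ?_
    have : ∀ z ∈ B ∩ A₁, z = γ 0 := by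
      rintro z ⟨hzB, u, hu, rfl⟩
      rcases hABmem _ (hsub1 ⟨u, hu, rfl⟩) hzB with h | h
      · rw [hp, h]
      · rw [← hq] at h
        have := hi ⟨hu.1, by linarith [hu.2]⟩ (by simp) h
        linarith [hu.2]
    intro z hz w hw
    rw [this z hz, this w hw]
  have hBA2 : IsPreconnected ((B ∪ A₁) ∩ A₂) := by
    refine Set.Subsingleton.isPreconnected ?_
    have : ∀ z ∈ (B ∪ A₁) ∩ A₂, z = γ 1 := by
      rintro z ⟨hzB, u, hu, rfl⟩
      have hu01 : u ∈ Set.Icc (0 : ℝ) 1 := ⟨by linarith [hu.1], hu.2⟩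
      rcases hzB with hzB | ⟨v, hv, hvu⟩
      · rcases hABmem _ (hsub2 ⟨u, hu, rfl⟩) hzB with h | h
        · rw [← hp] at h
          have := hi hu01 (by simp) h
          linarith [hu.1]
        · rw [h, hq]
      · have := hi ⟨hv.1, by linarith [hv.2]⟩ hu01 hvu
        linarith [hu.1, hv.2]
    intro z hz w hw
    rw [this z hz, this w hw]
  have hg' : IsFaceOf (B ∪ A₁ ∪ A₂) g := by
    refine hg.of_frontier hK.isClosed (by
      rw [Set.union_assoc]; exact Set.union_subset_union_right _ (Set.union_subset hsub1 hsub2)) ?_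
    rintro z ⟨hz, hzB | hzA⟩
    · exact Or.inl (Or.inl hzB)
    · rw [← hA] at hzA
      obtain ⟨u, hu, rfl⟩ := hzA
      rcases le_or_gt u s₁ with h1 | h1
      · exact Or.inl (Or.inr ⟨u, ⟨hu.1, h1⟩, rfl⟩)
      rcases le_or_gt s₂ u with h2 | h2
      · exact Or.inr ⟨u, ⟨h2, hu.2⟩, rfl⟩
      · exact absurd hz (hball (show u ∈ Metric.closedBall t ε by
          rw [Real.closedBall_eq_Icc]; exact ⟨h1.le, h2.le⟩)).1
  obtain ⟨g₁, hg₁, hgg₁⟩ := hg'.exists_superset (D' := B ∪ A₁) Set.subset_union_left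
  obtain ⟨z, hz⟩ := hg.nonempty
  have e1 := face_eq_of_dangling h.isCompact hA1.isCompact hA1.hasLogOn_ratio hBA1 hf₀ hg₁
    (hg₁.subset_of_mem hf₀ Set.subset_union_left (hgg₁ hz) (hgf hz))
  have e2 := face_eq_of_dangling (h.isCompact.union hA1.isCompact) hA2.isCompact
    hA2.hasLogOn_ratio hBA2 hg₁ hg' hgg₁
  have htA : γ t ∈ A := hA ▸ ⟨t, Set.Ioo_subset_Icc_self ht, rfl⟩
  have htf : γ t ∈ f₀ := hAf (by
    rw [← hA, ← hp, ← hq, IsArc.diff_endpoints hi]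
    exact ⟨t, ht, rfl⟩)
  refine hg.notMem (z := γ t) ?_ (Or.inr htA)
  rw [e2, e1]
  refine ⟨⟨htf, ?_⟩, ?_⟩
  · rintro ⟨u, hu, hut⟩
    have := hi ⟨hu.1, by linarith [hu.2]⟩ (Set.Ioo_subset_Icc_self ht) hut
    linarith [hu.2]
  · rintro ⟨u, hu, hut⟩
    have := hi ⟨by linarith [hu.1], hu.2⟩ (Set.Ioo_subset_Icc_self ht) hut
    linarith [hu.1]

theorem exists_two_faces (h : AttachedArc B A p q) (hf₀ : IsFaceOf B f₀)
    (hAf : A \ {p, q} ⊆ f₀) : ∃ g g', IsFaceOf (B ∪ A) g ∧ IsFaceOf (B ∪ A) g' ∧ g ≠ g' ∧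
      g ⊆ f₀ ∧ g' ⊆ f₀ := by
  by_contra! hcon
  have hBc := h.isCompact.isClosed
  have hAc := h.isArc.isCompact.isClosed
  have hK := h.union_isCompact.isClosed
  have hf₀o := hf₀.isOpen hBc
  have hconn : IsPreconnected (f₀ \ A) := by
    rcases (f₀ \ A).eq_empty_or_nonempty with he | ⟨z, hz⟩
    · rw [he]; exact isPreconnected_empty
    have hface : ∀ w ∈ f₀ \ A, w ∉ B ∪ A := fun w hw => by
      rintro (h | h)
      · exact hf₀.notMem hw.1 h
      · exact hw.2 h
    have hsub : ∀ w ∈ f₀ \ A, connectedComponentIn (B ∪ A)ᶜ w ⊆ f₀ := fun w hw =>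
      (IsFaceOf.of_notMem (hface w hw)).subset_of_mem hf₀ Set.subset_union_left
        (mem_connectedComponentIn (F := (B ∪ A)ᶜ) (hface w hw)) hw.1
    have : f₀ \ A = connectedComponentIn (B ∪ A)ᶜ z := by
      refine Set.Subset.antisymm (fun w hw => ?_) fun w hw => ⟨hsub z hz hw, fun hwA => ?_⟩
      · have : connectedComponentIn (B ∪ A)ᶜ z = connectedComponentIn (B ∪ A)ᶜ w := by
          by_contra hne
          exact hcon _ _ (IsFaceOf.of_notMem (hface z hz)) (IsFaceOf.of_notMem (hface w hw)) hne
            (hsub z hz) (hsub w hw)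
        rw [this]
        exact mem_connectedComponentIn (F := (B ∪ A)ᶜ) (hface w hw)
      · exact (IsFaceOf.of_notMem (hface z hz)).notMem hw (Or.inr hwA)
    rw [this]
    exact isPreconnected_connectedComponentIn
  have hpq : 0 < ‖cx q - cx p‖ := norm_pos_iff.2 (cx_sub_ne_zero h.isArc.ne.symm)
  set r := ‖cx q - cx p‖ / 2 with hr
  have hr0 : 0 < r := half_pos hpq
  have hrq : r < ‖cx q - cx p‖ := half_lt_self hpq
  have hS := isCompact_circ p r
  have hpS : p ∉ circ p r := fun h => by
    have : ‖cx p - cx p‖ = r := h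
    rw [sub_self, norm_zero] at this; exact hr0.ne this
  have hqS : q ∉ circ p r := fun h => by
    have : ‖cx q - cx p‖ = r := h
    rw [this] at hrq; exact lt_irrefl _ hrq
  obtain ⟨SA, SB, hSA, hSB, hSAA, hSBB, hSeq⟩ := hS.binary_compact_cover hAc.isOpen_compl
    hBc.isOpen_compl (by
      intro z hz
      by_contra hzz
      simp only [Set.mem_union, Set.mem_compl_iff, not_or, not_not] at hzz
      have : z ∈ A ∩ B := hzz
      rw [h.inter] at this
      rcases this with rfl | rfl
      · exact hpS hz
      · exact hqS hz)
  have hAsub : ∀ z ∈ A, z ∈ f₀ ∨ z ∈ B := by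
    intro z hz
    by_cases hzpq : z ∈ ({p, q} : Set (ℝ × ℝ))
    · exact Or.inr (by rcases hzpq with rfl | rfl; exacts [h.left_mem, h.right_mem])
    · exact Or.inl (hAf ⟨hz, hzpq⟩)
  set SA' := SA ∪ SB \ f₀ with hSA'
  set SB' := SB ∩ closure f₀ with hSB'
  have hSBf : ∀ z ∈ SB', z ∈ f₀ := fun z hz =>
    (hf₀.closure_subset hBc hz.2).resolve_right (hSBB hz.1)
  have hSA'c : IsCompact SA' := hSA.union (hSB.diff hf₀o)
  have hSB'c : IsCompact SB' := hSB.inter_right isClosed_closure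
  have hSA'A : Disjoint A SA' := by
    refine Set.disjoint_left.2 fun z hz => ?_
    rintro (hzS | hzS)
    · exact hSAA hzS hz
    · exact (hAsub z hz).elim hzS.2 (hSBB hzS.1)
  have hSB'B : Disjoint B SB' := Set.disjoint_left.2 fun z hz hzS => hSBB hzS.1 hz
  have hT : SA' ∩ SB' ⊆ f₀ \ A := fun z hz =>
    ⟨hSBf z hz.2, fun hzA => Set.disjoint_left.1 hSA'A hzA hz.1⟩
  obtain ⟨Q, hQ, hQc, hTQ, hQf⟩ := exists_compact_preconnected (hf₀o.sdiff hAc) hconn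
    (hSA'c.inter hSB'c) hT
  have l1 : HasLogOn (SA' ∪ Q) (ratio p q) := by
    refine hasLogOn_ratio_of_isPreconnected (hSA'c.union hQ).isClosed h.isArc.isPreconnected ?_
      h.isArc.left_mem h.isArc.right_mem
    exact Set.disjoint_union_right.2 ⟨hSA'A, Set.disjoint_left.2 fun z hz hzQ => (hQf hzQ).2 hz⟩
  have l2 : HasLogOn (SB' ∪ Q) (ratio p q) := by
    refine hasLogOn_ratio_of_isPreconnected (hSB'c.union hQ).isClosed h.isPreconnected ?_
      h.left_mem h.right_mem
    exact Set.disjoint_union_right.2 ⟨hSB'B, Set.disjoint_left.2 fun z hz hzQ =>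
      hf₀.notMem (hQf hzQ).1 hz⟩
  have hinter : (SA' ∪ Q) ∩ (SB' ∪ Q) = Q := by
    rw [← Set.inter_union_distrib_right]
    exact Set.union_eq_right.2 hTQ
  refine not_hasLogOn_ratio_circ hr0 hrq ((l1.union (hSA'c.union hQ).isClosed
    (hSB'c.union hQ).isClosed l2 (by rw [hinter]; exact hQc)).mono ?_)
  rw [hSeq]
  rintro z (hz | hz)
  · exact Or.inl (Or.inl (Or.inl hz))
  · by_cases hzf : z ∈ f₀
    · exact Or.inr (Or.inl ⟨hz, _root_.subset_closure hzf⟩)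
    · exact Or.inl (Or.inl (Or.inr ⟨hz, hzf⟩))

theorem hasLogOn_union (h : AttachedArc B A p q) {F L M : ℝ × ℝ → ℂ} (hL : ContinuousOn L A)
    (hM : ContinuousOn M B) (heL : ∀ z ∈ A, Complex.exp (L z) = F z)
    (heM : ∀ z ∈ B, Complex.exp (M z) = F z) (hd : L p - M p = L q - M q) :
    HasLogOn (B ∪ A) F := by
  rw [Set.union_comm]
  refine HasLogOn.union_of_const h.isArc.isCompact.isClosed h.isCompact.isClosed hL hM heL heM
    (fun z hz => heM z hz.2 ▸ Complex.exp_ne_zero _) ?_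
  rw [h.inter]
  rintro x (rfl | rfl) y (rfl | rfl)
  exacts [rfl, hd, hd.symm, rfl]

theorem exists_jump (h : AttachedArc B A p q) {F L M : ℝ × ℝ → ℂ}
    (heL : ∀ z ∈ A, Complex.exp (L z) = F z) (heM : ∀ z ∈ B, Complex.exp (M z) = F z) :
    ∃ n : ℤ, (L p - M p) - (L q - M q) = n * (2 * Real.pi * Complex.I) := by
  have key : ∀ z ∈ A, z ∈ B → Complex.exp (L z - M z) = 1 := fun z hz hz' => by
    rw [Complex.exp_sub, heL z hz, heM z hz']
    exact div_self (heM z hz' ▸ Complex.exp_ne_zero _)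
  rw [← Complex.exp_eq_one_iff, Complex.exp_sub, key p h.isArc.left_mem h.left_mem,
    key q h.isArc.right_mem h.right_mem, div_one]

theorem eq_of_isBounded (h : AttachedArc B A p q) (hf₀ : IsFaceOf B f₀) {g₁ g₂ g₃ : Set (ℝ × ℝ)}
    (hg₁ : IsFaceOf (B ∪ A) g₁) (hg₂ : IsFaceOf (B ∪ A) g₂) (hg₃ : IsFaceOf (B ∪ A) g₃)
    (h₁ : g₁ ⊆ f₀) (h₂ : g₂ ⊆ f₀) (h₃ : g₃ ⊆ f₀) (hb : Bornology.IsBounded g₁) (h12 : g₁ ≠ g₂)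
    (h13 : g₁ ≠ g₃) : g₂ = g₃ := by
  obtain ⟨a₁, ha₁⟩ := hg₁.nonempty
  obtain ⟨a₂, ha₂⟩ := hg₂.nonempty
  obtain ⟨a₃, ha₃⟩ := hg₃.nonempty
  have hK := h.union_isCompact
  have logB : ∀ {g g' a b}, IsFaceOf (B ∪ A) g → IsFaceOf (B ∪ A) g' → g ⊆ f₀ → g' ⊆ f₀ →
      a ∈ g → b ∈ g' → HasLogOn B (ratio a b) := fun _ _ h1 h2 ha hb =>
    hasLogOn_ratio_of_isPreconnected h.isCompact.isClosed hf₀.isPreconnected hf₀.disjoint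
      (h1 ha) (h2 hb)
  have logA : ∀ {g g' a b}, IsFaceOf (B ∪ A) g → IsFaceOf (B ∪ A) g' →
      a ∈ g → b ∈ g' → HasLogOn A (ratio a b) := fun hg hg' ha hb =>
    h.isArc.hasLogOn_ratio _ _ (fun h => hg.notMem ha (Or.inr h)) fun h =>
      hg'.notMem hb (Or.inr h)
  obtain ⟨L₁, hL₁, heL₁⟩ := logA hg₁ hg₃ ha₁ ha₃
  obtain ⟨M₁, hM₁, heM₁⟩ := logB hg₁ hg₃ h₁ h₃ ha₁ ha₃
  obtain ⟨L₂, hL₂, heL₂⟩ := logA hg₂ hg₃ ha₂ ha₃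
  obtain ⟨M₂, hM₂, heM₂⟩ := logB hg₂ hg₃ h₂ h₃ ha₂ ha₃
  obtain ⟨n₁, hn₁⟩ := h.exists_jump heL₁ heM₁
  obtain ⟨n₂, hn₂⟩ := h.exists_jump heL₂ heM₂
  have hlog : HasLogOn (B ∪ A) fun z => ratio a₁ a₃ z ^ n₂ * (ratio a₂ a₃ z ^ n₁)⁻¹ := by
    refine h.hasLogOn_union (L := fun z => n₂ * L₁ z - n₁ * L₂ z)
      (M := fun z => n₂ * M₁ z - n₁ * M₂ z) ((continuousOn_const.mul hL₁).sub
      (continuousOn_const.mul hL₂)) ((continuousOn_const.mul hM₁).sub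
      (continuousOn_const.mul hM₂)) ?_ ?_ ?_
    · intro z hz
      rw [Complex.exp_sub, Complex.exp_int_mul, Complex.exp_int_mul, heL₁ z hz, heL₂ z hz,
        div_eq_mul_inv]
    · intro z hz
      rw [Complex.exp_sub, Complex.exp_int_mul, Complex.exp_int_mul, heM₁ z hz, heM₂ z hz,
        div_eq_mul_inv]
    · linear_combination n₂ * hn₁ - n₁ * hn₂
  have hn : ∀ {g a}, IsFaceOf (B ∪ A) g → g₁ ≠ g → a ∈ g → ∀ z ∈ closure g₁, z ≠ a :=
    fun hg hne ha z hz h => hg₁.notMem_closure_of_mem hK.isClosed hg hne ha (h ▸ hz)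
  have hn2 := hn hg₂ h12 ha₂
  have hn3 := hn hg₃ h13 ha₃
  have hcr : ContinuousOn (ratio a₂ a₃) (closure g₁) :=
    continuousOn_ratio fun h => hn3 a₃ h rfl
  have hzero : n₂ = 0 := by
    refine eq_zero_of_hasLogOn_of_isBounded hK hg₁ hb ha₁
      (P := fun z => ((cx z - cx a₃) ^ n₂)⁻¹ * (ratio a₂ a₃ z ^ n₁)⁻¹) ?_ ?_
      (hlog.congr fun z _ => ?_)
    · refine ContinuousOn.mul (ContinuousOn.inv₀ (ContinuousOn.zpow₀
        (continuous_cx.sub continuous_const).continuousOn _ fun z hz =>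
          Or.inl (cx_sub_ne_zero (hn3 z hz))) ?_)
        (ContinuousOn.inv₀ (hcr.zpow₀ _ fun z hz => Or.inl
          (ratio_ne_zero (hn2 z hz) (hn3 z hz))) ?_)
      · exact fun z hz => zpow_ne_zero _ (cx_sub_ne_zero (hn3 z hz))
      · exact fun z hz => zpow_ne_zero _ (ratio_ne_zero (hn2 z hz) (hn3 z hz))
    · exact fun z hz => mul_ne_zero (inv_ne_zero (zpow_ne_zero _ (cx_sub_ne_zero (hn3 z hz))))
        (inv_ne_zero (zpow_ne_zero _ (ratio_ne_zero (hn2 z hz) (hn3 z hz))))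
    · show ratio a₁ a₃ z ^ n₂ * _ = _
      rw [show ratio a₁ a₃ z = (cx z - cx a₁) / (cx z - cx a₃) from rfl, div_zpow,
        div_eq_mul_inv, mul_assoc]
  refine eq_of_hasLogOn_ratio hK hg₂ hg₃ ha₂ ha₃ (h.hasLogOn_union hL₂ hM₂ heL₂ heM₂ ?_)
  rw [hzero, Int.cast_zero, zero_mul] at hn₂
  exact sub_eq_zero.1 hn₂

theorem eq_or_eq_of_subset (h : AttachedArc B A p q) (hf₀ : IsFaceOf B f₀)
    {g₁ g₂ g₃ : Set (ℝ × ℝ)} (hg₁ : IsFaceOf (B ∪ A) g₁) (hg₂ : IsFaceOf (B ∪ A) g₂)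
    (hg₃ : IsFaceOf (B ∪ A) g₃) (h₁ : g₁ ⊆ f₀) (h₂ : g₂ ⊆ f₀) (h₃ : g₃ ⊆ f₀) (h12 : g₁ ≠ g₂) :
    g₃ = g₁ ∨ g₃ = g₂ := by
  by_contra! hne
  rcases isBounded_of_ne h.union_isCompact hg₁ hg₂ h12 with hb | hb
  · exact hne.2 (h.eq_of_isBounded hf₀ hg₁ hg₂ hg₃ h₁ h₂ h₃ hb h12 hne.1.symm).symm
  · exact hne.1 (h.eq_of_isBounded hf₀ hg₂ hg₁ hg₃ h₂ h₁ h₃ hb h12.symm hne.2.symm).symm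

/-- A face touching an interior point of the attached arc lies in the host face. -/
theorem subset_of_touch (h : AttachedArc B A p q) (hf₀ : IsFaceOf B f₀)
    (hAf : A \ {p, q} ⊆ f₀) (hg : IsFaceOf (B ∪ A) g) {z : ℝ × ℝ} (hz : z ∈ A \ {p, q})
    (hzg : z ∈ closure g) : g ⊆ f₀ := by
  obtain ⟨w, hw, hwg⟩ := mem_closure_iff.1 hzg _ (hf₀.isOpen h.isCompact.isClosed) (hAf hz)
  exact hg.subset_of_mem hf₀ Set.subset_union_left hwg hw

theorem subset_closure_iff (h : AttachedArc B A p q) (hf₀ : IsFaceOf B f₀)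
    (hAf : A \ {p, q} ⊆ f₀) (hg : IsFaceOf (B ∪ A) g) : A ⊆ closure g ↔ g ⊆ f₀ := by
  refine ⟨fun hA => ?_, h.subset_closure hf₀ hAf hg⟩
  obtain ⟨z, hz⟩ := h.isArc.diff_nonempty
  exact h.subset_of_touch hf₀ hAf hg hz (hA hz.1)

theorem subset_closure_of_touch (h : AttachedArc B A p q) (hg : IsFaceOf (B ∪ A) g) {z : ℝ × ℝ}
    (hz : z ∈ A \ {p, q}) (hzg : z ∈ closure g) : A ⊆ closure g := by
  obtain ⟨f₀, hf₀, hAf⟩ := h.exists_face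
  exact h.subset_closure hf₀ hAf hg (h.subset_of_touch hf₀ hAf hg hz hzg)

/-- Exactly two faces have the attached arc on their boundary. -/
theorem exists_two (h : AttachedArc B A p q) : ∃ g g', IsFaceOf (B ∪ A) g ∧
    IsFaceOf (B ∪ A) g' ∧ g ≠ g' ∧ A ⊆ closure g ∧ A ⊆ closure g' ∧
    ∀ k, IsFaceOf (B ∪ A) k → A ⊆ closure k → k = g ∨ k = g' := by
  obtain ⟨f₀, hf₀, hAf⟩ := h.exists_face
  obtain ⟨g, g', hg, hg', hne, h1, h2⟩ := h.exists_two_faces hf₀ hAf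
  exact ⟨g, g', hg, hg', hne, h.subset_closure hf₀ hAf hg h1, h.subset_closure hf₀ hAf hg' h2,
    fun k hk hAk => h.eq_or_eq_of_subset hf₀ hg hg' hk h1 h2
      ((h.subset_closure_iff hf₀ hAf hk).1 hAk) hne⟩

theorem eq_or_eq (h : AttachedArc B A p q) {g₁ g₂ g₃ : Set (ℝ × ℝ)} (hg₁ : IsFaceOf (B ∪ A) g₁)
    (hg₂ : IsFaceOf (B ∪ A) g₂) (hg₃ : IsFaceOf (B ∪ A) g₃) (h₁ : A ⊆ closure g₁)
    (h₂ : A ⊆ closure g₂) (h₃ : A ⊆ closure g₃) (h12 : g₁ ≠ g₂) : g₃ = g₁ ∨ g₃ = g₂ := by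
  obtain ⟨f₀, hf₀, hAf⟩ := h.exists_face
  exact h.eq_or_eq_of_subset hf₀ hg₁ hg₂ hg₃ ((h.subset_closure_iff hf₀ hAf hg₁).1 h₁)
    ((h.subset_closure_iff hf₀ hAf hg₂).1 h₂) ((h.subset_closure_iff hf₀ hAf hg₃).1 h₃) h12

end AttachedArc

theorem IsArc.isPreconnected_diff_right {A : Set (ℝ × ℝ)} {p q : ℝ × ℝ} (h : IsArc A p q) :
    IsPreconnected (A \ {q}) := by
  refine h.isPreconnected_diff.subset_closure ?_ ?_
  · exact Set.sdiff_subset_sdiff_right (by simp)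
  · exact Set.sdiff_subset.trans h.subset_closure_diff

/-- A family of arcs emanating from a point `x` and ending on a compact connected set `K`. -/
structure ArcStar {ι : Type*} (K : Set (ℝ × ℝ)) (x : ℝ × ℝ) (y : ι → ℝ × ℝ)
    (A : ι → Set (ℝ × ℝ)) : Prop where
  isCompact : IsCompact K
  isPreconnected : IsPreconnected K
  notMem : x ∉ K
  isArc : ∀ i, IsArc (A i) x (y i)
  inter : ∀ i, A i ∩ K = {y i}
  inter_arc : ∀ i j, i ≠ j → A i ∩ A j = {x}

namespace ArcStar

variable {ι : Type*} {K F f g : Set (ℝ × ℝ)} {x : ℝ × ℝ} {y : ι → ℝ × ℝ} {A : ι → Set (ℝ × ℝ)}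

/-- The union of the base set with the arcs indexed by `S`. -/
def total (K : Set (ℝ × ℝ)) (A : ι → Set (ℝ × ℝ)) (S : Finset ι) : Set (ℝ × ℝ) :=
  K ∪ ⋃ i ∈ S, A i

theorem mem_total {S : Finset ι} {z : ℝ × ℝ} : z ∈ total K A S ↔ z ∈ K ∨ ∃ i ∈ S, z ∈ A i := by
  simp [total]

theorem total_insert (i : ι) (S : Finset ι) : total K A (insert i S) = total K A S ∪ A i := by
  ext z
  simp only [mem_total, Set.mem_union, Finset.mem_insert, exists_eq_or_imp, or_assoc]
  exact or_congr_right or_comm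

theorem total_erase {i : ι} {S : Finset ι} (hi : i ∈ S) :
    total K A S = total K A (S.erase i) ∪ A i := by
  rw [← total_insert, Finset.insert_erase hi]

theorem total_mono {S T : Finset ι} (h : S ⊆ T) : total K A S ⊆ total K A T := by
  intro z
  simp only [mem_total]
  rintro (hz | ⟨i, hi, hz⟩)
  exacts [Or.inl hz, Or.inr ⟨i, h hi, hz⟩]

theorem end_mem (h : ArcStar K x y A) (i : ι) : y i ∈ K :=
  (h.inter i ▸ Set.mem_singleton _ : y i ∈ A i ∩ K).2

theorem total_isCompact (h : ArcStar K x y A) (S : Finset ι) : IsCompact (total K A S) :=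
  h.isCompact.union (S.finite_toSet.isCompact_biUnion fun i _ => (h.isArc i).isCompact)

theorem total_isPreconnected (h : ArcStar K x y A) (S : Finset ι) :
    IsPreconnected (total K A S) := by
  induction S using Finset.induction_on with
  | empty => simpa [total] using h.isPreconnected
  | insert i S _ ih =>
    rw [total_insert]
    exact IsPreconnected.union (y i) (Or.inl (h.end_mem i)) (h.isArc i).right_mem ih
      (h.isArc i).isPreconnected

theorem eq_of_mem_of_mem (h : ArcStar K x y A) {i j : ι} (hij : i ≠ j) {z : ℝ × ℝ} (hi : z ∈ A i)
    (hj : z ∈ A j) : z = x := by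
  have : z ∈ A i ∩ A j := ⟨hi, hj⟩
  rwa [h.inter_arc i j hij] at this

theorem eq_of_mem_base (h : ArcStar K x y A) {i : ι} {z : ℝ × ℝ} (hi : z ∈ A i)
    (hz : z ∈ K) : z = y i := by
  have : z ∈ A i ∩ K := ⟨hi, hz⟩
  rwa [h.inter i] at this

theorem attached (h : ArcStar K x y A) {i j : ι} {S : Finset ι} (hj : j ∈ S) (hij : i ∉ S) :
    AttachedArc (total K A S) (A i) x (y i) where
  isCompact := h.total_isCompact S
  isPreconnected := h.total_isPreconnected S
  isArc := h.isArc i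
  inter := by
    ext z
    constructor
    · rintro ⟨hz, hz'⟩
      rcases mem_total.1 hz' with hz' | ⟨k, hk, hz'⟩
      · exact Or.inr (h.eq_of_mem_base hz hz')
      · exact Or.inl (h.eq_of_mem_of_mem (fun e : i = k => hij (by rw [e]; exact hk)) hz hz')
    · rintro (rfl | rfl)
      · exact ⟨(h.isArc i).left_mem, mem_total.2 (Or.inr ⟨j, hj, (h.isArc j).left_mem⟩)⟩
      · exact ⟨(h.isArc i).right_mem, mem_total.2 (Or.inl (h.end_mem i))⟩

theorem arc_subset_face (h : ArcStar K x y A) (hF : IsFaceOf K F) (hx : x ∈ F) (i : ι) :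
    A i \ {y i} ⊆ F := by
  refine hF.subset_of_isPreconnected (h.isArc i).isPreconnected_diff_right ?_ hx
    ⟨(h.isArc i).left_mem, (h.isArc i).ne⟩
  exact Set.disjoint_left.2 fun z hz hzK => hz.2 (h.eq_of_mem_base hz.1 hzK)

theorem attached_erase (h : ArcStar K x y A) {i j : ι} {S : Finset ι} (hj : j ∈ S)
    (hij : i ≠ j) : AttachedArc (total K A (S.erase i)) (A i) x (y i) :=
  h.attached (Finset.mem_erase.2 ⟨hij.symm, hj⟩) (Finset.notMem_erase i S)

theorem subset_closure_of_touch (h : ArcStar K x y A) {i j : ι} {S : Finset ι} (hi : i ∈ S)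
    (hj : j ∈ S) (hij : i ≠ j) (hf : IsFaceOf (total K A S) f) {z : ℝ × ℝ} (hz : z ∈ A i)
    (hzx : z ≠ x) (hzy : z ≠ y i) (hzf : z ∈ closure f) : A i ⊆ closure f := by
  rw [total_erase hi] at hf
  exact (h.attached_erase hj hij).subset_closure_of_touch hf ⟨hz, by simp [hzx, hzy]⟩ hzf

theorem subset_of_mem_closure (h : ArcStar K x y A) (hF : IsFaceOf K F) (hx : x ∈ F)
    {S : Finset ι} (hf : IsFaceOf (total K A S) f) (hxf : x ∈ closure f) : f ⊆ F := by
  obtain ⟨w, hw, hwf⟩ := mem_closure_iff.1 hxf _ (hF.isOpen h.isCompact.isClosed) hx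
  exact hf.subset_of_mem hF Set.subset_union_left hwf hw

/-- A face around the centre of a star has at least two of the arcs on its boundary. -/
theorem exists_two_arcs (h : ArcStar K x y A) {S : Finset ι} (hS : 1 < S.card)
    (hF : IsFaceOf K F) (hx : x ∈ F) (hf : IsFaceOf (total K A S) f) (hfF : f ⊆ F) :
    ∃ i ∈ S, ∃ j ∈ S, i ≠ j ∧ A i ⊆ closure f ∧ A j ⊆ closure f := by
  by_contra! hcon
  obtain ⟨a, ha, b, hb, hab⟩ := Finset.one_lt_card.1 hS
  obtain ⟨i, hi, hi'⟩ : ∃ i ∈ S, ∀ j ∈ S, j ≠ i → ¬ A j ⊆ closure f := by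
    by_cases hex : ∃ i ∈ S, A i ⊆ closure f
    · obtain ⟨i, hi, hif⟩ := hex
      exact ⟨i, hi, fun j hj hji => hcon i hi j hj hji.symm hif⟩
    · exact ⟨a, ha, fun j hj _ hjf => hex ⟨j, hj, hjf⟩⟩
  obtain ⟨j, hj, hji⟩ : ∃ j ∈ S, j ≠ i := by
    by_cases e : a = i
    · exact ⟨b, hb, fun e' => hab (e.trans e'.symm)⟩
    · exact ⟨a, ha, e⟩
  have hf' : IsFaceOf (K ∪ A i) f := by
    refine hf.of_frontier (h.total_isCompact S).isClosed ?_ ?_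
    · rintro z (hz | hz)
      · exact mem_total.2 (Or.inl hz)
      · exact mem_total.2 (Or.inr ⟨i, hi, hz⟩)
    · rintro z ⟨hzf, hz⟩
      rcases mem_total.1 hz with hz | ⟨k, hk, hz⟩
      · exact Or.inl hz
      by_cases hki : k = i
      · exact Or.inr (hki ▸ hz)
      by_cases hzx : z = x
      · exact Or.inr (hzx ▸ (h.isArc i).left_mem)
      by_cases hzy : z = y k
      · exact Or.inl (hzy ▸ h.end_mem k)
      exact absurd (h.subset_closure_of_touch hk hi hki hf hz hzx hzy hzf) (hi' k hk hki)
  have e := face_eq_of_dangling h.isCompact (h.isArc i).isCompact (h.isArc i).hasLogOn_ratio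
    (by rw [Set.inter_comm, h.inter]; exact isPreconnected_singleton) hF hf' hfF
  obtain ⟨z, hz, hz'⟩ := (h.isArc j).diff_nonempty
  simp only [Set.mem_insert_iff, Set.mem_singleton_iff, not_or] at hz'
  refine hf.notMem (z := z) ?_ (mem_total.2 (Or.inr ⟨j, hj, hz⟩))
  rw [e]
  exact ⟨h.arc_subset_face hF hx j ⟨hz, hz'.2⟩, fun hzi => hz'.1 (h.eq_of_mem_of_mem hji hz hzi)⟩

theorem exists_two_arcs' (h : ArcStar K x y A) {S : Finset ι} (hS : 1 < S.card)
    (hf : IsFaceOf (total K A S) f) (hxf : x ∈ closure f) :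
    ∃ i ∈ S, ∃ j ∈ S, i ≠ j ∧ A i ⊆ closure f ∧ A j ⊆ closure f := by
  have hF := IsFaceOf.of_notMem h.notMem
  have hx := mem_connectedComponentIn (F := Kᶜ) h.notMem
  exact h.exists_two_arcs hS hF hx hf (h.subset_of_mem_closure hF hx hf hxf)

/-- A face around the centre of a star has at most two of the arcs on its boundary. -/
theorem not_three_arcs (h : ArcStar K x y A) {S : Finset ι} {i j k : ι} (hi : i ∈ S)
    (hj : j ∈ S) (hk : k ∈ S) (hij : i ≠ j) (hik : i ≠ k) (hjk : j ≠ k)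
    (hf : IsFaceOf (total K A S) f) (hfi : A i ⊆ closure f) (hfj : A j ⊆ closure f)
    (hfk : A k ⊆ closure f) : False := by
  set F := connectedComponentIn Kᶜ x with hFdef
  have hF : IsFaceOf K F := IsFaceOf.of_notMem h.notMem
  have hx : x ∈ F := mem_connectedComponentIn (F := Kᶜ) h.notMem
  set T : Finset ι := {i, j} with hT
  have hkT : k ∉ T := by simp [hT, hik.symm, hjk.symm]
  have hTc : 1 < T.card := by rw [hT, Finset.card_pair hij]; norm_num
  set U : Finset ι := insert k T with hU
  have hUc : 1 < U.card := by
    rw [hU, Finset.card_insert_of_notMem hkT]; omega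
  have hUS : U ⊆ S := by
    intro m hm
    simp only [hU, hT, Finset.mem_insert, Finset.mem_singleton] at hm
    rcases hm with rfl | rfl | rfl <;> assumption
  have hiU : i ∈ U := by simp [hU, hT]
  have hjU : j ∈ U := by simp [hU, hT]
  obtain ⟨f', hf', hff'⟩ := hf.exists_superset (total_mono (K := K) (A := A) hUS)
  have hcl := closure_mono hff'
  -- the two faces of the drawing with the arcs `i` and `j`
  have pair : ∀ α, IsFaceOf (total K A T) α → α ⊆ F → A i ⊆ closure α ∧ A j ⊆ closure α := by
    intro α hα hαF
    obtain ⟨a, ha, b, hb, hab, h1, h2⟩ := h.exists_two_arcs hTc hF hx hα hαF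
    simp only [hT, Finset.mem_insert, Finset.mem_singleton] at ha hb
    rcases ha with rfl | rfl <;> rcases hb with rfl | rfl
    exacts [absurd rfl hab, ⟨h1, h2⟩, ⟨h2, h1⟩, absurd rfl hab]
  have hatk : AttachedArc (total K A T) (A k) x (y k) :=
    h.attached (j := i) (by simp [hT]) hkT
  have hUk : total K A U = total K A T ∪ A k := total_insert k T
  obtain ⟨f₀, hf₀, hkf₀⟩ := hatk.exists_face
  have hxk : x ∈ closure f₀ := closure_mono hkf₀
    ((h.isArc k).subset_closure_diff (h.isArc k).left_mem)
  have hf₀F : f₀ ⊆ F := h.subset_of_mem_closure hF hx hf₀ hxk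
  obtain ⟨β, hβ, hβne, hβF⟩ : ∃ β, IsFaceOf (total K A T) β ∧ β ≠ f₀ ∧ β ⊆ F := by
    have hati := h.attached_erase (S := T) (i := i) (j := j) (by simp [hT]) hij
    obtain ⟨α, β, hα, hβ, hne, hα', hβ', -⟩ := hati.exists_two
    rw [← total_erase (by simp [hT])] at hα hβ
    have hαF := h.subset_of_mem_closure hF hx hα (hα' (h.isArc i).left_mem)
    have hβF := h.subset_of_mem_closure hF hx hβ (hβ' (h.isArc i).left_mem)
    by_cases e : α = f₀
    · exact ⟨β, hβ, fun e' => hne (e.trans e'.symm), hβF⟩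
    · exact ⟨α, hα, e, hαF⟩
  have hβf₀ : ∀ z ∈ β, z ∉ f₀ := fun z hz hz' => hβne (hβ.eq_of_mem hf₀ hz hz')
  have hβU : IsFaceOf (total K A U) β := by
    refine hβ.of_disjoint (hUk ▸ Set.subset_union_left) ?_
    rw [hUk, Set.disjoint_union_right]
    refine ⟨hβ.disjoint, Set.disjoint_left.2 fun z hz hzk => ?_⟩
    by_cases hzz : z ∈ ({x, y k} : Set (ℝ × ℝ))
    · refine hβ.notMem hz ?_
      rcases hzz with rfl | rfl
      exacts [hatk.left_mem, hatk.right_mem]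
    · exact hβf₀ z hz (hkf₀ ⟨hzk, hzz⟩)
  have hf'₀ : f' ⊆ f₀ := (hatk.subset_closure_iff hf₀ hkf₀ (hUk ▸ hf')).1 (hfk.trans hcl)
  obtain ⟨α, hα, hαf₀, hαne⟩ : ∃ α, IsFaceOf (total K A U) α ∧ α ⊆ f₀ ∧ α ≠ f' := by
    obtain ⟨α, α', hα, hα', hne, h1, h2⟩ := hatk.exists_two_faces hf₀ hkf₀
    rw [← hUk] at hα hα'
    by_cases e : α = f'
    · exact ⟨α', hα', h2, fun e' => hne (e.trans e'.symm)⟩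
    · exact ⟨α, hα, h1, e⟩
  have hαβ : α ≠ β := by
    rintro rfl
    obtain ⟨z, hz⟩ := hα.nonempty
    exact hβf₀ z hz (hαf₀ hz)
  have hfβ : f' ≠ β := by
    rintro rfl
    obtain ⟨z, hz⟩ := hf'.nonempty
    exact hβf₀ z hz (hf'₀ hz)
  have key : ∀ a ∈ U, ∀ b ∈ U, a ≠ b → A a ⊆ closure f' → A a ⊆ closure α → A a ⊆ closure β →
      False := by
    intro a ha b hb hab h1 h2 h3
    have hat := h.attached_erase hb hab
    rw [total_erase ha] at hf' hα hβU
    rcases hat.eq_or_eq hf' hα hβU h1 h2 h3 hαne.symm with e | e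
    exacts [hfβ e.symm, hαβ e.symm]
  obtain ⟨a, ha, b, hb, hab, h1, h2⟩ := h.exists_two_arcs hUc hF hx hα (hαf₀.trans hf₀F)
  have hβ2 := pair β hβ hβF
  simp only [hU, hT, Finset.mem_insert, Finset.mem_singleton] at ha hb
  have : A i ⊆ closure α ∨ A j ⊆ closure α := by
    rcases ha with rfl | rfl | rfl
    · rcases hb with rfl | rfl | rfl
      exacts [absurd rfl hab, Or.inl h2, Or.inr h2]
    · exact Or.inl h1
    · exact Or.inr h1
  rcases this with h' | h'
  · exact key i hiU j hjU hij (hfi.trans hcl) h' hβ2.1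
  · exact key j hjU i hiU hij.symm (hfj.trans hcl) h' hβ2.2

/-- If two different faces share two arcs at the centre, then there are no other arcs. -/
theorem eq_or_eq_of_two_faces (h : ArcStar K x y A) {S : Finset ι} {i j k : ι} (hi : i ∈ S)
    (hj : j ∈ S) (hk : k ∈ S) (hij : i ≠ j) (hf : IsFaceOf (total K A S) f)
    (hg : IsFaceOf (total K A S) g) (hfg : f ≠ g) (hfi : A i ⊆ closure f)
    (hfj : A j ⊆ closure f) (hgi : A i ⊆ closure g) (hgj : A j ⊆ closure g) : k = i ∨ k = j := by
  by_contra! hkij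
  set F := connectedComponentIn Kᶜ x with hFdef
  have hF : IsFaceOf K F := IsFaceOf.of_notMem h.notMem
  have hx : x ∈ F := mem_connectedComponentIn (F := Kᶜ) h.notMem
  have hfF := h.subset_of_mem_closure hF hx hf (hfi (h.isArc i).left_mem)
  have hpre : IsPreconnected (F \ {x}) := by
    have hsub : K ∪ {x} ⊆ total K A S := by
      rintro z (hz | rfl)
      · exact mem_total.2 (Or.inl hz)
      · exact mem_total.2 (Or.inr ⟨i, hi, (h.isArc i).left_mem⟩)
    obtain ⟨f', hf', hff'⟩ := hf.exists_superset hsub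
    obtain ⟨z, hz⟩ := hf.nonempty
    rw [← face_eq_of_dangling h.isCompact isCompact_singleton (fun a b ha hb =>
      ⟨fun _ => Complex.log (ratio a b x), continuousOn_const, ?_⟩) ?_ hF hf'
      (hf'.subset_of_mem hF Set.subset_union_left (hff' hz) (hfF hz))]
    · exact hf'.isPreconnected
    · have : K ∩ {x} = ∅ := by
        ext z; simp only [Set.mem_inter_iff, Set.mem_singleton_iff, Set.mem_empty_iff_false,
          iff_false, not_and]
        rintro hz rfl; exact h.notMem hz
      rw [this]; exact isPreconnected_empty
    · rintro _ rfl
      exact Complex.exp_log (ratio_ne_zero (fun e => ha e.symm) (fun e => hb e.symm))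
  -- the union of `f`, `g` and the interior of an arc on both boundaries is open
  have host : ∀ a ∈ S, ∀ b ∈ S, a ≠ b → A a ⊆ closure f → A a ⊆ closure g →
      ∃ W, IsOpen W ∧ f ⊆ W ∧ W ⊆ f ∪ g ∪ A a ∧ A a \ {x, y a} ⊆ W ∧ g ⊆ W := by
    intro a ha b hb hab h1 h2
    have hat := h.attached_erase hb hab
    rw [total_erase ha] at hf hg
    obtain ⟨f₀, hf₀, haf₀⟩ := hat.exists_face
    have hff := (hat.subset_closure_iff hf₀ haf₀ hf).1 h1
    have hgf := (hat.subset_closure_iff hf₀ haf₀ hg).1 h2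
    refine ⟨f₀, hf₀.isOpen hat.isCompact.isClosed, hff, fun z hz => ?_, haf₀, hgf⟩
    by_cases hza : z ∈ A a
    · exact Or.inr hza
    have hzK : z ∉ total K A (S.erase a) ∪ A a := fun h => h.elim (hf₀.notMem hz) hza
    have hmem := mem_connectedComponentIn (F := (total K A (S.erase a) ∪ A a)ᶜ) hzK
    have hface := IsFaceOf.of_notMem hzK
    rcases hat.eq_or_eq_of_subset hf₀ hf hg hface hff hgf
      (hface.subset_of_mem hf₀ Set.subset_union_left hmem hz) hfg with e | e
    · exact Or.inl (Or.inl (e ▸ hmem))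
    · exact Or.inl (Or.inr (e ▸ hmem))
  obtain ⟨W, hW, hfW, hWs, hWi, hgW⟩ := host i hi j hj hij hfi hgi
  obtain ⟨W', hW', hfW', hWs', hWj, hgW'⟩ := host j hj i hi hij.symm hfj hgj
  have hclf : ∀ f', IsFaceOf (total K A S) f' → A i ⊆ closure f' → A j ⊆ closure f' →
      f' ⊆ W → ∀ z ∈ closure f', z ∈ F \ {x} → z ∈ W ∪ W' := by
    intro f' hf' h1 h2 hf'W z hz hzF
    rcases hf'.closure_subset (h.total_isCompact S).isClosed hz with hz' | hz'
    · exact Or.inl (hf'W hz')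
    rcases mem_total.1 hz' with hzK | ⟨m, hm, hzm⟩
    · exact absurd hzK (hF.notMem hzF.1)
    have hzx : z ≠ x := hzF.2
    have hzy : z ≠ y m := fun e => hF.notMem hzF.1 (e ▸ h.end_mem m)
    have hinter : ∀ m, z ≠ y m → z ∈ A m → z ∈ A m \ {x, y m} := fun m h1 h2 =>
      ⟨h2, by simp [hzx, h1]⟩
    by_cases hmi : m = i
    · subst hmi; exact Or.inl (hWi (hinter m hzy hzm))
    by_cases hmj : m = j
    · subst hmj; exact Or.inr (hWj (hinter m hzy hzm))
    exact (h.not_three_arcs hi hj hm hij (Ne.symm hmi) (Ne.symm hmj) hf' h1 h2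
      (h.subset_closure_of_touch hm hi hmi hf' hzm hzx hzy hz)).elim
  have hsub : F \ {x} ⊆ W ∪ W' := by
    refine hpre.subset_of_closure_inter_subset (hW.union hW') ?_ ?_
    · obtain ⟨z, hz⟩ := hf.nonempty
      refine ⟨z, ⟨hfF hz, ?_⟩, Or.inl (hfW hz)⟩
      rintro rfl
      exact hf.notMem hz (mem_total.2 (Or.inr ⟨i, hi, (h.isArc i).left_mem⟩))
    · rintro z ⟨hz, hzF⟩
      have hsub : W ∪ W' ⊆ f ∪ g ∪ A i ∪ A j := by
        rintro w (hw | hw)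
        · exact Or.inl (hWs hw)
        · rcases hWs' hw with hw | hw
          exacts [Or.inl (Or.inl hw), Or.inr hw]
      have hz' := closure_mono hsub hz
      rw [closure_union, closure_union, closure_union, (h.isArc i).isCompact.isClosed.closure_eq,
        (h.isArc j).isCompact.isClosed.closure_eq] at hz'
      have hin : ∀ m, z ∈ A m → z ∈ A m \ {x, y m} := fun m hm => ⟨hm, by
        have h1 : z ≠ x := hzF.2
        have h2 : z ≠ y m := fun e => hF.notMem hzF.1 (e ▸ h.end_mem m)
        simp [h1, h2]⟩
      rcases hz' with ((hz' | hz') | hz') | hz'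
      · exact hclf f hf hfi hfj hfW z hz' hzF
      · exact hclf g hg hgi hgj hgW z hz' hzF
      · exact Or.inl (hWi (hin i hz'))
      · exact Or.inr (hWj (hin j hz'))
  obtain ⟨z, hz, hz'⟩ := (h.isArc k).diff_nonempty
  simp only [Set.mem_insert_iff, Set.mem_singleton_iff, not_or] at hz'
  have hzS : z ∈ total K A S := mem_total.2 (Or.inr ⟨k, hk, hz⟩)
  have hzF : z ∈ F \ {x} := ⟨h.arc_subset_face hF hx k ⟨hz, hz'.2⟩, hz'.1⟩
  have hnot : ∀ m, m ≠ k → z ∉ A m := fun m hm hzm => hz'.1 (h.eq_of_mem_of_mem hm hzm hz)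
  rcases hsub hzF with hw | hw
  · rcases hWs hw with (hw | hw) | hw
    exacts [hf.notMem hw hzS, hg.notMem hw hzS, hnot i hkij.1.symm hw]
  · rcases hWs' hw with (hw | hw) | hw
    exacts [hf.notMem hw hzS, hg.notMem hw hzS, hnot j hkij.2.symm hw]

end ArcStar

section Drawings

variable {V : Type*} {G : SimpleGraph V}

/-- The point set drawn by a set of edges. -/
def drawE (emb : PlaneEmbedding G) (E : Set (Sym2 V)) : Set (ℝ × ℝ) :=
  ⋃ e ∈ E, arcSet emb e

theorem mem_drawE {emb : PlaneEmbedding G} {E : Set (Sym2 V)} {z : ℝ × ℝ} :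
    z ∈ drawE emb E ↔ ∃ e ∈ E, z ∈ arcSet emb e := by
  simp [drawE]

theorem drawE_mono (emb : PlaneEmbedding G) {E E' : Set (Sym2 V)} (h : E ⊆ E') :
    drawE emb E ⊆ drawE emb E' :=
  Set.biUnion_subset_biUnion_left h

theorem PlaneEmbedding.isArc (emb : PlaneEmbedding G) {u v : V} (h : G.Adj u v) :
    IsArc (arcSet emb s(u, v)) (emb.pos u) (emb.pos v) := by
  obtain ⟨γ, h1, h2, h3, h4, h5⟩ := emb.arc_curve u v h
  exact ⟨γ, h1, h2, h3, h4, h5⟩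

theorem PlaneEmbedding.pos_mem_arcSet (emb : PlaneEmbedding G) {u v w : V} (h : G.Adj u v) :
    emb.pos w ∈ arcSet emb s(u, v) ↔ w = u ∨ w = v := by
  constructor
  · exact emb.arc_vertex u v h w
  · rintro (rfl | rfl)
    exacts [(emb.isArc h).left_mem, (emb.isArc h).right_mem]

theorem PlaneEmbedding.pos_mem_arcSet_iff (emb : PlaneEmbedding G) {e : Sym2 V} {w : V}
    (h : e ∈ G.edgeSet) : emb.pos w ∈ arcSet emb e ↔ w ∈ e := by
  induction e with
  | h u v => rw [emb.pos_mem_arcSet h, Sym2.mem_iff]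

theorem PlaneEmbedding.exists_of_mem_of_mem (emb : PlaneEmbedding G) {e e' : Sym2 V}
    (he : e ∈ G.edgeSet) (he' : e' ∈ G.edgeSet) (hne : e ≠ e') {z : ℝ × ℝ}
    (hz : z ∈ arcSet emb e) (hz' : z ∈ arcSet emb e') :
    ∃ w, z = emb.pos w ∧ w ∈ e ∧ w ∈ e' := by
  have : ∃ w, emb.pos w = z := by
    induction e with
    | h u v =>
      induction e' with
      | h a b => exact emb.arc_inter u v a b he he' hne ⟨hz, hz'⟩
  obtain ⟨w, rfl⟩ := this
  exact ⟨w, rfl, (emb.pos_mem_arcSet_iff he).1 hz, (emb.pos_mem_arcSet_iff he').1 hz'⟩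

theorem PlaneEmbedding.isCompact_arcSet (emb : PlaneEmbedding G) {e : Sym2 V}
    (he : e ∈ G.edgeSet) : IsCompact (arcSet emb e) := by
  induction e with
  | h u v => exact (emb.isArc he).isCompact

theorem PlaneEmbedding.isPreconnected_arcSet (emb : PlaneEmbedding G) {e : Sym2 V}
    (he : e ∈ G.edgeSet) : IsPreconnected (arcSet emb e) := by
  induction e with
  | h u v => exact (emb.isArc he).isPreconnected

theorem isCompact_drawE [Fintype V] (emb : PlaneEmbedding G) {E : Set (Sym2 V)} 
    (hE : E ⊆ G.edgeSet) : IsCompact (drawE emb E) :=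
  (Set.toFinite E).isCompact_biUnion fun _ he => emb.isCompact_arcSet (hE he)

theorem incVertex_of_incEdge {emb : PlaneEmbedding G} {f : Set (ℝ × ℝ)} {e : Sym2 V} {v : V}
    (he : e ∈ G.edgeSet) (h : incEdge emb f e) (hv : v ∈ e) : incVertex emb f v :=
  h ((emb.pos_mem_arcSet_iff he).2 hv)

/-- A set of edges whose drawing stays connected after removing a vertex and in which no vertex
has degree one. -/
structure Robust (emb : PlaneEmbedding G) (E : Set (Sym2 V)) : Prop where
  subset : E ⊆ G.edgeSet
  isPreconnected : ∀ x, IsPreconnected (drawE emb {e ∈ E | x ∉ e})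
  exists_ne : ∀ x w, s(x, w) ∈ E → ∃ w', w' ≠ w ∧ s(x, w') ∈ E

namespace Robust

variable {emb : PlaneEmbedding G} {E : Set (Sym2 V)} {f g k : Set (ℝ × ℝ)} {x w w₁ w₂ w₃ : V}

theorem adj (h : Robust emb E) (hw : s(x, w) ∈ E) : G.Adj x w := h.subset hw

variable [Fintype V]

theorem star (h : Robust emb E) (x : V) :
    ArcStar (drawE emb {e ∈ E | x ∉ e}) (emb.pos x)
      (fun w : {w // s(x, w) ∈ E} => emb.pos w) (fun w => arcSet emb s(x, w)) where
  isCompact := isCompact_drawE emb fun _ he => h.subset he.1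
  isPreconnected := h.isPreconnected x
  notMem := by
    rw [mem_drawE]
    rintro ⟨e, ⟨he, hx⟩, hz⟩
    exact hx ((emb.pos_mem_arcSet_iff (h.subset he)).1 hz)
  isArc w := emb.isArc (h.adj w.2)
  inter := by
    rintro ⟨w, hw⟩
    ext z
    simp only [Set.mem_inter_iff, Set.mem_singleton_iff, mem_drawE]
    constructor
    · rintro ⟨hz, e, ⟨he, hxe⟩, hze⟩
      have hne : s(x, w) ≠ e := fun h' => hxe (h' ▸ Sym2.mem_mk_left x w)
      obtain ⟨u, rfl, hu, hu'⟩ := emb.exists_of_mem_of_mem (h.subset hw) (h.subset he) hne hz hze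
      rcases Sym2.mem_iff.1 hu with rfl | rfl
      exacts [absurd hu' hxe, rfl]
    · rintro rfl
      refine ⟨(emb.isArc (h.adj hw)).right_mem, ?_⟩
      obtain ⟨w', hne, hw'⟩ := h.exists_ne w x (Sym2.eq_swap ▸ hw)
      refine ⟨_, ⟨hw', ?_⟩, (emb.isArc (h.adj hw')).left_mem⟩
      rw [Sym2.mem_iff, not_or]
      exact ⟨(h.adj hw).ne, hne.symm⟩
  inter_arc := by
    rintro ⟨w, hw⟩ ⟨w', hw'⟩ hne
    ext z
    simp only [Set.mem_inter_iff, Set.mem_singleton_iff]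
    have hww : w ≠ w' := fun e => hne (by simp [e])
    constructor
    · rintro ⟨hz, hz'⟩
      have hne' : s(x, w) ≠ s(x, w') := fun h' => hww (Sym2.congr_right.1 h')
      obtain ⟨u, rfl, hu, hu'⟩ := emb.exists_of_mem_of_mem (h.subset hw) (h.subset hw') hne' hz hz'
      rcases Sym2.mem_iff.1 hu with rfl | rfl
      · rfl
      · rcases Sym2.mem_iff.1 hu' with rfl | rfl
        exacts [rfl, absurd rfl hww]
    · rintro rfl
      exact ⟨(emb.isArc (h.adj hw)).left_mem, (emb.isArc (h.adj hw')).left_mem⟩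

theorem total_univ (x : V) (E : Set (Sym2 V)) :
    ArcStar.total (drawE emb {e ∈ E | x ∉ e})
      (fun w : {w // s(x, w) ∈ E} => arcSet emb s(x, w)) Finset.univ = drawE emb E := by
  ext z
  rw [ArcStar.mem_total]
  simp only [mem_drawE, Finset.mem_univ, true_and, Subtype.exists, exists_prop]
  constructor
  · rintro (⟨e, he, hz⟩ | ⟨w, hw, hz⟩)
    exacts [⟨e, he.1, hz⟩, ⟨_, hw, hz⟩]
  · rintro ⟨e, he, hz⟩
    by_cases hx : x ∈ e
    · obtain ⟨w, rfl⟩ := hx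
      exact Or.inr ⟨w, he, hz⟩
    · exact Or.inl ⟨e, ⟨he, hx⟩, hz⟩

theorem attached (h : Robust emb E) (hw : s(x, w) ∈ E) :
    ∃ B, AttachedArc B (arcSet emb s(x, w)) (emb.pos x) (emb.pos w) ∧
      drawE emb E = B ∪ arcSet emb s(x, w) := by
  obtain ⟨w', hne, hw'⟩ := h.exists_ne x w hw
  have := (h.star x).attached_erase (i := ⟨w, hw⟩) (j := ⟨w', hw'⟩) (Finset.mem_univ _)
    (fun e => hne (by simpa using e.symm))
  refine ⟨_, this, ?_⟩
  rw [← total_univ x E]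
  exact ArcStar.total_erase (A := fun w : {w // s(x, w) ∈ E} => arcSet emb s(x, w)) (i := ⟨w, hw⟩)
    (Finset.mem_univ _)

theorem exists_two_faces (h : Robust emb E) {e : Sym2 V} (he : e ∈ E) :
    ∃ g g', IsFaceOf (drawE emb E) g ∧ IsFaceOf (drawE emb E) g' ∧ g ≠ g' ∧ incEdge emb g e ∧
      incEdge emb g' e ∧ ∀ k, IsFaceOf (drawE emb E) k → incEdge emb k e → k = g ∨ k = g' := by
  induction e with
  | h u v =>
    obtain ⟨B, hB, hD⟩ := h.attached he
    rw [hD]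
    exact hB.exists_two

theorem eq_or_eq (h : Robust emb E) {e : Sym2 V} (he : e ∈ E) (hf : IsFaceOf (drawE emb E) f)
    (hg : IsFaceOf (drawE emb E) g) (hk : IsFaceOf (drawE emb E) k) (h1 : incEdge emb f e)
    (h2 : incEdge emb g e) (h3 : incEdge emb k e) (hfg : f ≠ g) : k = f ∨ k = g := by
  induction e with
  | h u v =>
    obtain ⟨B, hB, hD⟩ := h.attached he
    rw [hD] at hf hg hk
    exact hB.eq_or_eq hf hg hk h1 h2 h3 hfg

theorem exists_two_edges (h : Robust emb E) (hw : s(x, w) ∈ E) (hf : IsFaceOf (drawE emb E) f)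
    (hx : incVertex emb f x) : ∃ w₁ w₂, w₁ ≠ w₂ ∧ s(x, w₁) ∈ E ∧ s(x, w₂) ∈ E ∧
      incEdge emb f s(x, w₁) ∧ incEdge emb f s(x, w₂) := by
  obtain ⟨w', hne, hw'⟩ := h.exists_ne x w hw
  rw [← total_univ x] at hf
  obtain ⟨i, -, j, -, hij, h1, h2⟩ := (h.star x).exists_two_arcs'
    (Finset.one_lt_card.2 ⟨⟨w, hw⟩, Finset.mem_univ _, ⟨w', hw'⟩, Finset.mem_univ _,
      fun e => hne (by simpa using e.symm)⟩) hf hx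
  exact ⟨i, j, fun e => hij (Subtype.ext e), i.2, j.2, h1, h2⟩

theorem eq_or_eq_of_incEdge (h : Robust emb E) (hw₁ : s(x, w₁) ∈ E) (hw₂ : s(x, w₂) ∈ E)
    (hw₃ : s(x, w₃) ∈ E) (hf : IsFaceOf (drawE emb E) f) (h₁ : incEdge emb f s(x, w₁))
    (h₂ : incEdge emb f s(x, w₂)) (h₃ : incEdge emb f s(x, w₃)) (hne : w₁ ≠ w₂) :
    w₃ = w₁ ∨ w₃ = w₂ := by
  by_contra! hcon
  rw [← total_univ x] at hf
  exact (h.star x).not_three_arcs (i := ⟨w₁, hw₁⟩) (j := ⟨w₂, hw₂⟩) (k := ⟨w₃, hw₃⟩)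
    (Finset.mem_univ _) (Finset.mem_univ _) (Finset.mem_univ _) (fun e => hne (by simpa using e))
    (fun e => hcon.1 (by simpa using e.symm)) (fun e => hcon.2 (by simpa using e.symm)) hf h₁ h₂ h₃

theorem eq_or_eq_of_two_faces (h : Robust emb E) (hw₁ : s(x, w₁) ∈ E) (hw₂ : s(x, w₂) ∈ E)
    (hw₃ : s(x, w₃) ∈ E) (hf : IsFaceOf (drawE emb E) f) (hg : IsFaceOf (drawE emb E) g)
    (hfg : f ≠ g) (hf₁ : incEdge emb f s(x, w₁)) (hf₂ : incEdge emb f s(x, w₂))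
    (hg₁ : incEdge emb g s(x, w₁)) (hg₂ : incEdge emb g s(x, w₂)) (hne : w₁ ≠ w₂) :
    w₃ = w₁ ∨ w₃ = w₂ := by
  rw [← total_univ x] at hf hg
  have := (h.star x).eq_or_eq_of_two_faces (i := ⟨w₁, hw₁⟩) (j := ⟨w₂, hw₂⟩) (k := ⟨w₃, hw₃⟩)
    (Finset.mem_univ _) (Finset.mem_univ _) (Finset.mem_univ _) (fun e => hne (by simpa using e))
    hf hg hfg hf₁ hf₂ hg₁ hg₂
  simpa using this

end Robust
end Drawings

section CycleIndexing

variable {V : Type*} {G : SimpleGraph V} {x : V}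

theorem SimpleGraph.Walk.mem_edges_iff_exists_getVert {u v : V} (W : G.Walk u v) (e : Sym2 V) :
    e ∈ W.edges ↔ ∃ n < W.length, e = s(W.getVert n, W.getVert (n + 1)) := by
  induction W with
  | nil => simp
  | cons h W ih =>
    simp only [SimpleGraph.Walk.edges_cons, List.mem_cons, ih, SimpleGraph.Walk.length_cons]
    constructor
    · rintro (rfl | ⟨n, hn, rfl⟩)
      · exact ⟨0, by omega, by simp⟩
      · exact ⟨n + 1, by omega, by simp⟩
    · rintro ⟨n, hn, rfl⟩
      cases n with
      | zero => exact Or.inl (by simp)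
      | succ n => exact Or.inr ⟨n, by omega, by simp⟩

/-- A periodic enumeration of the vertices of the cycle `C` in their cyclic order. -/
structure CycleIndex (C : G.Walk x x) (p : ℤ → V) : Prop where
  eq_iff : ∀ i j, p i = p j ↔ (C.length : ℤ) ∣ i - j
  mem_edges : ∀ e, e ∈ C.edges ↔ ∃ i, e = s(p i, p (i + 1))
  mem_support : ∀ v, v ∈ C.support ↔ ∃ i, p i = v

theorem SimpleGraph.Walk.IsCycle.exists_cycleIndex {C : G.Walk x x} (hC : C.IsCycle) :
    ∃ p, CycleIndex C p := by
  have hlen := hC.three_le_length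
  have hc : (0 : ℤ) < C.length := by omega
  set p : ℤ → V := fun i => C.getVert (i % C.length).toNat with hp
  have hpn : ∀ n ≤ C.length, p n = C.getVert n := by
    intro n hn
    rcases hn.lt_or_eq with hn | rfl
    · simp only [hp]
      rw [Int.emod_eq_of_lt (by omega) (by omega)]
      simp
    · simp [hp]
  have hper : ∀ i k : ℤ, p (i + k * C.length) = p i := by
    intro i k; simp [hp]
  have hred : ∀ i, ∃ n < C.length, ∃ k : ℤ, i = n + k * C.length := by
    intro i
    have h1 := Int.emod_nonneg i hc.ne'
    have h2 := Int.emod_lt_of_pos i hc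
    refine ⟨(i % C.length).toNat, by omega, i / C.length, ?_⟩
    rw [Int.toNat_of_nonneg h1, mul_comm]
    exact (Int.emod_add_mul_ediv i _).symm
  refine ⟨p, ⟨fun i j => ⟨fun h => ?_, ?_⟩, fun e => ?_, fun v => ?_⟩⟩
  · have h1 := Int.emod_lt_of_pos i hc
    have h2 := Int.emod_lt_of_pos j hc
    have h3 := Int.emod_nonneg i hc.ne'
    have h4 := Int.emod_nonneg j hc.ne'
    have := hC.getVert_injOn' (by rw [Set.mem_ofPred_eq]; omega)
      (by rw [Set.mem_ofPred_eq]; omega) h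
    refine (Int.emod_eq_emod_iff_emod_sub_eq_zero.1 ?_ |> Int.dvd_of_emod_eq_zero)
    omega
  · rintro ⟨k, hk⟩
    rw [show i = j + k * C.length by rw [mul_comm, ← hk]; ring]
    exact hper j k
  · rw [SimpleGraph.Walk.mem_edges_iff_exists_getVert]
    constructor
    · rintro ⟨n, hn, rfl⟩
      exact ⟨n, by rw [hpn n hn.le, ← hpn (n + 1) hn]; simp⟩
    · rintro ⟨i, rfl⟩
      obtain ⟨n, hn, k, rfl⟩ := hred i
      refine ⟨n, hn, ?_⟩
      rw [hper, show (n : ℤ) + k * C.length + 1 = (n + 1 : ℕ) + k * C.length by push_cast; ring,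
        hper, hpn n hn.le, hpn (n + 1) hn]
  · rw [SimpleGraph.Walk.mem_support_iff_exists_getVert]
    constructor
    · rintro ⟨n, rfl, hn⟩
      exact ⟨n, hpn n hn⟩
    · rintro ⟨i, rfl⟩
      obtain ⟨n, hn, k, rfl⟩ := hred i
      exact ⟨n, by rw [hper, hpn n hn.le], hn.le⟩

namespace CycleIndex

variable {C : G.Walk x x} {p : ℤ → V}

theorem shift (h : CycleIndex C p) (r : ℤ) : CycleIndex C fun i => p (i + r) where
  eq_iff i j := by rw [h.eq_iff]; ring_nf
  mem_edges e := by
    rw [h.mem_edges]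
    constructor
    · rintro ⟨i, rfl⟩
      exact ⟨i - r, by ring_nf⟩
    · rintro ⟨i, rfl⟩
      exact ⟨i + r, by ring_nf⟩
  mem_support v := by
    rw [h.mem_support]
    constructor
    · rintro ⟨i, rfl⟩
      exact ⟨i - r, by ring_nf⟩
    · rintro ⟨i, rfl⟩
      exact ⟨i + r, by ring_nf⟩

theorem reflect (h : CycleIndex C p) (r : ℤ) : CycleIndex C fun i => p (r - i) where
  eq_iff i j := by
    rw [h.eq_iff, show r - i - (r - j) = -(i - j) by ring, dvd_neg]
  mem_edges e := by
    rw [h.mem_edges]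
    constructor
    · rintro ⟨i, rfl⟩
      exact ⟨r - i - 1, by rw [Sym2.eq_swap]; ring_nf⟩
    · rintro ⟨i, rfl⟩
      exact ⟨r - i - 1, by rw [Sym2.eq_swap]; ring_nf⟩
  mem_support v := by
    rw [h.mem_support]
    constructor
    · rintro ⟨i, rfl⟩
      exact ⟨r - i, by ring_nf⟩
    · rintro ⟨i, rfl⟩
      exact ⟨r - i, by ring_nf⟩

theorem mem_edges_step (h : CycleIndex C p) (i : ℤ) : s(p i, p (i + 1)) ∈ C.edges :=
  (h.mem_edges _).2 ⟨i, rfl⟩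

theorem adj (h : CycleIndex C p) (i : ℤ) : G.Adj (p i) (p (i + 1)) :=
  C.edges_subset_edgeSet (h.mem_edges_step i)

theorem eq_of_eq (h : CycleIndex C p) {i j : ℤ} (hij : p i = p j) (h1 : i - j < C.length)
    (h2 : j - i < C.length) : i = j := by
  have := Int.eq_zero_of_abs_lt_dvd ((h.eq_iff i j).1 hij) (by rw [abs_lt]; omega)
  omega

theorem ne (h : CycleIndex C p) {i j : ℤ} (hij : i ≠ j) (h1 : i - j < C.length)
    (h2 : j - i < C.length) : p i ≠ p j :=
  fun e => hij (h.eq_of_eq e h1 h2)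

theorem periodic (h : CycleIndex C p) (i : ℤ) : p (i + C.length) = p i :=
  (h.eq_iff _ _).2 (by simp)

theorem exists_window (h : CycleIndex C p) (hc : 0 < C.length) (a i : ℤ) :
    ∃ k, a ≤ k ∧ k < a + C.length ∧ p k = p i := by
  have hc' : (0 : ℤ) < C.length := by omega
  have h1 := Int.emod_nonneg (i - a) hc'.ne'
  have h2 := Int.emod_lt_of_pos (i - a) hc'
  refine ⟨a + (i - a) % C.length, by omega, by omega, (h.eq_iff _ _).2 ?_⟩
  rw [show a + (i - a) % C.length - i = -((i - a) - (i - a) % C.length) by ring, dvd_neg]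
  exact Int.dvd_self_sub_emod

end CycleIndex

end CycleIndexing

section Chords

variable {V : Type*} {G : SimpleGraph V} {x : V} {C : G.Walk x x}

theorem mem_Hgraph {e : Sym2 V} : e ∈ (Hgraph C).edgeSet ↔ e ∈ G.edgeSet ∧ e ∉ chordSet C := by
  simp [Hgraph, SimpleGraph.edgeSet_deleteEdges]

theorem mem_Hgraph_of_mem_edges {e : Sym2 V} (he : e ∈ C.edges) : e ∈ (Hgraph C).edgeSet :=
  mem_Hgraph.2 ⟨C.edges_subset_edgeSet he, fun h => h.2.1 he⟩

theorem mem_Hgraph_of_notMem {v w : V} (hv : v ∉ C.support) (h : G.Adj v w) :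
    s(v, w) ∈ (Hgraph C).edgeSet :=
  mem_Hgraph.2 ⟨h, fun h' => hv (h'.2.2 v (Sym2.mem_mk_left v w))⟩

end Chords

section Setup

variable {V : Type*} [Fintype V] {G : SimpleGraph V} {x : V}

/-- An indexed longest isolating cycle of length at least eight in a 3-connected graph. -/
structure CycleSetup (C : G.Walk x x) (p : ℤ → V) : Prop extends CycleIndex C p where
  three : ThreeConnected G
  longest : IsLongestIsolatingCycle G C
  len : 8 ≤ C.length

namespace CycleSetup

variable {C : G.Walk x x} {p : ℤ → V}

theorem shift (S : CycleSetup C p) (r : ℤ) : CycleSetup C fun i => p (i + r) :=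
  ⟨S.toCycleIndex.shift r, S.three, S.longest, S.len⟩

theorem reflect (S : CycleSetup C p) (r : ℤ) : CycleSetup C fun i => p (r - i) :=
  ⟨S.toCycleIndex.reflect r, S.three, S.longest, S.len⟩

theorem mem_support_of_adj (S : CycleSetup C p) {v w : V} (hv : v ∉ C.support)
    (h : G.Adj v w) : ∃ i, p i = w :=
  (S.mem_support w).1 ((S.longest.2.1 v hv).2 w h)

theorem isPreconnected_path (S : CycleSetup C p) (emb : PlaneEmbedding G) (m : ℤ) (n : ℕ) :
    IsPreconnected (⋃ k ∈ Finset.Ico m (m + n + 1), arcSet emb s(p k, p (k + 1))) := by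
  induction n with
  | zero =>
    rw [show Finset.Ico m (m + (0 : ℕ) + 1) = {m} by ext; simp; omega]
    simpa using (emb.isArc (S.adj m)).isPreconnected
  | succ n ih =>
    rw [show Finset.Ico m (m + (n + 1 : ℕ) + 1) = insert (m + n + 1) (Finset.Ico m (m + n + 1)) by
      ext; simp only [Finset.mem_Ico, Finset.mem_insert]; push_cast; omega,
      Finset.set_biUnion_insert]
    refine IsPreconnected.union (emb.pos (p (m + n + 1))) (emb.isArc (S.adj _)).left_mem ?_
      (emb.isArc (S.adj _)).isPreconnected ih
    exact Set.mem_biUnion (x := m + n) (by simp) (emb.isArc (S.adj _)).right_mem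

/-- The part of the cycle avoiding a given vertex is connected. -/
theorem exists_path_avoiding (S : CycleSetup C p) (emb : PlaneEmbedding G) (v : V) :
    ∃ P : Set (ℝ × ℝ), IsPreconnected P ∧ P.Nonempty ∧ (∀ i, p i ≠ v → emb.pos (p i) ∈ P) ∧
      P ⊆ drawE emb {e | e ∈ C.edges ∧ v ∉ e} := by
  have hlen := S.len
  obtain ⟨m, n, hmn, hmn'⟩ : ∃ (m : ℤ) (n : ℕ), (∀ k, m ≤ k → k ≤ m + n + 1 → p k ≠ v) ∧
      ∀ i, p i ≠ v → ∃ k, m ≤ k ∧ k ≤ m + n + 1 ∧ p k = p i := by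
    by_cases hv : v ∈ C.support
    · obtain ⟨i, rfl⟩ := (S.mem_support v).1 hv
      refine ⟨i + 1, C.length - 3, fun k h1 h2 e => ?_, fun j hj => ?_⟩
      · have := S.eq_of_eq e (by omega) (by omega)
        omega
      · obtain ⟨k, h1, h2, h3⟩ := S.exists_window (by omega) (i + 1) j
        have hk : k ≠ i + C.length := by
          rintro rfl
          exact hj (by rw [← h3, S.periodic])
        exact ⟨k, h1, by omega, h3⟩
    · refine ⟨0, C.length - 1, fun k _ _ e => hv ((S.mem_support v).2 ⟨k, e⟩), fun j _ => ?_⟩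
      obtain ⟨k, h1, h2, h3⟩ := S.exists_window (by omega) 0 j
      exact ⟨k, h1, by omega, h3⟩
  refine ⟨_, S.isPreconnected_path emb m n, ?_, fun i hi => ?_, ?_⟩
  · exact ⟨_, Set.mem_biUnion (x := m) (by simp) (emb.isArc (S.adj m)).left_mem⟩
  · obtain ⟨k, h1, h2, h3⟩ := hmn' i hi
    rw [← h3]
    rcases h2.lt_or_eq with h2 | h2
    · exact Set.mem_biUnion (x := k) (by simp; omega) (emb.isArc (S.adj k)).left_mem
    · refine Set.mem_biUnion (x := m + n) (by simp) ?_
      rw [h2]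
      exact (emb.isArc (S.adj _)).right_mem
  · refine Set.iUnion₂_subset fun k hk => ?_
    simp only [Finset.mem_Ico] at hk
    refine fun z hz => mem_drawE.2 ⟨_, ⟨S.mem_edges_step k, ?_⟩, hz⟩
    rw [Sym2.mem_iff, not_or]
    exact ⟨(hmn k hk.1 (by omega)).symm, (hmn (k + 1) (by omega) (by omega)).symm⟩

theorem robust (S : CycleSetup C p) (emb : PlaneEmbedding G) {E : Set (Sym2 V)}
    (hE : E ⊆ G.edgeSet) (hCE : ∀ e ∈ C.edges, e ∈ E)
    (hoff : ∀ v ∉ C.support, ∀ w, G.Adj v w → s(v, w) ∈ E) : Robust emb E where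
  subset := hE
  isPreconnected v := by
    obtain ⟨P, hP, ⟨z₀, hz₀⟩, hPv, hPE⟩ := S.exists_path_avoiding emb v
    have hPE' : P ⊆ drawE emb {e ∈ E | v ∉ e} :=
      hPE.trans (drawE_mono emb fun e he => ⟨hCE e he.1, he.2⟩)
    refine isPreconnected_of_forall z₀ fun z hz => ?_
    obtain ⟨e, ⟨he, hve⟩, hz⟩ := mem_drawE.1 hz
    have hend : ∃ i, p i ∈ e := by
      induction e with
      | h a b =>
        by_cases ha : a ∈ C.support
        · obtain ⟨i, rfl⟩ := (S.mem_support a).1 ha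
          exact ⟨i, by simp⟩
        · obtain ⟨i, rfl⟩ := S.mem_support_of_adj ha (hE he)
          exact ⟨i, by simp⟩
    obtain ⟨i, hi⟩ := hend
    refine ⟨P ∪ arcSet emb e, Set.union_subset hPE' ?_, Or.inl hz₀, Or.inr hz, ?_⟩
    · exact fun w hw => mem_drawE.2 ⟨e, ⟨he, hve⟩, hw⟩
    · exact IsPreconnected.union _ (hPv i fun h => hve (h ▸ hi))
        ((emb.pos_mem_arcSet_iff (hE he)).2 hi) hP (emb.isPreconnected_arcSet (hE he))
  exists_ne v w hvw := by
    have hlen := S.len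
    by_cases hv : v ∈ C.support
    · obtain ⟨i, rfl⟩ := (S.mem_support v).1 hv
      by_cases hw : p (i + 1) = w
      · refine ⟨p (i - 1), ?_, ?_⟩
        · rw [← hw]
          exact S.ne (by omega) (by omega) (by omega)
        · have := hCE _ (S.mem_edges_step (i - 1))
          rwa [sub_add_cancel, Sym2.eq_swap] at this
      · exact ⟨_, hw, hCE _ (S.mem_edges_step i)⟩
    · obtain ⟨u, hu, hne⟩ := Finset.exists_mem_ne (s := Finset.univ.filter fun w => G.Adj v w)
        (by rw [(S.longest.2.1 v hv).1]; norm_num) w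
      exact ⟨u, hne, hoff v hv u (Finset.mem_filter.1 hu).2⟩

theorem robust_Hgraph (S : CycleSetup C p) (emb : PlaneEmbedding G) :
    Robust emb (Hgraph C).edgeSet :=
  S.robust emb (fun _ he => (mem_Hgraph.1 he).1) (fun _ => mem_Hgraph_of_mem_edges)
    fun _ hv _ => mem_Hgraph_of_notMem hv

theorem robust_insert (S : CycleSetup C p) (emb : PlaneEmbedding G) {e : Sym2 V}
    (he : e ∈ G.edgeSet) : Robust emb (insert e (Hgraph C).edgeSet) :=
  S.robust emb (Set.insert_subset he fun _ he => (mem_Hgraph.1 he).1)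
    (fun _ h => Or.inr (mem_Hgraph_of_mem_edges h)) fun _ hv _ h =>
      Or.inr (mem_Hgraph_of_notMem hv h)

theorem exists_mem_Hgraph (S : CycleSetup C p) (v : V) : ∃ w, s(v, w) ∈ (Hgraph C).edgeSet := by
  by_cases hv : v ∈ C.support
  · obtain ⟨i, rfl⟩ := (S.mem_support v).1 hv
    exact ⟨_, mem_Hgraph_of_mem_edges (S.mem_edges_step i)⟩
  · obtain ⟨u, hu⟩ := Finset.card_pos.1 (show 0 < (Finset.univ.filter fun w => G.Adj v w).card by
      rw [(S.longest.2.1 v hv).1]; norm_num)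
    exact ⟨u, mem_Hgraph_of_notMem hv (Finset.mem_filter.1 hu).2⟩

theorem drawingH_eq (S : CycleSetup C p) (emb : PlaneEmbedding G) :
    drawingH emb C = drawE emb (Hgraph C).edgeSet := by
  ext z
  simp only [drawingH, drawingOn, Set.mem_union, Set.mem_image, Set.mem_univ, true_and,
    Set.mem_iUnion, exists_prop, mem_drawE]
  constructor
  · rintro (⟨v, rfl⟩ | ⟨u, v, huv, hz⟩)
    · obtain ⟨w, hw⟩ := S.exists_mem_Hgraph v
      exact ⟨_, hw, (emb.pos_mem_arcSet_iff (mem_Hgraph.1 hw).1).2 (Sym2.mem_mk_left v w)⟩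
    · exact ⟨s(u, v), huv, hz⟩
  · rintro ⟨e, he, hz⟩
    induction e with
    | h u v => exact Or.inr ⟨u, v, he, hz⟩

theorem mem_Vminus_union_Vplus (emb : PlaneEmbedding G) {v : V} :
    v ∈ Vminus emb C ∪ Vplus emb C ↔ v ∉ C.support := by
  simp only [Finset.mem_union, Vplus, Finset.mem_filter, Finset.mem_univ, true_and]
  constructor
  · rintro (h | h)
    · simp only [Vminus, Finset.mem_filter] at h
      exact h.2.1
    · exact h.1
  · intro h
    by_cases h' : v ∈ Vminus emb C
    exacts [Or.inl h', Or.inr ⟨h, h'⟩]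

theorem minorFaceH_iff (S : CycleSetup C p) (emb : PlaneEmbedding G) {f : Set (ℝ × ℝ)} :
    MinorFaceH emb C f ↔ IsFaceOf (drawE emb (Hgraph C).edgeSet) f ∧
      ∃! v, v ∉ C.support ∧ incVertex emb f v := by
  rw [MinorFaceH, MinorFaceOf, S.drawingH_eq]
  simp only [mem_Vminus_union_Vplus]

end CycleSetup
end Setup

section MinorFaces

variable {V : Type*} {G : SimpleGraph V} {x : V} {C : G.Walk x x} {p : ℤ → V}

namespace CycleIndex

theorem add_eq_add_iff (h : CycleIndex C p) (i j r : ℤ) : p (i + r) = p (j + r) ↔ p i = p j := by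
  rw [h.eq_iff, h.eq_iff]; ring_nf

theorem sub_eq_sub_iff (h : CycleIndex C p) (i j r : ℤ) : p (r - i) = p (r - j) ↔ p i = p j := by
  rw [h.eq_iff, h.eq_iff, show r - i - (r - j) = -(i - j) by ring, dvd_neg]

theorem edge_eq_iff (h : CycleIndex C p) (hc : 3 ≤ C.length) (i j : ℤ) :
    s(p i, p (i + 1)) = s(p j, p (j + 1)) ↔ p i = p j := by
  constructor
  · rw [Sym2.eq_iff]
    rintro (⟨h1, -⟩ | ⟨h1, h2⟩)
    · exact h1
    · exfalso
      rw [h.eq_iff] at h1 h2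
      have h3 := dvd_sub h2 h1
      rw [show i + 1 - j - (i - (j + 1)) = 2 by ring] at h3
      have := Int.le_of_dvd (by norm_num) h3
      omega
  · intro h1
    rw [h1, (h.add_eq_add_iff i j 1).2 h1]

theorem card_filter_edges (h : CycleIndex C p) (hc : 3 ≤ C.length) (a : ℤ) (P : Sym2 V → Prop) :
    (C.edges.toFinset.filter P).card =
      ((Finset.Ico a (a + C.length)).filter fun k => P s(p k, p (k + 1))).card := by
  symm
  refine Finset.card_bij (fun k _ => s(p k, p (k + 1))) ?_ ?_ ?_
  · intro k hk
    simp only [Finset.mem_filter, List.mem_toFinset] at hk ⊢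
    exact ⟨h.mem_edges_step k, hk.2⟩
  · intro k hk l hl hkl
    simp only [Finset.mem_filter, Finset.mem_Ico] at hk hl
    exact h.eq_of_eq ((h.edge_eq_iff hc k l).1 hkl) (by omega) (by omega)
  · intro e he
    simp only [Finset.mem_filter, List.mem_toFinset] at he
    obtain ⟨i, rfl⟩ := (h.mem_edges e).1 he.1
    obtain ⟨k, h1, h2, h3⟩ := h.exists_window (by omega) a i
    have hk := (h.edge_eq_iff hc k i).2 h3
    exact ⟨k, by simpa [h1, h2, hk] using he.2, hk⟩

end CycleIndex

/-- The face `f` of `H` is bounded by the path `p a, …, p (a + j)` of the cycle together with the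
vertex `v` off the cycle. -/
structure MinorFace (emb : PlaneEmbedding G) (C : G.Walk x x) (p : ℤ → V) (f : Set (ℝ × ℝ)) (v : V)
    (a j : ℤ) : Prop where
  face : IsFaceOf (drawE emb (Hgraph C).edgeSet) f
  notMem : v ∉ C.support
  adj_left : G.Adj v (p a)
  adj_right : G.Adj v (p (a + j))
  pos : 0 < j
  lt : j < C.length
  incEdge_iff : ∀ k, incEdge emb f s(p k, p (k + 1)) ↔ ∃ l, a ≤ l ∧ l < a + j ∧ p l = p k
  incVertex_iff : ∀ k, incVertex emb f (p k) ↔ ∃ l, a ≤ l ∧ l ≤ a + j ∧ p l = p k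
  eq_of_incVertex : ∀ u, u ∉ C.support → incVertex emb f u → u = v

namespace MinorFace

variable {emb : PlaneEmbedding G} {f : Set (ℝ × ℝ)} {v : V} {a j : ℤ}

theorem incEdge (h : MinorFace emb C p f v a j) {k : ℤ} (h1 : a ≤ k) (h2 : k < a + j) :
    incEdge emb f s(p k, p (k + 1)) :=
  (h.incEdge_iff k).2 ⟨k, h1, h2, rfl⟩

theorem not_incEdge (h : MinorFace emb C p f v a j) (hp : CycleIndex C p) {k : ℤ} (h1 : a + j ≤ k)
    (h2 : k < a + C.length) : ¬ _root_.incEdge emb f s(p k, p (k + 1)) := by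
  rw [h.incEdge_iff]
  rintro ⟨l, h3, h4, h5⟩
  have := hp.eq_of_eq h5 (by omega) (by omega)
  omega

theorem reflect (h : MinorFace emb C p f v a j) (hp : CycleIndex C p) (r : ℤ) :
    MinorFace emb C (fun i => p (r - i)) f v (r - a - j) j where
  face := h.face
  notMem := h.notMem
  adj_left := by simpa [show r - (r - a - j) = a + j by ring] using h.adj_right
  adj_right := by simpa using h.adj_left
  pos := h.pos
  lt := h.lt
  incEdge_iff k := by
    have := h.incEdge_iff (r - (k + 1))
    rw [show r - (k + 1) + 1 = r - k by ring, Sym2.eq_swap] at this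
    rw [this]
    constructor
    · rintro ⟨l, h1, h2, h3⟩
      refine ⟨r - (l + 1), by omega, by omega, ?_⟩
      simp only [sub_sub_cancel]
      rw [← hp.add_eq_add_iff _ _ 1] at h3
      rw [h3]; ring_nf
    · rintro ⟨l, h1, h2, h3⟩
      refine ⟨r - (l + 1), by omega, by omega, ?_⟩
      rw [hp.sub_eq_sub_iff] at h3 ⊢
      rwa [hp.add_eq_add_iff]
  incVertex_iff k := by
    rw [h.incVertex_iff]
    constructor
    · rintro ⟨l, h1, h2, h3⟩
      exact ⟨r - l, by omega, by omega, by simpa using h3⟩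
    · rintro ⟨l, h1, h2, h3⟩
      exact ⟨r - l, by omega, by omega, h3⟩
  eq_of_incVertex := h.eq_of_incVertex

theorem congr_of_eq (h : MinorFace emb C p f v a j) (hp : CycleIndex C p) {b : ℤ}
    (hb : p b = p a) : MinorFace emb C p f v b j where
  face := h.face
  notMem := h.notMem
  adj_left := hb ▸ h.adj_left
  adj_right := by
    rw [(hp.add_eq_add_iff b a j).2 hb]
    exact h.adj_right
  pos := h.pos
  lt := h.lt
  incEdge_iff k := by
    rw [h.incEdge_iff]
    constructor
    · rintro ⟨l, h1, h2, h3⟩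
      refine ⟨b + (l - a), by omega, by omega, ?_⟩
      rw [(hp.add_eq_add_iff b a (l - a)).2 hb, ← h3]; ring_nf
    · rintro ⟨l, h1, h2, h3⟩
      refine ⟨a + (l - b), by omega, by omega, ?_⟩
      rw [(hp.add_eq_add_iff a b (l - b)).2 hb.symm, ← h3]; ring_nf
  incVertex_iff k := by
    rw [h.incVertex_iff]
    constructor
    · rintro ⟨l, h1, h2, h3⟩
      refine ⟨b + (l - a), by omega, by omega, ?_⟩
      rw [(hp.add_eq_add_iff b a (l - a)).2 hb, ← h3]; ring_nf
    · rintro ⟨l, h1, h2, h3⟩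
      refine ⟨a + (l - b), by omega, by omega, ?_⟩
      rw [(hp.add_eq_add_iff a b (l - b)).2 hb.symm, ← h3]; ring_nf
  eq_of_incVertex := h.eq_of_incVertex

theorem shift (h : MinorFace emb C p f v a j) (r : ℤ) :
    MinorFace emb C (fun i => p (i + r)) f v (a - r) j where
  face := h.face
  notMem := h.notMem
  adj_left := by simpa using h.adj_left
  adj_right := by simpa [show a - r + j + r = a + j by ring] using h.adj_right
  pos := h.pos
  lt := h.lt
  incEdge_iff k := by
    have := h.incEdge_iff (k + r)
    rw [show k + r + 1 = k + 1 + r by ring] at this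
    rw [this]
    constructor
    · rintro ⟨l, h1, h2, h3⟩
      exact ⟨l - r, by omega, by omega, by simpa using h3⟩
    · rintro ⟨l, h1, h2, h3⟩
      exact ⟨l + r, by omega, by omega, h3⟩
  incVertex_iff k := by
    rw [h.incVertex_iff]
    constructor
    · rintro ⟨l, h1, h2, h3⟩
      exact ⟨l - r, by omega, by omega, by simpa using h3⟩
    · rintro ⟨l, h1, h2, h3⟩
      exact ⟨l + r, by omega, by omega, h3⟩
  eq_of_incVertex := h.eq_of_incVertex

theorem numCEdges_eq (h : MinorFace emb C p f v a j) (hp : CycleIndex C p) (hc : 3 ≤ C.length) :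
    (numCEdges emb C f : ℤ) = j := by
  rw [numCEdges, hp.card_filter_edges hc a]
  have : ((Finset.Ico a (a + C.length)).filter fun k => _root_.incEdge emb f s(p k, p (k + 1))) =
      Finset.Ico a (a + j) := by
    ext k
    simp only [Finset.mem_filter, Finset.mem_Ico]
    have := h.lt
    constructor
    · rintro ⟨⟨h1, h2⟩, h3⟩
      refine ⟨h1, ?_⟩
      by_contra! hk
      exact h.not_incEdge hp hk h2 h3
    · rintro ⟨h1, h2⟩
      exact ⟨⟨h1, by omega⟩, h.incEdge h1 h2⟩
  rw [this, Int.card_Ico]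
  have := h.pos
  omega

end MinorFace

namespace CycleSetup

variable [Fintype V] {emb : PlaneEmbedding G} {f : Set (ℝ × ℝ)}

/-- The edges of `H` at a vertex of the cycle. -/
theorem eq_of_mem_Hgraph (S : CycleSetup C p) {i : ℤ} {w : V}
    (h : s(p i, w) ∈ (Hgraph C).edgeSet) : w = p (i - 1) ∨ w = p (i + 1) ∨ w ∉ C.support := by
  by_cases hw : w ∈ C.support
  · obtain ⟨h1, h2⟩ := mem_Hgraph.1 h
    have h3 : s(p i, w) ∈ C.edges := by
      by_contra h3
      refine h2 ⟨h1, h3, fun u hu => ?_⟩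
      rcases Sym2.mem_iff.1 hu with rfl | rfl
      exacts [(S.mem_support _).2 ⟨i, rfl⟩, hw]
    obtain ⟨k, hk⟩ := (S.mem_edges _).1 h3
    rcases Sym2.eq_iff.1 hk with ⟨h4, rfl⟩ | ⟨h4, rfl⟩
    · exact Or.inr (Or.inl ((S.add_eq_add_iff k i 1).2 h4.symm))
    · refine Or.inl ?_
      have := (S.add_eq_add_iff i (k + 1) (-1)).2 h4
      rw [show i + -1 = i - 1 by ring, show k + 1 + -1 = k by ring] at this
      exact this.symm
  · exact Or.inr (Or.inr hw)

theorem prev_mem_Hgraph (S : CycleSetup C p) (i : ℤ) :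
    s(p i, p (i - 1)) ∈ (Hgraph C).edgeSet := by
  have := mem_Hgraph_of_mem_edges (S.mem_edges_step (i - 1))
  rwa [sub_add_cancel, Sym2.eq_swap] at this

theorem next_mem_Hgraph (S : CycleSetup C p) (i : ℤ) :
    s(p i, p (i + 1)) ∈ (Hgraph C).edgeSet :=
  mem_Hgraph_of_mem_edges (S.mem_edges_step i)

theorem exists_minorFace (S : CycleSetup C p) (hf : MinorFaceH emb C f) :
    ∃ v a, MinorFace emb C p f v a (numCEdges emb C f) := by
  have hlen := S.len
  obtain ⟨hf, v, ⟨hv, hvf⟩, huniq⟩ := (S.minorFaceH_iff emb).1 hf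
  have R := S.robust_Hgraph emb
  obtain ⟨w, hw⟩ := S.exists_mem_Hgraph v
  obtain ⟨w₁, w₂, hne, hE₁, hE₂, hi₁, hi₂⟩ := R.exists_two_edges hw hf hvf
  have vert : ∀ {k}, incEdge emb f s(p k, p (k + 1)) → incVertex emb f (p k) := fun {k} hk =>
    incVertex_of_incEdge (S.adj k) hk (Sym2.mem_mk_left _ _)
  have vert' : ∀ {k}, incEdge emb f s(p k, p (k - 1)) → incVertex emb f (p k) := fun {k} hk =>
    incVertex_of_incEdge (R.subset (S.prev_mem_Hgraph k)) hk (Sym2.mem_mk_left _ _)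
  have off : ∀ {k u}, s(p k, u) ∈ (Hgraph C).edgeSet → u ∉ C.support → incEdge emb f s(p k, u) →
      u = v ∧ (p k = w₁ ∨ p k = w₂) := by
    intro k u hu huC hinc
    have huv := huniq u ⟨huC, incVertex_of_incEdge (R.subset hu) hinc (Sym2.mem_mk_right _ _)⟩
    subst huv
    exact ⟨rfl, R.eq_or_eq_of_incEdge hE₁ hE₂ (Sym2.eq_swap ▸ hu) hf hi₁ hi₂
      (Sym2.eq_swap ▸ hinc) hne⟩
  have hpm : ∀ k, p (k - 1) ≠ p (k + 1) := fun k => S.ne (by omega) (by omega) (by omega)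
  have hoffne : ∀ k, v ≠ p k := fun k e => hv ((S.mem_support v).2 ⟨k, e.symm⟩)
  have key : ∀ k, incVertex emb f (p k) →
      (p k ≠ w₁ → p k ≠ w₂ →
        incEdge emb f s(p k, p (k - 1)) ∧ incEdge emb f s(p k, p (k + 1))) := by
    intro k hk h1 h2
    obtain ⟨u₁, u₂, hu, hu₁, hu₂, hf₁, hf₂⟩ := R.exists_two_edges (S.next_mem_Hgraph k) hf hk
    have c1 : ∀ {u}, s(p k, u) ∈ (Hgraph C).edgeSet → incEdge emb f s(p k, u) →
        u = p (k - 1) ∨ u = p (k + 1) := by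
      intro u hu hi
      rcases S.eq_of_mem_Hgraph hu with h | h | h
      · exact Or.inl h
      · exact Or.inr h
      · rcases (off hu h hi).2 with h | h
        exacts [absurd h h1, absurd h h2]
    rcases c1 hu₁ hf₁ with rfl | rfl <;> rcases c1 hu₂ hf₂ with rfl | rfl
    exacts [absurd rfl hu, ⟨hf₁, hf₂⟩, ⟨hf₂, hf₁⟩, absurd rfl hu]
  have key' : ∀ k, p k = w₁ ∨ p k = w₂ → incVertex emb f (p k) ∧
      (¬ incEdge emb f s(p k, p (k - 1)) ↔ incEdge emb f s(p k, p (k + 1))) := by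
    intro k hk
    have hE : s(p k, v) ∈ (Hgraph C).edgeSet := by
      rw [Sym2.eq_swap]; rcases hk with h | h <;> rw [h] <;> assumption
    have hi : incEdge emb f s(p k, v) := by
      rw [Sym2.eq_swap]; rcases hk with h | h <;> rw [h] <;> assumption
    have hinc := incVertex_of_incEdge (R.subset hE) hi (Sym2.mem_mk_left _ _)
    refine ⟨hinc, ?_⟩
    obtain ⟨u₁, u₂, hu, hu₁, hu₂, hf₁, hf₂⟩ := R.exists_two_edges (S.next_mem_Hgraph k) hf hinc
    have : ∃ u, u ≠ v ∧ s(p k, u) ∈ (Hgraph C).edgeSet ∧ incEdge emb f s(p k, u) := by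
      by_cases e : u₁ = v
      · exact ⟨u₂, fun e' => hu (e.trans e'.symm), hu₂, hf₂⟩
      · exact ⟨u₁, e, hu₁, hf₁⟩
    obtain ⟨u, huv, huE, hui⟩ := this
    constructor
    · intro hn
      rcases S.eq_of_mem_Hgraph huE with rfl | rfl | h
      · exact absurd hui hn
      · exact hui
      · exact absurd (off huE h hui).1 huv
    · intro h1 h2
      rcases R.eq_or_eq_of_incEdge (S.prev_mem_Hgraph k) (S.next_mem_Hgraph k) hE hf h2 h1 hi
        (hpm k) with e | e
      exacts [hoffne _ e, hoffne _ e]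
  -- membership of consecutive edges
  have step : ∀ k, p (k + 1) ≠ w₁ → p (k + 1) ≠ w₂ →
      (incEdge emb f s(p k, p (k + 1)) ↔ incEdge emb f s(p (k + 1), p (k + 1 + 1))) := by
    intro k h1 h2
    constructor
    · intro h
      have h' : incEdge emb f s(p (k + 1), p (k + 1 - 1)) := by
        rwa [add_sub_cancel_right, Sym2.eq_swap]
      exact (key _ (vert' h') h1 h2).2
    · intro h
      have := (key _ (vert h) h1 h2).1
      rwa [add_sub_cancel_right, Sym2.eq_swap] at this
  have flip : ∀ k, p (k + 1) = w₁ ∨ p (k + 1) = w₂ →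
      (¬ incEdge emb f s(p k, p (k + 1)) ↔ incEdge emb f s(p (k + 1), p (k + 1 + 1))) := by
    intro k h
    have := (key' _ h).2
    rwa [add_sub_cancel_right, Sym2.eq_swap] at this
  have const : ∀ a b : ℤ, a ≤ b → (∀ k, a < k → k ≤ b → p k ≠ w₁ ∧ p k ≠ w₂) →
      (incEdge emb f s(p a, p (a + 1)) ↔ incEdge emb f s(p b, p (b + 1))) := by
    intro a b hab
    induction b, hab using Int.leInduction with
    | base => simp
    | succ b hab ih =>
      intro h
      rw [ih fun k h1 h2 => h k h1 (by omega)]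
      exact step b (h (b + 1) (by omega) le_rfl).1 (h (b + 1) (by omega) le_rfl).2
  have core : ∀ a b : ℤ, a < b → b < a + C.length → (p a = w₁ ∧ p b = w₂ ∨ p a = w₂ ∧ p b = w₁) →
      incEdge emb f s(p a, p (a + 1)) → MinorFace emb C p f v a (b - a) := by
    intro a b hab hb hw hinc
    have hd : ∀ k, a < k → k < a + C.length → k ≠ b → p k ≠ w₁ ∧ p k ≠ w₂ := by
      intro k h1 h2 h3
      have e1 : p k ≠ p a := S.ne (by omega) (by omega) (by omega)
      have e2 : p k ≠ p b := S.ne h3 (by omega) (by omega)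
      rcases hw with ⟨h, h'⟩ | ⟨h, h'⟩
      · rw [← h, ← h']; exact ⟨e1, e2⟩
      · rw [← h, ← h']; exact ⟨e2, e1⟩
    have hin : ∀ k, a ≤ k → k < b → incEdge emb f s(p k, p (k + 1)) := fun k h1 h2 =>
      (const a k h1 fun m h3 h4 => hd m h3 (by omega) (by omega)).1 hinc
    have hbb : ¬ incEdge emb f s(p b, p (b + 1)) := by
      have h1 := flip (b - 1) (by rw [sub_add_cancel]; tauto)
      rw [sub_add_cancel] at h1
      rw [← h1, not_not]
      have := hin (b - 1) (by omega) (by omega)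
      rwa [sub_add_cancel] at this
    have hout : ∀ k, b ≤ k → k < a + C.length → ¬ incEdge emb f s(p k, p (k + 1)) :=
      fun k h1 h2 h =>
      hbb ((const b k h1 fun m h3 h4 => hd m (by omega) (by omega) (by omega)).2 h)
    have hadj : ∀ k, p k = w₁ ∨ p k = w₂ → G.Adj v (p k) := by
      rintro k (h | h) <;> rw [h]
      exacts [R.adj hE₁, R.adj hE₂]
    have hab' : a + (b - a) = b := by ring
    have heq : ∀ {k l}, p l = p k → (incEdge emb f s(p l, p (l + 1)) ↔
        incEdge emb f s(p k, p (k + 1))) := by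
      intro k l h
      rw [(S.edge_eq_iff (by omega) l k).2 h]
    refine ⟨hf, hv, hadj a (by tauto), ?_, by omega, by omega, fun k => ?_, fun k => ?_,
      fun u h1 h2 => huniq u ⟨h1, h2⟩⟩
    · rw [hab']; exact hadj b (by tauto)
    · rw [hab']
      constructor
      · intro h
        obtain ⟨l, h1, h2, h3⟩ := S.exists_window (by omega) a k
        refine ⟨l, h1, ?_, h3⟩
        by_contra! h4
        exact hout l h4 h2 ((heq h3).2 h)
      · rintro ⟨l, h1, h2, h3⟩
        exact (heq h3).1 (hin l h1 h2)
    · rw [hab']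
      constructor
      · intro h
        obtain ⟨l, h1, h2, h3⟩ := S.exists_window (by omega) a k
        refine ⟨l, h1, ?_, h3⟩
        by_contra! h4
        rw [← h3] at h
        have := hd l (by omega) h2 (by omega)
        exact hout l (by omega) h2 (key l h this.1 this.2).2
      · rintro ⟨l, h1, h2, h3⟩
        rw [← h3]
        rcases h2.lt_or_eq with h2 | rfl
        · exact vert (hin l h1 h2)
        · exact (key' l (by tauto)).1
  suffices h : ∃ a j, MinorFace emb C p f v a j by
    obtain ⟨a, j, h⟩ := h
    rw [← h.numCEdges_eq S.toCycleIndex (by omega)] at h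
    exact ⟨v, a, h⟩
  obtain ⟨a, rfl⟩ := S.mem_support_of_adj hv (R.adj hE₁)
  obtain ⟨b₀, hb₀⟩ := S.mem_support_of_adj hv (R.adj hE₂)
  obtain ⟨b, h1, h2, h3⟩ := S.exists_window (by omega) a b₀
  have hab : a ≠ b := by
    rintro rfl
    exact hne (h3.trans hb₀)
  by_cases hinc : incEdge emb f s(p a, p (a + 1))
  · exact ⟨a, _, core a b (by omega) h2 (Or.inl ⟨rfl, h3.trans hb₀⟩) hinc⟩
  · refine ⟨b, _, core b (a + C.length) (by omega) (by omega)
      (Or.inr ⟨h3.trans hb₀, S.periodic a⟩) ?_⟩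
    have h4 := (flip (b - 1) (Or.inr (by rw [sub_add_cancel]; exact h3.trans hb₀))).1 (by
      rw [← const a (b - 1) (by omega) fun k h5 h6 => ⟨?_, ?_⟩]
      · exact hinc
      · exact S.ne (by omega) (by omega) (by omega)
      · rw [← hb₀, ← h3]
        exact S.ne (by omega) (by omega) (by omega))
    rwa [sub_add_cancel] at h4

end CycleSetup
end MinorFaces

section Extension

variable {V : Type*} {G : SimpleGraph V} {x : V} {C : G.Walk x x} {p : ℤ → V}

theorem SimpleGraph.exists_isCycle_of_isChain {l : List V} (h3 : 3 ≤ l.length) (hn : l.Nodup)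
    (hl : l.IsChain G.Adj) (hne : l ≠ []) (hadj : G.Adj (l.getLast hne) (l.head hne)) :
    ∃ (y : V) (C' : G.Walk y y), C'.IsCycle ∧ C'.length = l.length ∧ ∀ v ∈ l, v ∈ C'.support := by
  have hsup := SimpleGraph.Walk.support_ofSupport hne hl
  have hlen := SimpleGraph.Walk.length_ofSupport hne hl
  have hpath : (SimpleGraph.Walk.ofSupport l hne hl).IsPath := .mk' (by rwa [hsup])
  refine ⟨_, .cons hadj (.ofSupport l hne hl), ?_, ?_, fun v hv => ?_⟩
  · rw [SimpleGraph.Walk.cons_isCycle_iff]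
    refine ⟨hpath, fun h => ?_⟩
    have := hpath.length_eq_one_of_mem_edges (Sym2.eq_swap ▸ h)
    omega
  · rw [SimpleGraph.Walk.length_cons, hlen]
    omega
  · rw [SimpleGraph.Walk.support_cons, hsup]
    exact List.mem_cons_of_mem _ hv

namespace CycleSetup

variable [Fintype V]

/-- A segment of a longest isolating cycle cannot be replaced by a longer path through all of its
vertices and some vertices off the cycle. -/
theorem false_of_isChain (S : CycleSetup C p) {a b : ℤ} (hab : a < b) (hb : b < a + C.length)
    {l : List V} (hn : l.Nodup) (hl : l.IsChain G.Adj) (hhead : l.head? = some (p a))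
    (hlast : l.getLast? = some (p b)) (hmem : ∀ k, a ≤ k → k ≤ b → p k ∈ l)
    (hoff : ∀ k, b < k → k < a + C.length → p k ∉ l) (hlen : b - a + 1 < l.length) : False := by
  obtain ⟨n, hn'⟩ : ∃ n : ℕ, (n : ℤ) = a + C.length - b - 1 :=
    ⟨(a + C.length - b - 1).toNat, by omega⟩
  set r : List V := (List.range n).map fun k : ℕ => p (b + 1 + k) with hr
  have hmr : ∀ v, v ∈ r ↔ ∃ k : ℤ, b < k ∧ k < a + C.length ∧ p k = v := by
    intro v
    simp only [hr, List.mem_map, List.mem_range]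
    constructor
    · rintro ⟨k, hk, rfl⟩
      exact ⟨_, by omega, by omega, rfl⟩
    · rintro ⟨k, h1, h2, rfl⟩
      exact ⟨(k - b - 1).toNat, by omega, by congr 1; omega⟩
  have hrn : r.Nodup := by
    refine List.Nodup.map_on ?_ List.nodup_range
    intro i hi j hj h
    simp only [List.mem_range] at hi hj
    have := S.eq_of_eq h (by omega) (by omega)
    omega
  have hrc : r.IsChain G.Adj := by
    rw [hr, List.isChain_map]
    refine List.isChain_iff_getElem.2 fun i hi => ?_
    simp only [List.getElem_range]
    have := S.adj (b + 1 + i)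
    push_cast
    rwa [← add_assoc]
  have hlne : l ≠ [] := by rintro rfl; simp at hhead
  have hlast' : l.getLast hlne = p b := by
    rw [List.getLast?_eq_some_getLast hlne] at hlast
    exact Option.some.inj hlast
  have hhead' : l.head hlne = p a := by
    rw [List.head?_eq_some_head hlne] at hhead
    exact Option.some.inj hhead
  have hper := S.periodic a
  suffices h : (l ++ r).Nodup ∧ (l ++ r).IsChain G.Adj ∧
      G.Adj ((l ++ r).getLast (by simp [hlne])) ((l ++ r).head (by simp [hlne])) by
    obtain ⟨y, C', hC', hlen', hsup⟩ := SimpleGraph.exists_isCycle_of_isChain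
      (by rw [List.length_append]; omega) h.1 h.2.1 (by simp [hlne]) h.2.2
    have hsub : ∀ v, v ∈ C.support → v ∈ C'.support := by
      intro v hv
      obtain ⟨i, rfl⟩ := (S.mem_support v).1 hv
      obtain ⟨k, h1, h2, h3⟩ := S.exists_window (by have := S.len; omega) a i
      rw [← h3]
      refine hsup _ (List.mem_append.2 ?_)
      rcases le_or_gt k b with h | h
      · exact Or.inl (hmem k h1 h)
      · exact Or.inr ((hmr _).2 ⟨k, h, h2, rfl⟩)
    have := S.longest.2.2 y C' hC' fun v hv =>
      have h := S.longest.2.1 v fun h => hv (hsub v h)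
      ⟨h.1, fun w hw => hsub w (h.2 w hw)⟩
    have hrl : r.length = n := by simp [hr]
    rw [hlen', List.length_append, hrl] at this
    omega
  refine ⟨?_, ?_, ?_⟩
  · refine List.nodup_append.2 ⟨hn, hrn, ?_⟩
    rintro v hv w hw rfl
    obtain ⟨k, h1, h2, rfl⟩ := (hmr v).1 hw
    exact hoff k h1 h2 hv
  · refine hl.append hrc ?_
    intro u hu w hw
    rw [hlast, Option.mem_some_iff] at hu
    subst hu
    rw [hr, List.head?_map, Option.mem_map] at hw
    obtain ⟨k, hk, rfl⟩ := hw
    rcases n with _ | n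
    · simp at hk
    · rw [List.range_succ_eq_map, List.head?_cons, Option.mem_some_iff] at hk
      subst hk
      simpa using S.adj b
  · rw [List.head_append_of_ne_nil hlne, hhead']
    rcases n with _ | n
    · simp only [hr, List.range_zero, List.map_nil, List.append_nil, hlast']
      rw [← hper, show a + C.length = b + 1 by push_cast at hn'; omega]
      exact S.adj b
    · simp only [hr, List.range_succ, List.map_append, List.map_cons, List.map_nil]
      rw [List.getLast_append_of_ne_nil _ (by simp), List.getLast_append_of_ne_nil _ (by simp)]
      rw [List.getLast_singleton, ← hper, show a + C.length = b + 1 + n + 1 by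
        push_cast at hn'; omega]
      exact S.adj _

theorem adj_of_eq (S : CycleSetup C p) (i k : ℤ) (h : k = i + 1 ∨ i = k + 1) :
    G.Adj (p i) (p k) := by
  rcases h with rfl | rfl
  exacts [S.adj i, (S.adj k).symm]

/-- The form of `false_of_isChain` in which the path is given by cycle indices and labels of
vertices off the cycle. -/
theorem false_of_path (S : CycleSetup C p) {n : ℕ} (w : Fin n → V) (a b : ℤ) (l : List (ℤ ⊕ Fin n))
    (hw : ∀ i, w i ∉ C.support) (hwi : Function.Injective w)
    (hl : (l.map (Sum.elim p w)).IsChain G.Adj := by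
      simp only [List.map, Sum.elim_inl, Sum.elim_inr, Function.comp, List.isChain_cons_cons,
        List.isChain_singleton, and_true, Matrix.cons_val]
      and_intros
      all_goals first
        | exact CycleSetup.adj_of_eq (by assumption) _ _ (by decide)
        | assumption
        | (apply SimpleGraph.Adj.symm; assumption))
    (hb : b < a + 8 := by decide)
    (hab : a < b := by decide) (hhead : l.head? = some (Sum.inl a) := by rfl)
    (hlast : l.getLast? = some (Sum.inl b) := by rfl) (hn : l.Nodup := by decide)
    (hmem : ∀ k, a ≤ k → k ≤ b → Sum.inl k ∈ l := by intro k _ _; simp; omega)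
    (hbd : ∀ s ∈ l, Sum.elim (fun k => a ≤ k ∧ k ≤ b) (fun _ => True) s := by simp)
    (hlen : b - a + 1 < l.length := by decide) : False := by
  have hb' : b < a + C.length := by have := S.len; omega
  have hoff : ∀ i k, w i ≠ p k := fun i k h => hw i ((S.mem_support _).2 ⟨k, h.symm⟩)
  refine S.false_of_isChain hab hb' (l := l.map (Sum.elim p w)) ?_ hl ?_ ?_ ?_ ?_ ?_
  · refine List.Nodup.map_on ?_ hn
    rintro (i | i) hi (j | j) hj h
    · have hi' := hbd _ hi
      have hj' := hbd _ hj
      simp only [Sum.elim_inl] at hi' hj' h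
      rw [S.eq_of_eq h (by omega) (by omega)]
    · exact absurd h.symm (hoff _ _)
    · exact absurd h (hoff _ _)
    · rw [hwi h]
  · rw [List.head?_map, hhead]; rfl
  · rw [List.getLast?_map, hlast]; rfl
  · exact fun k h1 h2 => List.mem_map.2 ⟨_, hmem k h1 h2, rfl⟩
  · intro k h1 h2 h
    obtain ⟨s | s, hs, h⟩ := List.mem_map.1 h
    · have hs' := hbd _ hs
      simp only [Sum.elim_inl] at hs' h
      have := S.eq_of_eq h (by omega) (by omega)
      omega
    · exact hoff _ _ h
  · simpa using hlen

end CycleSetup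
end Extension

section ChordFaces

variable {V : Type*} {G : SimpleGraph V} {x : V} {C : G.Walk x x} {p : ℤ → V}

theorem drawE_insert (emb : PlaneEmbedding G) (e : Sym2 V) (E : Set (Sym2 V)) :
    drawE emb (insert e E) = drawE emb E ∪ arcSet emb e := by
  ext z
  simp only [mem_drawE, Set.mem_union, Set.mem_insert_iff, or_and_right, exists_or,
    exists_eq_left]
  exact or_comm

theorem Robust.attachedArc [Fintype V] {emb : PlaneEmbedding G} {E : Set (Sym2 V)}
    (h : Robust emb E) {u v u' v' : V} (huv : G.Adj u v) (hE : s(u, v) ∉ E)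
    (hu : s(u, u') ∈ E) (hv : s(v, v') ∈ E) :
    AttachedArc (drawE emb E) (arcSet emb s(u, v)) (emb.pos u) (emb.pos v) where
  isCompact := isCompact_drawE emb h.subset
  isPreconnected := by
    obtain ⟨B, hB, hD⟩ := h.attached hu
    rw [hD]
    exact IsPreconnected.union _ hB.left_mem (emb.isArc (h.adj hu)).left_mem hB.isPreconnected
      hB.isArc.isPreconnected
  isArc := emb.isArc huv
  inter := by
    ext z
    simp only [Set.mem_inter_iff, mem_drawE, Set.mem_insert_iff, Set.mem_singleton_iff]
    constructor
    · rintro ⟨hz, e, he, hze⟩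
      have hne : s(u, v) ≠ e := fun h' => hE (h' ▸ he)
      obtain ⟨w, rfl, hw, -⟩ := emb.exists_of_mem_of_mem huv (h.subset he) hne hz hze
      rcases Sym2.mem_iff.1 hw with rfl | rfl
      exacts [Or.inl rfl, Or.inr rfl]
    · rintro (rfl | rfl)
      · exact ⟨(emb.isArc huv).left_mem, _, hu, (emb.isArc (h.adj hu)).left_mem⟩
      · exact ⟨(emb.isArc huv).right_mem, _, hv, (emb.isArc (h.adj hv)).left_mem⟩

/-- The edge joining `p i` and `p k` is drawn inside the face `f`. -/
structure IsChordIn (emb : PlaneEmbedding G) (p : ℤ → V) (f : Set (ℝ × ℝ)) (i k : ℤ) : Prop where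
  adj : G.Adj (p i) (p k)
  subset : arcSet emb s(p i, p k) \ {emb.pos (p i), emb.pos (p k)} ⊆ f

namespace IsChordIn

variable {emb : PlaneEmbedding G} {f : Set (ℝ × ℝ)} {i k : ℤ}

theorem symm (h : IsChordIn emb p f i k) : IsChordIn emb p f k i :=
  ⟨h.adj.symm, by rw [Sym2.eq_swap, Set.pair_comm]; exact h.subset⟩

theorem notMem {E : Set (Sym2 V)} (h : IsChordIn emb p f i k) (hf : IsFaceOf (drawE emb E) f) :
    s(p i, p k) ∉ E := by
  intro hE
  obtain ⟨z, hz⟩ := (emb.isArc h.adj).diff_nonempty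
  exact hf.notMem (h.subset hz) (mem_drawE.2 ⟨_, hE, hz.1⟩)

end IsChordIn

namespace CycleSetup

variable [Fintype V] {emb : PlaneEmbedding G} {f g : Set (ℝ × ℝ)} {v v' : V} {a j a' j' i k : ℤ}

theorem false_of_crossing (S : CycleSetup C p) (F : MinorFace emb C p f v a j) {r s : ℤ}
    (h1 : IsChordIn emb p f i k) (h2 : IsChordIn emb p f r s) (hai : a ≤ i) (hir : i < r)
    (hrk : r < k) (hks : k < s) (hs : s ≤ a + j) : False := by
  have hlt := F.lt
  have hlen := S.len
  have R := S.robust_Hgraph emb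
  have R' := S.robust_insert emb (e := s(p i, p k)) h1.adj
  have hαE := h1.notMem F.face
  have hA := R.attachedArc h1.adj hαE (S.next_mem_Hgraph i) (S.next_mem_Hgraph k)
  have hβ : s(p r, p s) ∉ insert s(p i, p k) (Hgraph C).edgeSet := by
    rintro (h | h)
    · rcases Sym2.eq_iff.1 h with ⟨h, -⟩ | ⟨h, -⟩
      · exact S.ne (by omega) (by omega) (by omega) h
      · exact S.ne (by omega) (by omega) (by omega) h
    · exact h2.notMem F.face h
  have hB := R'.attachedArc h2.adj hβ (Or.inr (S.next_mem_Hgraph r)) (Or.inr (S.next_mem_Hgraph s))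
  obtain ⟨g, hg, hgβ⟩ := hB.exists_face
  obtain ⟨z, hz⟩ := hB.isArc.diff_nonempty
  have hgf : g ⊆ f := hg.subset_of_mem F.face (drawE_mono emb (Set.subset_insert _ _)) (hgβ hz)
    (h2.subset hz)
  have hcl : closure g ⊆ closure f := closure_mono hgf
  have hα : incEdge emb g s(p i, p k) := by
    rw [drawE_insert] at hg
    exact hA.subset_closure F.face h1.subset hg hgf
  have hβg : arcSet emb s(p r, p s) ⊆ closure g :=
    hB.isArc.subset_closure_diff.trans (closure_mono hgβ)
  have key : ∀ {m u}, p m ≠ p i → p m ≠ p k → incVertex emb g (p m) →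
      s(p m, u) ∈ (Hgraph C).edgeSet → incEdge emb f s(p m, u) → incEdge emb g s(p m, u) := by
    intro m u hi hk hm hu hf
    obtain ⟨w₁, w₂, hne, hw₁, hw₂, hi₁, hi₂⟩ := R'.exists_two_edges (Or.inr hu) hg hm
    have hmem : ∀ {w}, s(p m, w) ∈ insert s(p i, p k) (Hgraph C).edgeSet →
        s(p m, w) ∈ (Hgraph C).edgeSet := by
      rintro w (h | h)
      · rcases Sym2.eq_iff.1 h with ⟨h, -⟩ | ⟨h, -⟩
        exacts [absurd h hi, absurd h hk]
      · exact h
    rcases R.eq_or_eq_of_incEdge (hmem hw₁) (hmem hw₂) hu F.face (hi₁.trans hcl) (hi₂.trans hcl)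
      hf hne with rfl | rfl
    exacts [hi₁, hi₂]
  have hne : ∀ m, r ≤ m → m ≤ s → m ≠ k → p m ≠ p i ∧ p m ≠ p k := fun m _ _ _ =>
    ⟨S.ne (by omega) (by omega) (by omega), S.ne (by omega) (by omega) (by omega)⟩
  have fwd : ∀ m : ℤ, r ≤ m → m < k → incEdge emb g s(p m, p (m + 1)) := by
    intro m hm
    induction m, hm using Int.leInduction with
    | base =>
      intro _
      have := hne r le_rfl (by omega) (by omega)
      exact key this.1 this.2 (hβg hB.isArc.left_mem) (S.next_mem_Hgraph r)
        (F.incEdge (by omega) (by omega))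
    | succ m hm ih =>
      intro hmk
      have := hne (m + 1) (by omega) (by omega) (by omega)
      exact key this.1 this.2 (incVertex_of_incEdge (S.adj m) (ih (by omega))
        (Sym2.mem_mk_right _ _)) (S.next_mem_Hgraph _) (F.incEdge (by omega) (by omega))
  have hprev : ∀ m, r < m → m ≤ s → m ≠ k → incVertex emb g (p m) →
      incEdge emb g s(p (m - 1), p m) := by
    intro m h1 h2 h3 h4
    have := hne m (by omega) (by omega) (by omega)
    rw [Sym2.eq_swap]
    refine key this.1 this.2 h4 (S.prev_mem_Hgraph m) ?_
    have := F.incEdge (k := m - 1) (by omega) (by omega)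
    rwa [sub_add_cancel, Sym2.eq_swap] at this
  have bwd : ∀ n : ℕ, k < s - n → incEdge emb g s(p (s - n - 1), p (s - n)) := by
    intro n
    induction n with
    | zero =>
      intro _
      simpa using hprev s (by omega) le_rfl (by omega) (hβg hB.isArc.right_mem)
    | succ n ih =>
      intro hn
      push_cast at hn ⊢
      refine hprev (s - (n + 1)) (by omega) (by omega) (by omega) ?_
      refine incVertex_of_incEdge (e := s(p (s - n - 1), p (s - n))) ?_ (ih (by omega)) ?_
      · simpa using S.adj (s - n - 1)
      · rw [show s - ((n : ℤ) + 1) = s - n - 1 by ring]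
        exact Sym2.mem_mk_left _ _
  have e1 := fwd (k - 1) (by omega) (by omega)
  have e2 := bwd (s - k - 1).toNat (by omega)
  rw [show s - ((s - k - 1).toNat : ℤ) = k + 1 by omega, add_sub_cancel_right] at e2
  rw [sub_add_cancel, Sym2.eq_swap] at e1
  rw [Sym2.eq_swap] at hα
  rcases R'.eq_or_eq_of_incEdge (Or.inr (S.prev_mem_Hgraph k)) (Or.inr (S.next_mem_Hgraph k))
    (Or.inl Sym2.eq_swap) hg e1 e2 hα (S.ne (by omega) (by omega) (by omega)) with h | h
  · rw [h] at hαE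
    have := S.prev_mem_Hgraph k
    rw [Sym2.eq_swap] at this
    exact hαE this
  · rw [h] at hαE
    have := S.next_mem_Hgraph k
    rw [Sym2.eq_swap] at this
    exact hαE this

/-- The neighbours of a vertex that is interior to the boundary paths of two minor faces. -/
theorem adj_cases (S : CycleSetup C p) (F : MinorFace emb C p f v a j)
    (F' : MinorFace emb C p g v' a' j') (hfg : f ≠ g) (h1 : a < i) (h2 : i < a + j) (h3 : a' < i)
    (h4 : i < a' + j') {w : V} (hw : G.Adj (p i) w) :
    w = p (i - 1) ∨ w = p (i + 1) ∨
      (∃ k, a ≤ k ∧ k ≤ a + j ∧ (k < i - 1 ∨ i + 1 < k) ∧ w = p k ∧ IsChordIn emb p f i k) ∨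
      ∃ k, a' ≤ k ∧ k ≤ a' + j' ∧ (k < i - 1 ∨ i + 1 < k) ∧ w = p k ∧ IsChordIn emb p g i k := by
  have hlen := S.len
  have R := S.robust_Hgraph emb
  have prev : ∀ {f v a j}, MinorFace emb C p f v a j → a < i → i < a + j →
      incEdge emb f s(p i, p (i - 1)) := by
    intro f v a j F h1 h2
    have := F.incEdge (k := i - 1) (by omega) (by omega)
    rwa [sub_add_cancel, Sym2.eq_swap] at this
  have two : ∀ {w}, s(p i, w) ∈ (Hgraph C).edgeSet → w = p (i - 1) ∨ w = p (i + 1) :=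
    fun {w} hw => R.eq_or_eq_of_two_faces (S.prev_mem_Hgraph i) (S.next_mem_Hgraph i) hw F.face
      F'.face hfg (prev F h1 h2) (F.incEdge h1.le h2) (prev F' h3 h4) (F'.incEdge h3.le h4)
      (S.ne (by omega) (by omega) (by omega))
  by_cases hE : s(p i, w) ∈ (Hgraph C).edgeSet
  · rcases two hE with h | h
    exacts [Or.inl h, Or.inr (Or.inl h)]
  have hwC : w ∈ C.support := by
    by_contra hwC
    exact hE (Sym2.eq_swap ▸ mem_Hgraph_of_notMem hwC hw.symm)
  obtain ⟨l, rfl⟩ := (S.mem_support w).1 hwC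
  have hA := R.attachedArc hw hE (S.next_mem_Hgraph i) (S.next_mem_Hgraph l)
  obtain ⟨h, hh, hAh⟩ := hA.exists_face
  have hcl : arcSet emb s(p i, p l) ⊆ closure h :=
    hA.isArc.subset_closure_diff.trans (closure_mono hAh)
  have hedge : incEdge emb h s(p i, p (i + 1)) := by
    obtain ⟨w₁, w₂, hne, hw₁, hw₂, hi₁, hi₂⟩ := R.exists_two_edges (S.next_mem_Hgraph i) hh
      (hcl hA.isArc.left_mem)
    rcases two hw₁ with rfl | rfl
    · rcases two hw₂ with rfl | rfl
      exacts [absurd rfl hne, hi₂]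
    · exact hi₁
  have fin : ∀ {f v a j}, MinorFace emb C p f v a j → a < i → i < a + j → h = f →
      ∃ k, a ≤ k ∧ k ≤ a + j ∧ (k < i - 1 ∨ i + 1 < k) ∧ p l = p k ∧ IsChordIn emb p f i k := by
    rintro f v a j F h1 h2 rfl
    obtain ⟨k, h3, h4, h5⟩ := (F.incVertex_iff l).1 (hcl hA.isArc.right_mem)
    rw [← h5] at hw hAh hE
    refine ⟨k, h3, h4, ?_, h5.symm, hw, hAh⟩
    by_contra hk
    rcases (by omega : k = i ∨ k = i - 1 ∨ k = i + 1) with rfl | rfl | rfl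
    exacts [hw.ne rfl, hE (S.prev_mem_Hgraph i), hE (S.next_mem_Hgraph i)]
  rcases R.eq_or_eq (S.next_mem_Hgraph i) F.face F'.face hh (F.incEdge h1.le h2)
    (F'.incEdge h3.le h4) hedge hfg with h | h
  · exact Or.inr (Or.inr (Or.inl (fin F h1 h2 h)))
  · exact Or.inr (Or.inr (Or.inr (fin F' h3 h4 h)))

end CycleSetup

end ChordFaces

section Separators

variable {V : Type*} [Fintype V] {G : SimpleGraph V}

/-- A set with at most two neighbours outside leaves no further vertices. -/
theorem ThreeConnected.mem_of_adj_closed (h : ThreeConnected G) {S T : Finset V} (hS : S.card ≤ 2)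
    (hT : ∀ v ∈ T, ∀ w, G.Adj v w → w ∈ S ∨ w ∈ T) {t : V} (ht : t ∈ T) (htS : t ∉ S) {u : V}
    (hu : u ∉ S) : u ∈ T := by
  obtain ⟨W⟩ := (h.2 S hS).preconnected ⟨t, by simpa using htS⟩ ⟨u, by simpa using hu⟩
  have : ∀ {a b : ((↑S : Set V)ᶜ : Set V)} (W : (G.induce ((↑S : Set V)ᶜ)).Walk a b),
      (a : V) ∈ T → (b : V) ∈ T := by
    intro a b W
    induction W with
    | nil => exact id
    | @cons a b c hadj W ih =>
      exact fun ha => ih ((hT _ ha _ hadj).resolve_left fun h => b.2 (Finset.mem_coe.2 h))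
  exact this W ht

theorem ThreeConnected.exists_adj_ne (h : ThreeConnected G) {v a b : V} (ha : v ≠ a) (hb : v ≠ b) :
    ∃ w, G.Adj v w ∧ w ≠ a ∧ w ≠ b := by
  by_contra! hcon
  have h1 : ∀ u, u ∈ ({a, b, v} : Finset V) := by
    intro u
    by_cases hu : u ∈ ({a, b} : Finset V)
    · simp only [Finset.mem_insert, Finset.mem_singleton] at hu ⊢
      tauto
    · have := h.mem_of_adj_closed (S := {a, b}) (T := {v}) Finset.card_le_two (t := v) ?_ (by simp)
        (by simp [ha, hb]) hu
      · simp only [Finset.mem_insert, Finset.mem_singleton] at this ⊢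
        tauto
      · intro v' hv' w hw
        rw [Finset.mem_singleton] at hv'
        subst hv'
        have := hcon w hw
        simp only [Finset.mem_insert, Finset.mem_singleton]
        tauto
  have h2 : Finset.univ ⊆ ({a, b, v} : Finset V) := fun u _ => h1 u
  have h3 := Finset.card_le_card h2
  have h4 : ({a, b, v} : Finset V).card ≤ 3 := Finset.card_le_three
  have := h.1
  rw [Finset.card_univ] at h3
  omega

end Separators

section Configurations

variable {V : Type*} {G : SimpleGraph V} {x : V} {C : G.Walk x x} {p : ℤ → V}

namespace CycleSetup

variable [Fintype V] {emb : PlaneEmbedding G} {f g h : Set (ℝ × ℝ)} {u v w : V} {a j a' j' i : ℤ}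

theorem false_of_path_one (S : CycleSetup C p) (a b : ℤ) (l : List (ℤ ⊕ Fin 1)) {w : V}
    (hw : w ∉ C.support)
    (hl : (l.map (Sum.elim p ![w])).IsChain G.Adj := by
      simp only [List.map, Sum.elim_inl, Sum.elim_inr, List.isChain_cons_cons,
        List.isChain_singleton, and_true, Matrix.cons_val]
      and_intros
      all_goals first
        | exact CycleSetup.adj_of_eq (by assumption) _ _ (by decide)
        | assumption
        | (apply SimpleGraph.Adj.symm; assumption))
    (hb : b < a + 8 := by decide)
    (hab : a < b := by decide) (hhead : l.head? = some (Sum.inl a) := by rfl)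
    (hlast : l.getLast? = some (Sum.inl b) := by rfl) (hn : l.Nodup := by decide)
    (hmem : ∀ k, a ≤ k → k ≤ b → Sum.inl k ∈ l := by intro k _ _; simp; omega)
    (hbd : ∀ s ∈ l, Sum.elim (fun k => a ≤ k ∧ k ≤ b) (fun _ => True) s := by simp)
    (hlen : b - a + 1 < l.length := by decide) : False :=
  S.false_of_path ![w] a b l (by simpa using hw) (Function.injective_of_subsingleton _) hl hb hab
    hhead hlast hn hmem hbd hlen

theorem not_adj_of_two (S : CycleSetup C p) (F : MinorFace emb C p g w a 2) :
    ¬ G.Adj (p (a + 1)) (p (a + 3)) ∧ ¬ G.Adj (p (a + 1)) (p (a - 1)) := by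
  have key : ∀ q : ℤ → V, CycleSetup C q → G.Adj w (q 0) → G.Adj w (q 2) →
      ¬ G.Adj (q 1) (q 3) ∧ ¬ G.Adj (q 1) (q (-1)) := fun q S h1 h2 =>
    ⟨fun _ => S.false_of_path_one 0 3 [.inl 0, .inr 0, .inl 2, .inl 1, .inl 3] F.notMem,
      fun _ => S.false_of_path_one (-1) 2 [.inl (-1), .inl 1, .inl 0, .inr 0, .inl 2] F.notMem⟩
  simpa only [add_comm a, sub_eq_neg_add] using key _ (S.shift a) (by simpa using F.adj_left)
    (by simpa [add_comm] using F.adj_right)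

theorem exists_chord (S : CycleSetup C p) (F : MinorFace emb C p f v a j)
    (F' : MinorFace emb C p g w a' j') (hfg : f ≠ g) (i : ℤ) (h1 : a < i) (h2 : i < a + j)
    (h3 : a' < i) (h4 : i < a' + j') :
    ∃ k, (k < i - 1 ∨ i + 1 < k) ∧ ((a ≤ k ∧ k ≤ a + j ∧ IsChordIn emb p f i k) ∨
      (a' ≤ k ∧ k ≤ a' + j' ∧ IsChordIn emb p g i k)) := by
  have hlen := S.len
  obtain ⟨u, hu, hu1, hu2⟩ := S.three.exists_adj_ne
    (S.ne (i := i) (j := i - 1) (by omega) (by omega) (by omega))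
    (S.ne (i := i) (j := i + 1) (by omega) (by omega) (by omega))
  rcases S.adj_cases F F' hfg h1 h2 h3 h4 hu with h | h | ⟨k, h5, h6, h7, -, h8⟩ |
    ⟨k, h5, h6, h7, -, h8⟩
  exacts [absurd h hu1, absurd h hu2, ⟨k, h7, Or.inl ⟨h5, h6, h8⟩⟩, ⟨k, h7, Or.inr ⟨h5, h6, h8⟩⟩]

theorem false_of_four_adj (S : CycleSetup C p) (hv : v ∉ C.support) {a b c d : ℤ}
    (h1 : G.Adj v (p a)) (h2 : G.Adj v (p b)) (h3 : G.Adj v (p c)) (h4 : G.Adj v (p d))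
    (hab : a < b) (hbc : b < c) (hcd : c < d) (hd : d < a + 8) : False := by
  have hlen := S.len
  have h := (S.longest.2.1 v hv).1
  have hsub : ({p a, p b, p c, p d} : Finset V) ⊆ Finset.univ.filter fun w => G.Adj v w := by
    intro w
    simp only [Finset.mem_insert, Finset.mem_singleton, Finset.mem_filter, Finset.mem_univ,
      true_and]
    rintro (rfl | rfl | rfl | rfl) <;> assumption
  have hcard : ({p a, p b, p c, p d} : Finset V).card = 4 := by
    have hne : ∀ i k : ℤ, a ≤ i → i < k → k ≤ d → p i ≠ p k := fun i k _ _ _ =>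
      S.ne (by omega) (by omega) (by omega)
    rw [Finset.card_insert_of_notMem, Finset.card_insert_of_notMem, Finset.card_pair]
    · exact hne c d (by omega) (by omega) (by omega)
    · simp [hne b c, hne b d, *, hab.le, hcd.le, hbc.trans hcd]
    · simp [hne a b, hne a c, hne a d, *, hab.trans hbc, (hab.trans hbc).trans hcd, hcd.le,
        (hbc.trans hcd).le]
  have := Finset.card_le_card hsub
  omega

theorem two_le (S : CycleSetup C p) (F : MinorFace emb C p g w a j) : 2 ≤ j := by
  by_contra hj
  obtain rfl : j = 1 := by have := F.pos; omega
  have key : ∀ q : ℤ → V, CycleSetup C q → G.Adj w (q 0) → G.Adj w (q 1) → False :=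
    fun q S h1 h2 => S.false_of_path_one 0 1 [.inl 0, .inr 0, .inl 1] F.notMem
  exact key _ (S.shift a) (by simpa using F.adj_left) (by simpa [add_comm] using F.adj_right)

/-- The middle vertex of a minor 2-face lying on another minor face is the end of a chord in
that face, which spans at least three edges of the cycle. -/
theorem exists_chord_of_two (S : CycleSetup C p) (F : MinorFace emb C p f v a j)
    (W : MinorFace emb C p g w i 2) (hfg : f ≠ g) (h1 : a ≤ i) (h2 : i + 2 ≤ a + j) :
    ∃ k, a ≤ k ∧ k ≤ a + j ∧ (k + 2 ≤ i ∨ i + 4 ≤ k) ∧ IsChordIn emb p f (i + 1) k := by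
  obtain ⟨k, hk, ⟨h3, h4, h⟩ | ⟨h3, h4, h⟩⟩ := S.exists_chord F W hfg (i + 1) (by omega) (by omega)
    (by omega) (by omega)
  · refine ⟨k, h3, h4, ?_, h⟩
    obtain ⟨h5, h6⟩ := S.not_adj_of_two W
    by_contra hk'
    rcases (by omega : k = i + 3 ∨ k = i - 1) with rfl | rfl
    exacts [h5 h.adj, h6 h.adj]
  · omega

end CycleSetup
end Configurations

section FiveFace

variable {V : Type*} [Fintype V] {G : SimpleGraph V} {x : V} {C : G.Walk x x} {p : ℤ → V}
  {emb : PlaneEmbedding G} {f g h : Set (ℝ × ℝ)} {t u v w : V} {j : ℤ}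

namespace CycleSetup

theorem false_of_two_two (S : CycleSetup C p) (F : MinorFace emb C p f v 0 5)
    (U : MinorFace emb C p g u 0 2) (W : MinorFace emb C p h w 2 2) (hfg : f ≠ g) (hfh : f ≠ h) :
    False := by
  obtain ⟨k, h1, h2, h3, hk⟩ := S.exists_chord_of_two F U hfg (by omega) (by omega)
  obtain ⟨l, h4, h5, h6, hl⟩ := S.exists_chord_of_two F W hfh (by omega) (by omega)
  obtain rfl : l = 0 := by omega
  exact S.false_of_crossing F hl.symm hk (by omega) (by omega) (by omega) (by omega) (by omega)

theorem isChordIn_zero_three (S : CycleSetup C p) (F : MinorFace emb C p f v 0 5)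
    (W : MinorFace emb C p h w 2 2) (hfh : f ≠ h) : IsChordIn emb p f 0 3 := by
  obtain ⟨l, h4, h5, h6, hl⟩ := S.exists_chord_of_two F W hfh (by omega) (by omega)
  obtain rfl : l = 0 := by omega
  exact hl.symm

/-- A chord at `p 1` inside the face left of a minor 2-face. -/
theorem exists_chord_one (S : CycleSetup C p) (F : MinorFace emb C p f v 0 5)
    (U : MinorFace emb C p g u (2 - j) j) (hj : 3 ≤ j) (W : MinorFace emb C p h w 2 2) (hfg : f ≠ g)
    (hfh : f ≠ h) : ∃ k, 2 - j ≤ k ∧ k ≤ -1 ∧ IsChordIn emb p g 1 k := by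
  have h03 := S.isChordIn_zero_three F W hfh
  obtain ⟨k, hk, ⟨h1, h2, hk'⟩ | ⟨h1, h2, hk'⟩⟩ := S.exists_chord F U hfg 1 (by omega) (by omega)
    (by omega) (by omega)
  · rcases (by omega : k = 3 ∨ 3 < k) with rfl | h3
    · exact ((S.not_adj_of_two W).2 hk'.adj.symm).elim
    · exact (S.false_of_crossing F h03 hk' (by omega) (by omega) (by omega) h3 (by omega)).elim
  · exact ⟨k, h1, by omega, hk'⟩

theorem false_of_three_two (S : CycleSetup C p) (F : MinorFace emb C p f v 0 5)
    (U : MinorFace emb C p g u (-1) 3) (W : MinorFace emb C p h w 2 2) (hfg : f ≠ g)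
    (hfh : f ≠ h) : False := by
  have h03 := (S.isChordIn_zero_three F W hfh).adj
  obtain ⟨k, h1, h2, hk⟩ := S.exists_chord_one F (j := 3) U le_rfl W hfg hfh
  obtain rfl : k = -1 := by omega
  have h4 := hk.adj
  have h5 := W.adj_left
  have h6 := W.adj_right
  norm_num at h6
  exact S.false_of_path_one (-1) 4
    [.inl (-1), .inl 1, .inl 0, .inl 3, .inl 2, .inr 0, .inl 4] W.notMem

theorem false_of_four_two {k : Set (ℝ × ℝ)} (S : CycleSetup C p) (F : MinorFace emb C p f v 0 5)
    (U : MinorFace emb C p g u (-2) 4) (W : MinorFace emb C p h w 2 2)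
    (T : MinorFace emb C p k t (-j) j) (hj : j = 2 ∨ j = 3) (hfg : f ≠ g) (hfh : f ≠ h)
    (hgk : g ≠ k) : False := by
  have h03 := (S.isChordIn_zero_three F W hfh).adj
  obtain ⟨l, h1, h2, hl⟩ := S.exists_chord_one F (j := 4) U (by omega) W hfg hfh
  have h4 := hl.adj
  have h5 := W.adj_left
  have h6 := W.adj_right
  norm_num at h6
  rcases (by omega : l = -1 ∨ l = -2) with rfl | rfl
  · exact S.false_of_path_one (-1) 4
      [.inl (-1), .inl 1, .inl 0, .inl 3, .inl 2, .inr 0, .inl 4] W.notMem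
  obtain ⟨m, hm, ⟨h7, h8, hm'⟩ | ⟨h7, h8, hm'⟩⟩ := S.exists_chord U T hgk (-1) (by omega) (by omega)
    (by omega) (by omega)
  · rcases (by omega : m = 1 ∨ m = 2) with rfl | rfl
    · have h9 := hm'.adj
      exact S.false_of_path_one (-1) 4
        [.inl (-1), .inl 1, .inl 0, .inl 3, .inl 2, .inr 0, .inl 4] W.notMem
    · exact S.false_of_crossing U hl.symm hm' (by omega) (by omega) (by omega) (by omega) (by omega)
  · obtain rfl : m = -3 := by omega
    have h9 := hm'.adj
    exact S.false_of_path_one (-3) 4 [.inl (-3), .inl (-1), .inl (-2), .inl 1, .inl 0, .inl 3,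
      .inl 2, .inr 0, .inl 4] W.notMem

theorem false_of_five_two {k : Set (ℝ × ℝ)} (S : CycleSetup C p) (F : MinorFace emb C p f v 0 5)
    (U : MinorFace emb C p g u (-3) 5) (W : MinorFace emb C p h w 2 2)
    (T : MinorFace emb C p k t (-2) 2) (hfg : f ≠ g) (hfh : f ≠ h) (hgk : g ≠ k) : False := by
  obtain ⟨l, h1, h2, hl⟩ := S.exists_chord_one F (j := 5) U (by omega) W hfg hfh
  obtain ⟨m, h3, h4, h5, hm⟩ := S.exists_chord_of_two U T hgk (by omega) (by omega)
  obtain rfl : m = 2 := by omega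
  rcases (by omega : l = -1 ∨ l < -1) with rfl | h6
  · exact (S.not_adj_of_two T).1 hl.adj.symm
  · exact S.false_of_crossing U hl.symm hm (by omega) (by omega) (by omega) (by omega) (by omega)

theorem exists_chord_of_three {a : ℤ} (S : CycleSetup C p) (F : MinorFace emb C p f v a j) {i : ℤ}
    (U : MinorFace emb C p g u i 3) (hfg : f ≠ g) (h1 : a ≤ i) (h2 : i + 3 ≤ a + j) :
    ∃ m k, (m = i + 1 ∨ m = i + 2) ∧ a ≤ k ∧ k ≤ a + j ∧ (k < i ∨ i + 3 < k) ∧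
      IsChordIn emb p f m k := by
  have hlen := S.len
  by_contra! hcon
  have hne : ∀ r s : ℤ, i ≤ r → r < s → s ≤ i + 4 → p s ≠ p r := fun r s _ _ _ =>
    S.ne (by omega) (by omega) (by omega)
  have key : ∀ m, (m = i + 1 ∨ m = i + 2) → ∀ y, G.Adj (p m) y →
      ∃ k, i ≤ k ∧ k ≤ i + 3 ∧ y = p k := by
    intro m hm y hy
    rcases S.adj_cases F U hfg (i := m) (by omega) (by omega) (by omega) (by omega) hy with
      h | h | ⟨k, h5, h6, h7, h8, h9⟩ | ⟨k, h5, h6, h7, h8, h9⟩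
    · exact ⟨_, by omega, by omega, h⟩
    · exact ⟨_, by omega, by omega, h⟩
    · refine ⟨k, ?_, ?_, h8⟩ <;> by_contra hk
      · exact hcon m k hm h5 h6 (Or.inl (by omega)) h9
      · exact hcon m k hm h5 h6 (Or.inr (by omega)) h9
    · exact ⟨k, h5, h6, h8⟩
  have := S.three.mem_of_adj_closed (S := {p i, p (i + 3)}) (T := {p (i + 1), p (i + 2)})
    Finset.card_le_two (t := p (i + 1)) (u := p (i + 4)) ?_ (by simp) ?_ ?_
  · simp only [Finset.mem_insert, Finset.mem_singleton] at this
    rcases this with h | h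
    · exact hne (i + 1) (i + 4) (by omega) (by omega) (by omega) h
    · exact hne (i + 2) (i + 4) (by omega) (by omega) (by omega) h
  · intro y hy z hz
    obtain ⟨m, hm, rfl⟩ : ∃ m, (m = i + 1 ∨ m = i + 2) ∧ y = p m := by
      simp only [Finset.mem_insert, Finset.mem_singleton] at hy
      rcases hy with h | h
      exacts [⟨_, Or.inl rfl, h⟩, ⟨_, Or.inr rfl, h⟩]
    obtain ⟨k, h3, h4, rfl⟩ := key m hm z hz
    simp only [Finset.mem_insert, Finset.mem_singleton]
    rcases (by omega : k = i ∨ k = i + 3 ∨ k = i + 1 ∨ k = i + 2) with rfl | rfl | rfl | rfl <;>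
      simp
  · simp only [Finset.mem_insert, Finset.mem_singleton, not_or]
    exact ⟨hne i (i + 1) (by omega) (by omega) (by omega),
      (hne (i + 1) (i + 3) (by omega) (by omega) (by omega)).symm⟩
  · simp only [Finset.mem_insert, Finset.mem_singleton, not_or]
    exact ⟨hne i (i + 4) (by omega) (by omega) (by omega),
      hne (i + 3) (i + 4) (by omega) (by omega) (by omega)⟩

theorem false_of_two_three (S : CycleSetup C p) (F : MinorFace emb C p f v 0 5)
    (W : MinorFace emb C p g w 0 2) (U : MinorFace emb C p h u 2 3) (hfg : f ≠ g) (hfh : f ≠ h) :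
    False := by
  obtain ⟨k, h1, h2, h3, hk⟩ := S.exists_chord_of_two F W hfg (by omega) (by omega)
  rw [zero_add] at hk
  have h4 := U.adj_left
  have h5 := U.adj_right
  norm_num at h5
  have h14 : ¬ G.Adj (p 1) (p 4) := fun h14 =>
    S.false_of_path_one 0 5 [.inl 0, .inl 1, .inl 4, .inl 3, .inl 2, .inr 0, .inl 5] U.notMem
  rcases (by omega : k = 4 ∨ k = 5) with rfl | rfl
  · exact h14 hk.adj
  obtain ⟨m, l, hm, h6, h7, h8, hl⟩ := S.exists_chord_of_three F U hfh (by omega) (by omega)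
  rcases (by omega : l = 0 ∨ l = 1) with rfl | rfl
  · exact S.false_of_crossing F hl.symm hk (by omega) (by omega) (by omega) (by omega) (by omega)
  · rcases hm with rfl | rfl
    · exact (S.not_adj_of_two W).1 hl.adj.symm
    · exact h14 hl.adj.symm

theorem false_of_three_three (S : CycleSetup C p) (F : MinorFace emb C p f v 0 5)
    (U : MinorFace emb C p g u (-1) 3) (T : MinorFace emb C p h t 2 3) (hfg : f ≠ g) (hfh : f ≠ h) :
    False := by
  have v0 := F.adj_left
  have v5 := F.adj_right
  have ul := U.adj_left
  have u2 := U.adj_right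
  have t2 := T.adj_left
  have t5 := T.adj_right
  norm_num at v5 u2 t5
  have h14 : ¬ G.Adj (p 1) (p 4) := fun _ =>
    S.false_of_path_one 0 5 [.inl 0, .inl 1, .inl 4, .inl 3, .inl 2, .inr 0, .inl 5] T.notMem
  have chord4 : ¬ G.Adj (p 4) (p 0) → G.Adj (p 4) (p 2) := by
    intro h40
    obtain ⟨k, hk, ⟨h1, h2, hk'⟩ | ⟨h1, h2, hk'⟩⟩ := S.exists_chord F T hfh 4 (by omega) (by omega)
      (by omega) (by omega)
    · rcases (by omega : k = 0 ∨ k = 1 ∨ k = 2) with rfl | rfl | rfl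
      exacts [absurd hk'.adj h40, absurd hk'.adj.symm h14, hk'.adj]
    · obtain rfl : k = 2 := by omega
      exact hk'.adj
  have h13 : ¬ G.Adj (p 1) (p 3) := by
    intro h13
    by_cases h40 : G.Adj (p 4) (p 0)
    · have huv : u ≠ v := by
        rintro rfl
        exact S.false_of_four_adj U.notMem ul v0 u2 v5 (by omega) (by omega) (by omega) (by omega)
      refine S.false_of_path ![u, v] (-1) 5 [.inl (-1), .inr 0, .inl 2, .inl 1, .inl 3, .inl 4,
        .inl 0, .inr 1, .inl 5] ?_ ?_
      · simp [Fin.forall_fin_two, U.notMem, F.notMem]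
      · intro i j h
        fin_cases i <;> fin_cases j <;> simp_all
    · have h42 := chord4 h40
      exact S.false_of_path_one 0 5 [.inl 0, .inl 1, .inl 3, .inl 4, .inl 2, .inr 0, .inl 5]
        T.notMem
  obtain ⟨m, l, hm, h6, h7, h8, hl⟩ := S.exists_chord_of_three F T hfh (by omega) (by omega)
  obtain rfl : l = 0 := by
    rcases (by omega : l = 0 ∨ l = 1) with rfl | rfl
    · rfl
    · rcases hm with rfl | rfl
      exacts [absurd hl.adj.symm h13, absurd hl.adj.symm h14]
  have h11 : G.Adj (p 1) (p (-1)) := by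
    obtain ⟨k, hk, ⟨h1, h2, hk'⟩ | ⟨h1, h2, hk'⟩⟩ := S.exists_chord F U hfg 1 (by omega) (by omega)
      (by omega) (by omega)
    · rcases (by omega : k = 3 ∨ k = 4 ∨ k = 5) with rfl | rfl | rfl
      · exact absurd hk'.adj h13
      · exact absurd hk'.adj h14
      · exact (S.false_of_crossing F hl.symm hk' (by omega) (by omega) (by omega) (by omega)
          (by omega)).elim
    · obtain rfl : k = -1 := by omega
      exact hk'.adj
  by_cases h40 : G.Adj (p 4) (p 0)
  · exact S.false_of_path_one (-1) 5 [.inl (-1), .inl 1, .inl 0, .inl 4, .inl 3, .inl 2, .inr 0,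
      .inl 5] T.notMem
  · have h42 := chord4 h40
    rcases hm with rfl | rfl
    · have h03 := hl.adj
      norm_num at h03
      exact S.false_of_path_one (-1) 5 [.inl (-1), .inl 1, .inl 0, .inl 3, .inl 4, .inl 2, .inr 0,
        .inl 5] T.notMem
    · exact h40 hl.adj

theorem false_of_two_three_two (S : CycleSetup C p) (F : MinorFace emb C p f v 0 5)
    (W : MinorFace emb C p g w (-1) 2) (U : MinorFace emb C p h u 1 3)
    {g' : Set (ℝ × ℝ)} {w' : V} (W' : MinorFace emb C p g' w' 4 2) (hfh : f ≠ h) : False := by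
  have key : ∀ (q : ℤ → V) (w w' : V), CycleSetup C q → MinorFace emb C q f v 0 5 →
      MinorFace emb C q h u 1 3 → w ∉ C.support → w' ∉ C.support → G.Adj w (q (-1)) →
      G.Adj w (q 1) → G.Adj w' (q 4) → G.Adj w' (q 6) →
      ¬ G.Adj (q 2) (q 0) ∧ ¬ G.Adj (q 3) (q 0) := by
    intro q w w' S F U hw hw' h1 h2 h3 h4
    have v0 := F.adj_left
    have v5 := F.adj_right
    norm_num at v5
    have h5 : w ≠ v := by
      rintro rfl
      exact S.false_of_four_adj hw h1 v0 h2 v5 (by omega) (by omega) (by omega) (by omega)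
    have h6 : w' ≠ v := by
      rintro rfl
      exact S.false_of_four_adj hw' v0 h3 v5 h4 (by omega) (by omega) (by omega) (by omega)
    have h7 : w ≠ w' := by
      rintro rfl
      exact S.false_of_four_adj hw h1 h2 h3 h4 (by omega) (by omega) (by omega) (by omega)
    have hmem : ∀ i, ![w, v, w'] i ∉ C.support := by
      simp [Fin.forall_fin_succ, hw, hw', F.notMem]
    have hinj : Function.Injective ![w, v, w'] := by
      intro i j h
      fin_cases i <;> fin_cases j <;> simp_all
    have h30 : ¬ G.Adj (q 3) (q 0) := fun _ =>
      S.false_of_path ![w, v, w'] (-1) 6 [.inl (-1), .inr 0, .inl 1, .inl 2, .inl 3, .inl 0, .inr 1,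
        .inl 5, .inl 4, .inr 2, .inl 6] hmem hinj
    refine ⟨fun h20 => ?_, h30⟩
    have : G.Adj (q 3) (q 5) ∨ G.Adj (q 3) (q 1) := by
      obtain ⟨k, hk, ⟨h1, h2, hk'⟩ | ⟨h1, h2, hk'⟩⟩ :=
        S.exists_chord F U hfh 3 (by omega) (by omega)
        (by omega) (by omega)
      · rcases (by omega : k = 0 ∨ k = 1 ∨ k = 5) with rfl | rfl | rfl
        exacts [absurd hk'.adj h30, Or.inr hk'.adj, Or.inl hk'.adj]
      · obtain rfl : k = 1 := by omega
        exact Or.inr hk'.adj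
    rcases this with h | h
    · exact S.false_of_path ![w, v, w'] (-1) 6 [.inl (-1), .inr 0, .inl 1, .inl 2, .inl 0, .inr 1,
        .inl 5, .inl 3, .inl 4, .inr 2, .inl 6] hmem hinj
    · exact S.false_of_path ![w, v, w'] (-1) 6 [.inl (-1), .inr 0, .inl 1, .inl 3, .inl 2, .inl 0,
        .inr 1, .inl 5, .inl 4, .inr 2, .inl 6] hmem hinj
  have w1 := W.adj_left
  have w2 := W.adj_right
  have w3 := W'.adj_left
  have w4 := W'.adj_right
  norm_num at w2 w4
  obtain ⟨h1, h2⟩ := key p w w' S F U W.notMem W'.notMem w1 w2 w3 w4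
  have F' := F.reflect S.toCycleIndex 5
  have U' := U.reflect S.toCycleIndex 5
  norm_num at F' U'
  obtain ⟨h3, h4⟩ := key (fun i => p (5 - i)) w' w (S.reflect 5) F' U' W'.notMem W.notMem
    (by simpa using w4) (by simpa using w3) (by simpa using w2) (by simpa using w1)
  norm_num at h3 h4
  obtain ⟨m, l, hm, h6, h7, h8, hl⟩ := S.exists_chord_of_three F U hfh (by omega) (by omega)
  have := hl.adj
  rcases (by omega : l = 0 ∨ l = 5) with rfl | rfl <;> rcases hm with rfl | rfl
  exacts [h1 this, h2 this, h4 this, h3 this]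

end CycleSetup
end FiveFace

section Rules

variable {V : Type*} {G : SimpleGraph V} {x : V} {C : G.Walk x x} {p : ℤ → V}
  {emb : PlaneEmbedding G} {f g h : Set (ℝ × ℝ)} {v w : V} {a j i : ℤ}

theorem mEdges_comm (emb : PlaneEmbedding G) (C : G.Walk x x) (f g : Set (ℝ × ℝ)) :
    mEdges emb C f g = mEdges emb C g f := by
  simp only [mEdges, and_comm]

theorem OppositeFaces.symm (h : OppositeFaces emb C f g) : OppositeFaces emb C g f :=
  ⟨h.1.symm, h.2.imp fun _ he => ⟨he.1, he.2.2, he.2.1⟩⟩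

namespace MinorFace

theorem exists_edge_eq (F : MinorFace emb C p f v a j) (hp : CycleIndex C p) (hc : 3 ≤ C.length)
    {e : Sym2 V} (he : e ∈ C.edges) (hf : _root_.incEdge emb f e) :
    ∃ i, a ≤ i ∧ i < a + j ∧ e = s(p i, p (i + 1)) := by
  obtain ⟨k, rfl⟩ := (hp.mem_edges e).1 he
  obtain ⟨i, h1, h2, h3⟩ := (F.incEdge_iff k).1 hf
  exact ⟨i, h1, h2, ((hp.edge_eq_iff hc i k).2 h3).symm⟩

theorem mEdges_eq (F : MinorFace emb C p f v a j) (hp : CycleIndex C p) (hc : 3 ≤ C.length)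
    (g : Set (ℝ × ℝ)) : mEdges emb C f g =
      ((Finset.Ico a (a + j)).filter fun i => _root_.incEdge emb g s(p i, p (i + 1))).card := by
  have hlt := F.lt
  refine .trans ?_ ((hp.card_filter_edges hc a fun e =>
    _root_.incEdge emb f e ∧ _root_.incEdge emb g e).trans ?_)
  · unfold mEdges
    congr!
  congr 1
  ext k
  simp only [Finset.mem_filter, Finset.mem_Ico]
  constructor
  · rintro ⟨⟨h1, h2⟩, h3, h4⟩
    refine ⟨⟨h1, ?_⟩, h4⟩
    by_contra! hk
    exact F.not_incEdge hp hk h2 h3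
  · rintro ⟨⟨h1, h2⟩, h3⟩
    exact ⟨⟨h1, by omega⟩, F.incEdge h1 h2, h3⟩

end MinorFace

variable [Fintype V]

/-- The condition under which rule R4 makes `f` send weight to `g`. -/
def RuleFour (emb : PlaneEmbedding G) (C : G.Walk x x) (f g : Set (ℝ × ℝ)) : Prop :=
  MinorFaceH emb C f ∧ 4 ≤ numCEdges emb C f ∧ MinorFaceH emb C g ∧
    numCEdges emb C g = 4 ∧ OppositeFaces emb C g f ∧ mEdges emb C g f = 2 ∧
    (∃ f₂ : Set (ℝ × ℝ), MinorFaceH emb C f₂ ∧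
      (numCEdges emb C f₂ = 2 ∨ numCEdges emb C f₂ = 3) ∧
      OppositeFaces emb C g f₂ ∧ mEdges emb C g f₂ = 2)

/-- The condition under which rule R5 makes `f` send weight to `g`. -/
def RuleFive (emb : PlaneEmbedding G) (C : G.Walk x x) (f g : Set (ℝ × ℝ)) : Prop :=
  MinorFaceH emb C f ∧ 4 ≤ numCEdges emb C f ∧ MinorFaceH emb C g ∧
    numCEdges emb C g = 5 ∧ OppositeFaces emb C g f ∧ mEdges emb C g f = 2 ∧
    (∃ g₁ g₂ : Set (ℝ × ℝ), g₁ ≠ g₂ ∧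
      MinorFaceH emb C g₁ ∧ numCEdges emb C g₁ = 2 ∧ OppositeFaces emb C g g₁ ∧
      MinorFaceH emb C g₂ ∧ numCEdges emb C g₂ = 2 ∧ OppositeFaces emb C g g₂)

theorem sendWeight_eq (emb : PlaneEmbedding G) (C : G.Walk x x) (f g : Set (ℝ × ℝ)) :
    sendWeight emb C f g =
      (if MajorFaceH emb C f ∧ MinorFaceH emb C g ∧ OppositeFaces emb C f g
        then (mEdges emb C f g : ℚ) else 0)
      + (if MinorFaceH emb C f ∧ MinorFaceH emb C g ∧ numCEdges emb C g = 2 ∧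
          OppositeFaces emb C f g then 2 / 3 * (mEdges emb C f g : ℚ) else 0)
      + (if MinorFaceH emb C f ∧ MinorFaceH emb C g ∧ numCEdges emb C g = 3 ∧ f ≠ g ∧
          (∃ e : Sym2 V, IsMiddleCEdge emb C g e ∧ incEdge emb f e) then 1 else 0)
      + (if RuleFour emb C f g then 2 / 3 else 0) + (if RuleFive emb C f g then 1 / 3 else 0) := by
  unfold sendWeight RuleFour RuleFive
  congr!

theorem sendWeight_eq_zero (h : ¬ OppositeFaces emb C f g) : sendWeight emb C f g = 0 := by
  have h4 : ¬ RuleFour emb C f g := fun H => h H.2.2.2.2.1.symm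
  have h5 : ¬ RuleFive emb C f g := fun H => h H.2.2.2.2.1.symm
  have h3 : ¬ (MinorFaceH emb C f ∧ MinorFaceH emb C g ∧ numCEdges emb C g = 3 ∧ f ≠ g ∧
      (∃ e : Sym2 V, IsMiddleCEdge emb C g e ∧ incEdge emb f e)) := by
    rintro ⟨-, -, -, hfg, e, he, hf⟩
    exact h ⟨hfg, e, he.1, hf, he.2.1⟩
  rw [sendWeight_eq, if_neg h3, if_neg h4, if_neg h5]
  simp [h]

/-- The weight that `f` loses to the opposite face `g` through the common edge `e`. -/
def edgeLoss (emb : PlaneEmbedding G) (C : G.Walk x x) (f g : Set (ℝ × ℝ)) (e : Sym2 V) : ℚ :=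
  if MajorFaceH emb C g then -1 else
    (if numCEdges emb C g = 2 then 2 / 3 else 0)
    + (if numCEdges emb C g = 3 ∧ IsMiddleCEdge emb C g e then 1 else 0)
    + (if RuleFour emb C f g then 1 / 3 else 0) + (if RuleFive emb C f g then 1 / 6 else 0)
    - (if RuleFive emb C g f then 1 / 6 else 0)

namespace CycleSetup

theorem exists_minorFace_of_incEdge (S : CycleSetup C p) (hg : MinorFaceH emb C g)
    (hi : incEdge emb g s(p i, p (i + 1))) :
    ∃ w a, MinorFace emb C p g w a (numCEdges emb C g) ∧ a ≤ i ∧ i < a + numCEdges emb C g := by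
  obtain ⟨w, a, hF⟩ := S.exists_minorFace hg
  obtain ⟨l, h1, h2, h3⟩ := (hF.incEdge_iff i).1 hi
  refine ⟨w, i - (l - a), hF.congr_of_eq S.toCycleIndex ?_, by omega, by omega⟩
  have := (S.add_eq_add_iff l i (a - l)).2 h3
  rw [show l + (a - l) = a by ring] at this
  rw [this]
  ring_nf

theorem eq_of_isMiddleCEdge (S : CycleSetup C p) (F : MinorFace emb C p g w a 3) (h1 : a ≤ i)
    (h2 : i < a + 3) (hm : IsMiddleCEdge emb C g s(p i, p (i + 1))) : i = a + 1 := by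
  have hlen := S.len
  have hne : ∀ r s : ℤ, a ≤ r → r < s → s ≤ a + 3 → p r ≠ p s := fun r s _ _ _ =>
    S.ne (by omega) (by omega) (by omega)
  have key : ¬ ∃ v, v ∈ s(p a, p (a + 1)) ∧ v ∈ s(p (a + 2), p (a + 2 + 1)) := by
    rintro ⟨v, h1, h2⟩
    rw [show a + 2 + 1 = a + 3 by ring] at h2
    rcases Sym2.mem_iff.1 h1 with rfl | rfl <;> rcases Sym2.mem_iff.1 h2 with h | h
    exacts [hne a (a + 2) (by omega) (by omega) (by omega) h,
      hne a (a + 3) (by omega) (by omega) (by omega) h,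
      hne (a + 1) (a + 2) (by omega) (by omega) (by omega) h,
      hne (a + 1) (a + 3) (by omega) (by omega) (by omega) h]
  have hedge : s(p a, p (a + 1)) ≠ s(p (a + 2), p (a + 2 + 1)) := by
    intro h
    exact key ⟨p a, Sym2.mem_mk_left _ _, h ▸ Sym2.mem_mk_left _ _⟩
  by_contra hi
  rcases (by omega : i = a ∨ i = a + 2) with rfl | rfl
  · exact key (hm.2.2 _ (S.mem_edges_step _) (F.incEdge (by omega) (by omega)) hedge.symm)
  · obtain ⟨v, h3, h4⟩ := hm.2.2 _ (S.mem_edges_step a) (F.incEdge (by omega) (by omega)) hedge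
    exact key ⟨v, h4, h3⟩

theorem not_majorFaceH (hg : MinorFaceH emb C g) : ¬ MajorFaceH emb C g := fun h => h.2 hg

theorem send_sub_send_le (S : CycleSetup C p) (hf : MinorFaceH emb C f)
    (hf5 : numCEdges emb C f = 5) (F : MinorFace emb C p f v a j)
    (hg : IsFaceOf (drawE emb (Hgraph C).edgeSet) g) (hfg : OppositeFaces emb C f g) :
    sendWeight emb C f g - sendWeight emb C g f ≤
      ∑ i ∈ (Finset.Ico a (a + j)).filter (fun i => incEdge emb g s(p i, p (i + 1))),
        edgeLoss emb C f g s(p i, p (i + 1)) := by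
  have hlen := S.len
  have hm := F.mEdges_eq S.toCycleIndex (by omega) g
  set s := (Finset.Ico a (a + j)).filter (fun i => incEdge emb g s(p i, p (i + 1))) with hs
  have hfm := not_majorFaceH hf
  have h42 : ¬ RuleFour emb C g f := fun H => by have := H.2.2.2.1; omega
  by_cases hgm : MajorFaceH emb C g
  · have h1 : ¬ RuleFour emb C f g := fun H => hgm.2 H.2.2.1
    have h2 : ¬ RuleFive emb C f g := fun H => hgm.2 H.2.2.1
    have h3 : ¬ RuleFive emb C g f := fun H => hgm.2 H.1
    rw [sendWeight_eq, sendWeight_eq, mEdges_comm emb C g f, hm]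
    simp [hgm, hgm.2, h1, h2, h3, h42, hf, hfg.symm, edgeLoss]
  · have hgn : MinorFaceH emb C g := by
      by_contra h
      exact hgm ⟨by rwa [S.drawingH_eq], h⟩
    have h4m : RuleFour emb C f g → s.card = 2 := fun H => by
      rw [← hm, mEdges_comm]; exact H.2.2.2.2.2.1
    have h5m : RuleFive emb C f g → s.card = 2 := fun H => by
      rw [← hm, mEdges_comm]; exact H.2.2.2.2.2.1
    have h5m' : RuleFive emb C g f → s.card = 2 := fun H => by
      rw [← hm]; exact H.2.2.2.2.2.1
    have hmid : (if numCEdges emb C g = 3 ∧ ∃ e : Sym2 V, IsMiddleCEdge emb C g e ∧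
        incEdge emb f e then (1 : ℚ) else 0) ≤
        ∑ i ∈ s, if numCEdges emb C g = 3 ∧ IsMiddleCEdge emb C g s(p i, p (i + 1))
          then (1 : ℚ) else 0 := by
      have hnn : ∀ i ∈ s, (0 : ℚ) ≤ if numCEdges emb C g = 3 ∧
          IsMiddleCEdge emb C g s(p i, p (i + 1)) then (1 : ℚ) else 0 := by
        intro i _
        split_ifs <;> norm_num
      split_ifs with h
      · obtain ⟨h3, e, he, hfe⟩ := h
        obtain ⟨i, h1, h2, rfl⟩ := F.exists_edge_eq S.toCycleIndex (by omega) he.1 hfe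
        refine le_trans (by rw [if_pos ⟨h3, he⟩]) (Finset.single_le_sum hnn
          (Finset.mem_filter.2 ⟨Finset.mem_Ico.2 ⟨h1, h2⟩, he.2.1⟩))
      · exact Finset.sum_nonneg hnn
    have hsum : ∑ i ∈ s, edgeLoss emb C f g s(p i, p (i + 1)) =
        (if numCEdges emb C g = 2 then 2 / 3 * (s.card : ℚ) else 0)
        + (∑ i ∈ s, if numCEdges emb C g = 3 ∧ IsMiddleCEdge emb C g s(p i, p (i + 1))
            then (1 : ℚ) else 0)
        + (if RuleFour emb C f g then 2 / 3 else 0) + (if RuleFive emb C f g then 1 / 3 else 0)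
        - (if RuleFive emb C g f then 1 / 3 else 0) := by
      simp only [edgeLoss, if_neg hgm, Finset.sum_add_distrib, Finset.sum_sub_distrib,
        Finset.sum_const, nsmul_eq_mul]
      congr 1
      · congr 1
        · congr 1
          · congr 1
            split_ifs <;> ring
          · split_ifs with h
            · rw [h4m h]; norm_num
            · ring
        · split_ifs with h
          · rw [h5m h]; norm_num
          · ring
      · split_ifs with h
        · rw [h5m' h]; norm_num
        · ring
    rw [hsum, sendWeight_eq emb C f g, sendWeight_eq emb C g f, hm]
    simp only [hf, hgn, hfm, hgm, hf5, hfg, h42, hfg.1, hfg.symm, true_and, false_and, if_false,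
      ne_eq, not_false_eq_true, and_true, Nat.reduceEqDiff]
    linarith

end CycleSetup
end Rules

section Bounds

variable {V : Type*} {G : SimpleGraph V} {x : V} {C : G.Walk x x} {p : ℤ → V}
  {emb : PlaneEmbedding G} {f h k : Set (ℝ × ℝ)} {v w : V} {a j i : ℤ} {g : ℤ → Set (ℝ × ℝ)}

/-- `g i` is the face of `H` opposite to `f` with respect to the edge `p i p (i + 1)`, for
`0 ≤ i < 5`. -/
structure OppositeSeq (emb : PlaneEmbedding G) (C : G.Walk x x) (p : ℤ → V) (f : Set (ℝ × ℝ))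
    (g : ℤ → Set (ℝ × ℝ)) : Prop where
  face : ∀ i, 0 ≤ i → i < 5 → IsFaceOf (drawE emb (Hgraph C).edgeSet) (g i)
  ne : ∀ i, 0 ≤ i → i < 5 → f ≠ g i
  inc : ∀ i, 0 ≤ i → i < 5 → incEdge emb (g i) s(p i, p (i + 1))

theorem OppositeSeq.reflect (Q : OppositeSeq emb C p f g) :
    OppositeSeq emb C (fun i => p (5 - i)) f fun i => g (4 - i) where
  face i _ _ := Q.face _ (by omega) (by omega)
  ne i _ _ := Q.ne _ (by omega) (by omega)
  inc i h1 h2 := by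
    have := Q.inc (4 - i) (by omega) (by omega)
    rw [Sym2.eq_swap, show 4 - i + 1 = 5 - i by ring] at this
    rwa [show 5 - (i + 1) = 4 - i by ring]

variable [Fintype V]

namespace CycleSetup

theorem exists_oppositeSeq (S : CycleSetup C p) (emb : PlaneEmbedding G) (f : Set (ℝ × ℝ)) :
    ∃ g, OppositeSeq emb C p f g := by
  have : ∀ i : ℤ, ∃ k, IsFaceOf (drawE emb (Hgraph C).edgeSet) k ∧ f ≠ k ∧
      incEdge emb k s(p i, p (i + 1)) := by
    intro i
    obtain ⟨k, k', h1, h2, h3, h4, h5, -⟩ :=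
      (S.robust_Hgraph emb).exists_two_faces (S.next_mem_Hgraph i)
    by_cases hk : f = k
    · exact ⟨k', h2, hk ▸ h3, h5⟩
    · exact ⟨k, h1, hk, h4⟩
  choose g hg using this
  exact ⟨g, fun i _ _ => (hg i).1, fun i _ _ => (hg i).2.1, fun i _ _ => (hg i).2.2⟩

theorem eq_of_incEdge (S : CycleSetup C p) (hf : IsFaceOf (drawE emb (Hgraph C).edgeSet) f)
    (hh : IsFaceOf (drawE emb (Hgraph C).edgeSet) h)
    (hk : IsFaceOf (drawE emb (Hgraph C).edgeSet) k) (hf' : incEdge emb f s(p i, p (i + 1)))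
    (hh' : incEdge emb h s(p i, p (i + 1))) (hk' : incEdge emb k s(p i, p (i + 1))) (hfh : f ≠ h)
    (hfk : f ≠ k) : h = k := by
  rcases (S.robust_Hgraph emb).eq_or_eq (S.next_mem_Hgraph i) hf hh hk hf' hh' hk' hfh with e | e
  exacts [absurd e.symm hfk, e.symm]

theorem incEdge_iff_eq (S : CycleSetup C p) (F : MinorFace emb C p f v 0 5)
    (Q : OppositeSeq emb C p f g) (hk : IsFaceOf (drawE emb (Hgraph C).edgeSet) k) (hfk : f ≠ k)
    (h1 : 0 ≤ i) (h2 : i < 5) : incEdge emb k s(p i, p (i + 1)) ↔ g i = k := by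
  constructor
  · intro h
    exact S.eq_of_incEdge F.face (Q.face i h1 h2) hk (F.incEdge h1 (by omega)) (Q.inc i h1 h2) h
      (Q.ne i h1 h2) hfk
  · rintro rfl
    exact Q.inc i h1 h2

theorem mEdges_eq_card (S : CycleSetup C p) (F : MinorFace emb C p f v 0 5)
    (Q : OppositeSeq emb C p f g) (hk : IsFaceOf (drawE emb (Hgraph C).edgeSet) k) (hfk : f ≠ k) :
    mEdges emb C f k = ((Finset.Ico (0 : ℤ) 5).filter fun i => g i = k).card := by
  have hlen := S.len
  rw [F.mEdges_eq S.toCycleIndex (by omega), zero_add]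
  congr 1
  ext i
  simp only [Finset.mem_filter, Finset.mem_Ico]
  exact and_congr_right fun h => S.incEdge_iff_eq F Q hk hfk h.1 h.2

theorem le_wFace (S : CycleSetup C p) (hf : MinorFaceH emb C f) (hf5 : numCEdges emb C f = 5)
    (F : MinorFace emb C p f v 0 5) (Q : OppositeSeq emb C p f g) :
    5 - ∑ i ∈ Finset.Ico (0 : ℤ) 5, edgeLoss emb C f (g i) s(p i, p (i + 1)) ≤ wFace emb C f := by
  have hlen := S.len
  set O := (Finset.Ico (0 : ℤ) 5).image g with hO
  have hmem : ∀ k, IsFaceOf (drawE emb (Hgraph C).edgeSet) k → OppositeFaces emb C f k →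
      k ∈ O := by
    rintro k hk ⟨hfk, e, he, h1, h2⟩
    obtain ⟨i, h3, h4, rfl⟩ := F.exists_edge_eq S.toCycleIndex (by omega) he h1
    exact Finset.mem_image.2 ⟨i, Finset.mem_Ico.2 ⟨h3, by omega⟩,
      (S.incEdge_iff_eq F Q hk hfk h3 (by omega)).1 h2⟩
  have hface : ∀ k l, sendWeight emb C k l ≠ 0 →
      IsFaceOf (drawE emb (Hgraph C).edgeSet) k ∧ IsFaceOf (drawE emb (Hgraph C).edgeSet) l := by
    intro k l h
    by_contra hcon
    have h1 : ¬ (MinorFaceH emb C k ∧ MinorFaceH emb C l) := fun H =>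
      hcon ⟨((S.minorFaceH_iff emb).1 H.1).1, ((S.minorFaceH_iff emb).1 H.2).1⟩
    have h2 : ¬ (MajorFaceH emb C k ∧ MinorFaceH emb C l) := fun H =>
      hcon ⟨S.drawingH_eq emb ▸ H.1.1, ((S.minorFaceH_iff emb).1 H.2).1⟩
    apply h
    rw [sendWeight_eq, if_neg fun H => h2 ⟨H.1, H.2.1⟩, if_neg fun H => h1 ⟨H.1, H.2.1⟩,
      if_neg fun H => h1 ⟨H.1, H.2.1⟩, if_neg fun H => h1 ⟨H.1, H.2.2.1⟩,
      if_neg fun H => h1 ⟨H.1, H.2.2.1⟩]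
    norm_num
  have hout : ∑ᶠ k, sendWeight emb C f k = ∑ k ∈ O, sendWeight emb C f k :=
    finsum_eq_sum_of_support_subset _ fun k hk => hmem k (hface _ _ hk).2 (by
      by_contra h
      exact hk (sendWeight_eq_zero h))
  have hin : ∑ᶠ k, sendWeight emb C k f = ∑ k ∈ O, sendWeight emb C k f :=
    finsum_eq_sum_of_support_subset _ fun k hk => hmem k (hface _ _ hk).1 (by
      by_contra h
      exact hk (sendWeight_eq_zero fun h' => h h'.symm))
  have hle : ∑ k ∈ O, (sendWeight emb C f k - sendWeight emb C k f) ≤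
      ∑ i ∈ Finset.Ico (0 : ℤ) 5, edgeLoss emb C f (g i) s(p i, p (i + 1)) := by
    rw [← Finset.sum_fiberwise_of_maps_to (g := g) (t := O)
      fun i hi => Finset.mem_image_of_mem g hi]
    refine Finset.sum_le_sum fun k hk => ?_
    obtain ⟨i, hi, rfl⟩ := Finset.mem_image.1 hk
    obtain ⟨h1, h2⟩ := Finset.mem_Ico.1 hi
    refine (S.send_sub_send_le hf hf5 F (Q.face i h1 h2) ⟨Q.ne i h1 h2, _, S.mem_edges_step i,
      F.incEdge h1 (by omega), Q.inc i h1 h2⟩).trans_eq ?_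
    rw [zero_add]
    refine Finset.sum_congr ?_ ?_
    · ext l
      simp only [Finset.mem_filter, Finset.mem_Ico]
      exact and_congr_right fun h => S.incEdge_iff_eq F Q (Q.face i h1 h2) (Q.ne i h1 h2) h.1 h.2
    · intro l hl
      rw [(Finset.mem_filter.1 hl).2]
  rw [wFace, hout, hin, hf5]
  rw [Finset.sum_sub_distrib] at hle
  push_cast
  linarith

theorem edgeLoss_le (S : CycleSetup C p) (hk : MinorFaceH emb C k)
    (K : MinorFace emb C p k w a j) (h1 : a ≤ i) (h2 : i < a + j) :
    edgeLoss emb C f k s(p i, p (i + 1)) ≤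
      if j = 2 then 2 / 3 else if j = 3 then (if i = a + 1 then 1 else 0) else
        if RuleFour emb C f k ∨ RuleFive emb C f k then 1 / 3 else 0 := by
  have hlen := S.len
  have hj := K.numCEdges_eq S.toCycleIndex (by omega)
  have h4 : RuleFour emb C f k → j = 4 := fun H => by have := H.2.2.2.1; omega
  have h5 : RuleFive emb C f k → j = 5 := fun H => by have := H.2.2.2.1; omega
  have h0 : (0 : ℚ) ≤ if RuleFive emb C k f then 1 / 6 else 0 := by split_ifs <;> norm_num
  rw [edgeLoss, if_neg (not_majorFaceH hk)]
  by_cases hj2 : j = 2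
  · have h4' : ¬ RuleFour emb C f k := fun H => by have := h4 H; omega
    have h5' : ¬ RuleFive emb C f k := fun H => by have := h5 H; omega
    rw [if_pos (by omega : numCEdges emb C k = 2), if_neg fun H => by have := H.1; omega,
      if_neg h4', if_neg h5', if_pos hj2]
    linarith
  by_cases hj3 : j = 3
  · have h4' : ¬ RuleFour emb C f k := fun H => by have := h4 H; omega
    have h5' : ¬ RuleFive emb C f k := fun H => by have := h5 H; omega
    rw [if_neg (by omega : ¬ numCEdges emb C k = 2), if_neg h4', if_neg h5', if_neg hj2, if_pos hj3]
    subst hj3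
    by_cases hi : i = a + 1
    · rw [if_pos hi]
      split_ifs at * <;> linarith
    · rw [if_neg hi, if_neg fun H => hi (S.eq_of_isMiddleCEdge K h1 h2 H.2)]
      linarith
  · rw [if_neg (by omega : ¬ numCEdges emb C k = 2), if_neg fun H => by have := H.1; omega,
      if_neg hj2, if_neg hj3]
    by_cases H4 : RuleFour emb C f k
    · have h5' : ¬ RuleFive emb C f k := fun H => by have := h5 H; have := h4 H4; omega
      rw [if_pos H4, if_neg h5', if_pos (Or.inl H4)]
      linarith
    · by_cases H5 : RuleFive emb C f k
      · rw [if_neg H4, if_pos H5, if_pos (Or.inr H5)]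
        linarith
      · rw [if_neg H4, if_neg H5, if_neg (not_or.2 ⟨H4, H5⟩)]
        linarith

end CycleSetup
end Bounds

section Accounting

variable {V : Type*} {G : SimpleGraph V} {x : V} {C : G.Walk x x} {p : ℤ → V}
  {emb : PlaneEmbedding G} {f h k : Set (ℝ × ℝ)} {v w : V} {a j i : ℤ} {g : ℤ → Set (ℝ × ℝ)}
variable [Fintype V]

/-- The weight that `f` loses through the edge `p i p (i + 1)` if `g i` is the opposite face. -/
def lossAt (emb : PlaneEmbedding G) (C : G.Walk x x) (p : ℤ → V) (f : Set (ℝ × ℝ))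
    (g : ℤ → Set (ℝ × ℝ)) (i : ℤ) : ℚ :=
  edgeLoss emb C f (g i) s(p i, p (i + 1))

theorem lossAt_reflect (emb : PlaneEmbedding G) (C : G.Walk x x) (p : ℤ → V) (f : Set (ℝ × ℝ))
    (g : ℤ → Set (ℝ × ℝ)) (i : ℤ) :
    lossAt emb C (fun i => p (5 - i)) f (fun i => g (4 - i)) i = lossAt emb C p f g (4 - i) := by
  rw [lossAt, lossAt, Sym2.eq_swap, show 5 - (i + 1) = 4 - i by ring,
    show 4 - i + 1 = 5 - i by ring]

namespace CycleSetup

theorem exists_minorFace_opposite (S : CycleSetup C p) (Q : OppositeSeq emb C p f g)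
    (h1 : 0 ≤ i) (h2 : i < 5) (hm : MinorFaceH emb C (g i)) :
    ∃ w a j, MinorFace emb C p (g i) w a j ∧ a ≤ i ∧ i < a + j ∧ 2 ≤ j ∧
      (numCEdges emb C (g i) : ℤ) = j := by
  obtain ⟨w, a, K, h3, h4⟩ := S.exists_minorFace_of_incEdge hm (Q.inc i h1 h2)
  exact ⟨w, a, _, K, h3, h4, S.two_le K, rfl⟩

theorem lt_add_iff (S : CycleSetup C p) (F : MinorFace emb C p f v 0 5)
    (Q : OppositeSeq emb C p f g) (K : MinorFace emb C p (g i) w a j) (h1 : a ≤ i)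
    (h2 : i < a + j) (h3 : 0 ≤ i) (h4 : i + 1 < 5) : i + 1 < a + j ↔ g (i + 1) = g i := by
  have key := S.incEdge_iff_eq F Q (i := i + 1) (Q.face i h3 (by omega)) (Q.ne i h3 (by omega))
    (by omega) h4
  rw [← key]
  have hlt := K.lt
  refine ⟨fun h => K.incEdge (by omega) h, fun h => ?_⟩
  by_contra hcon
  exact K.not_incEdge S.toCycleIndex (by omega) (by omega) h

theorem lt_iff (S : CycleSetup C p) (F : MinorFace emb C p f v 0 5)
    (Q : OppositeSeq emb C p f g) (K : MinorFace emb C p (g i) w a j) (h1 : a ≤ i)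
    (h2 : i < a + j) (h3 : 1 ≤ i) (h4 : i < 5) : a < i ↔ g (i - 1) = g i := by
  have key := S.incEdge_iff_eq F Q (i := i - 1) (Q.face i (by omega) h4) (Q.ne i (by omega) h4)
    (by omega) (by omega)
  rw [← key]
  have hlt := K.lt
  refine ⟨fun h => K.incEdge (by omega) (by omega), fun h => ?_⟩
  by_contra hcon
  refine K.not_incEdge S.toCycleIndex (k := i - 1 + C.length) (by omega) (by omega) ?_
  rwa [show i - 1 + C.length + 1 = i - 1 + 1 + C.length by ring, S.periodic, S.periodic]

theorem three_le_mEdges (S : CycleSetup C p) (F : MinorFace emb C p f v 0 5)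
    (Q : OppositeSeq emb C p f g) {l m : ℤ} (h1 : 0 ≤ i) (h2 : i < l) (h3 : l < m) (h4 : m < 5)
    (hl : g l = g i) (hm : g m = g i) : 3 ≤ mEdges emb C f (g i) := by
  rw [S.mEdges_eq_card F Q (Q.face i h1 (by omega)) (Q.ne i h1 (by omega))]
  have : ({i, l, m} : Finset ℤ).card = 3 :=
    Finset.card_eq_three.2 ⟨i, l, m, by omega, by omega, by omega, rfl⟩
  rw [← this]
  refine Finset.card_le_card fun r hr => ?_
  simp only [Finset.mem_insert, Finset.mem_singleton] at hr
  simp only [Finset.mem_filter, Finset.mem_Ico]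
  rcases hr with rfl | rfl | rfl
  exacts [⟨⟨by omega, by omega⟩, rfl⟩, ⟨⟨by omega, by omega⟩, hl⟩, ⟨⟨by omega, by omega⟩, hm⟩]

theorem mEdges_eq_one (S : CycleSetup C p) (F : MinorFace emb C p f v 0 5)
    (Q : OppositeSeq emb C p f g) (h1 : 0 ≤ i) (h2 : i < 5)
    (h : ∀ l, 0 ≤ l → l < 5 → g l = g i → l = i) : mEdges emb C f (g i) = 1 := by
  rw [S.mEdges_eq_card F Q (Q.face i h1 h2) (Q.ne i h1 h2), Finset.card_eq_one]
  refine ⟨i, Finset.ext fun l => ?_⟩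
  simp only [Finset.mem_filter, Finset.mem_Ico, Finset.mem_singleton]
  refine ⟨fun H => h l H.1.1 H.1.2 H.2, ?_⟩
  rintro rfl
  exact ⟨⟨h1, h2⟩, rfl⟩

theorem lossAt_le_one (S : CycleSetup C p) (hk : MinorFaceH emb C k)
    (K : MinorFace emb C p k w a j) (h1 : a ≤ i) (h2 : i < a + j) (hgk : g i = k) :
    lossAt emb C p f g i ≤ 1 := by
  subst hgk
  have := S.edgeLoss_le (f := f) hk K h1 h2
  rw [lossAt]
  split_ifs at this <;> linarith

theorem lossAt_le_of_three (S : CycleSetup C p) (hk : MinorFaceH emb C k)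
    (K : MinorFace emb C p k w a j) (h1 : a ≤ i) (h2 : i < a + j) (hgk : g i = k)
    (hj : j = 3) (hi : i ≠ a + 1) : lossAt emb C p f g i ≤ 0 := by
  subst hgk
  have := S.edgeLoss_le (f := f) hk K h1 h2
  rw [lossAt]
  rwa [if_neg (by omega), if_pos hj, if_neg hi] at this

theorem lossAt_le_of_four_le (S : CycleSetup C p) (hk : MinorFaceH emb C k)
    (K : MinorFace emb C p k w a j) (h1 : a ≤ i) (h2 : i < a + j) (hgk : g i = k)
    (hj : 4 ≤ j) : lossAt emb C p f g i ≤ 1 / 3 := by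
  subst hgk
  have := S.edgeLoss_le (f := f) hk K h1 h2
  rw [lossAt]
  rw [if_neg (by omega), if_neg (by omega)] at this
  split_ifs at this <;> linarith

theorem lossAt_le_two_thirds (S : CycleSetup C p) (hk : MinorFaceH emb C k)
    (K : MinorFace emb C p k w a j) (h1 : a ≤ i) (h2 : i < a + j) (hgk : g i = k)
    (hi : i ≠ a + 1 ∨ j ≠ 3) :    lossAt emb C p f g i ≤ 2 / 3 := by
  subst hgk
  have := S.edgeLoss_le (f := f) hk K h1 h2
  rw [lossAt]
  split_ifs at this
  · linarith
  · omega
  all_goals linarith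

theorem lossAt_le_zero (S : CycleSetup C p) (hk : MinorFaceH emb C k)
    (K : MinorFace emb C p k w a j) (h1 : a ≤ i) (h2 : i < a + j) (hgk : g i = k)
    (hj : 4 ≤ j) (hm : mEdges emb C f k ≠ 2) : lossAt emb C p f g i ≤ 0 := by
  subst hgk
  have := S.edgeLoss_le (f := f) hk K h1 h2
  rw [lossAt]
  rw [mEdges_comm] at hm
  rwa [if_neg (by omega), if_neg (by omega),
    if_neg (not_or.2 ⟨fun H => hm H.2.2.2.2.2.1, fun H => hm H.2.2.2.2.2.1⟩)] at this

theorem lossAt_eq_of_four_le (S : CycleSetup C p) (hk : MinorFaceH emb C k)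
    (K : MinorFace emb C p k w a j) (hgk : g i = k) (hj : 4 ≤ j) (h4 : ¬ RuleFour emb C f k)
    (h5 : ¬ RuleFive emb C f k) : lossAt emb C p f g i =
      -(if RuleFive emb C k f then 1 / 6 else 0) := by
  subst hgk
  have hlen := S.len
  have hj' := K.numCEdges_eq S.toCycleIndex (by omega)
  rw [lossAt, edgeLoss, if_neg (not_majorFaceH hk), if_neg (by omega : ¬ numCEdges emb C (g i) = 2),
    if_neg fun H => by have := H.1; omega, if_neg h4, if_neg h5]
  ring

end CycleSetup
end Accounting

section Patterns

variable {V : Type*} {G : SimpleGraph V} {x : V} {C : G.Walk x x} {p : ℤ → V}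
  {emb : PlaneEmbedding G} {f h k : Set (ℝ × ℝ)} {v u w : V} {a j i : ℤ} {g : ℤ → Set (ℝ × ℝ)}
variable [Fintype V]

namespace CycleSetup

theorem lossAt_sum_le_of_first_four_eq (S : CycleSetup C p) (F : MinorFace emb C p f v 0 5)
    (Q : OppositeSeq emb C p f g) (M : ∀ i, 0 ≤ i → i < 5 → MinorFaceH emb C (g i))
    (h1 : g 1 = g 0) (h2 : g 2 = g 0) (h3 : g 3 = g 0) :
    lossAt emb C p f g 0 + lossAt emb C p f g 1 + lossAt emb C p f g 2 + lossAt emb C p f g 3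
      + lossAt emb C p f g 4 ≤ 5 / 3 := by
  have m0 := M 0 (by omega) (by omega)
  have m4 := M 4 (by omega) (by omega)
  obtain ⟨w, a, j, K, ha, hb, -, -⟩ := S.exists_minorFace_opposite Q (by omega) (by omega) m0
  have b1 := (S.lt_add_iff F Q K ha hb (by omega) (by omega)).2 h1
  have b2 := (S.lt_add_iff (i := 1) F Q (h1 ▸ K) (by omega) (by omega) (by omega) (by omega)).2
    (h2.trans h1.symm)
  have b3 := (S.lt_add_iff (i := 2) F Q (h2 ▸ K) (by omega) (by omega) (by omega) (by omega)).2
    (h3.trans h2.symm)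
  have hm := S.three_le_mEdges F Q (i := 0) (l := 1) (m := 2) le_rfl (by omega) (by omega)
    (by omega) h1 h2
  have key : ∀ i, 0 ≤ i → i ≤ 3 → g i = g 0 → lossAt emb C p f g i ≤ 0 := fun i _ _ hi =>
     S.lossAt_le_zero m0 K (by omega) (by omega) hi (by omega) (by omega)
  have k0 := key 0 (by omega) (by omega) rfl
  have k1 := key 1 (by omega) (by omega) h1
  have k2 := key 2 (by omega) (by omega) h2
  have k3 := key 3 (by omega) (by omega) h3
  have k4 : lossAt emb C p f g 4 ≤ 1 := by
    obtain ⟨w, a, j, K, ha, hb, -, -⟩ := S.exists_minorFace_opposite Q (by omega) (by omega) m4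
    exact S.lossAt_le_one m4 K ha hb rfl
  linarith

theorem lossAt_sum_le_of_two_three (S : CycleSetup C p) (F : MinorFace emb C p f v 0 5)
    (Q : OppositeSeq emb C p f g) (M : ∀ i, 0 ≤ i → i < 5 → MinorFaceH emb C (g i))
    (h1 : g 1 = g 0) (h2 : g 2 ≠ g 1) (h3 : g 3 = g 2) (h4 : g 4 = g 2) :
    lossAt emb C p f g 0 + lossAt emb C p f g 1 + lossAt emb C p f g 2 + lossAt emb C p f g 3
      + lossAt emb C p f g 4 ≤ 5 / 3 := by
  have m0 := M 0 (by omega) (by omega)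
  have m2 := M 2 (by omega) (by omega)
  obtain ⟨u, b, l, U, hb1, hb2, hl, -⟩ := S.exists_minorFace_opposite Q (by omega) (by omega) m0
  have b1 := (S.lt_add_iff F Q U hb1 hb2 (by omega) (by omega)).2 h1
  have b2 := mt (S.lt_add_iff (i := 1) F Q (h1 ▸ U) (by omega) (by omega) (by omega)
    (by omega)).1 h2
  obtain rfl : b = 2 - l := by omega
  obtain ⟨t, a, j, T, ha1, ha2, hj, -⟩ := S.exists_minorFace_opposite Q (by omega) (by omega) m2
  have c1 := mt (S.lt_iff (i := 2) F Q T (by omega) (by omega) (by omega) (by omega)).1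
    (by norm_num; exact h2.symm)
  obtain rfl : a = 2 := by omega
  have c2 := (S.lt_add_iff F Q T ha1 ha2 (by omega) (by omega)).2 h3
  have c3 := (S.lt_add_iff (i := 3) F Q (h3 ▸ T) (by omega) (by omega) (by omega) (by omega)).2
    (h4.trans h3.symm)
  have hfu := Q.ne 0 (by omega) (by omega)
  have hft := Q.ne 2 (by omega) (by omega)
  by_cases hj3 : j = 3
  · subst hj3
    have k2 := S.lossAt_le_of_three (f := f) (i := 2) m2 T (by omega) (by omega) rfl rfl (by omega)
    have k3 := S.lossAt_le_one (f := f) (i := 3) m2 T (by omega) (by omega) h3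
    have k4 := S.lossAt_le_of_three (f := f) (i := 4) m2 T (by omega) (by omega) h4 rfl (by omega)
    rcases (by omega : l = 2 ∨ l = 3 ∨ 4 ≤ l) with rfl | rfl | hl
    · exact (S.false_of_two_three F U T hfu hft).elim
    · exact (S.false_of_three_three F U T hfu hft).elim
    · have k0 := S.lossAt_le_of_four_le (f := f) (i := 0) m0 U (by omega) (by omega) rfl hl
      have k1 := S.lossAt_le_of_four_le (f := f) (i := 1) m0 U (by omega) (by omega) h1 hl
      linarith
  · have hm := S.three_le_mEdges F Q (i := 2) (l := 3) (m := 4) (by omega) (by omega) (by omega)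
      (by omega) h3 h4
    have k2 := S.lossAt_le_zero (f := f) (i := 2) m2 T (by omega) (by omega) rfl (by omega)
      (by omega)
    have k3 := S.lossAt_le_zero (f := f) (i := 3) m2 T (by omega) (by omega) h3 (by omega)
      (by omega)
    have k4 := S.lossAt_le_zero (f := f) (i := 4) m2 T (by omega) (by omega) h4 (by omega)
      (by omega)
    rcases eq_or_ne l 3 with rfl | hl3
    · have k0 := S.lossAt_le_one (f := f) (i := 0) m0 U (by omega) (by omega) rfl
      have k1 := S.lossAt_le_of_three (f := f) (i := 1) m0 U (by omega) (by omega) h1 rfl (by omega)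
      linarith
    · have k0 := S.lossAt_le_two_thirds (f := f) (i := 0) m0 U (by omega) (by omega) rfl (.inr hl3)
      have k1 := S.lossAt_le_two_thirds (f := f) (i := 1) m0 U (by omega) (by omega) h1 (.inr hl3)
      linarith

theorem lossAt_sum_le_of_one_three_one (S : CycleSetup C p) (F : MinorFace emb C p f v 0 5)
    (Q : OppositeSeq emb C p f g) (M : ∀ i, 0 ≤ i → i < 5 → MinorFaceH emb C (g i))
    (h1 : g 1 ≠ g 0) (h2 : g 2 = g 1) (h3 : g 3 = g 1) (h4 : g 4 ≠ g 3) :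
    lossAt emb C p f g 0 + lossAt emb C p f g 1 + lossAt emb C p f g 2 + lossAt emb C p f g 3
      + lossAt emb C p f g 4 ≤ 5 / 3 := by
  have m0 := M 0 (by omega) (by omega)
  have m1 := M 1 (by omega) (by omega)
  have m4 := M 4 (by omega) (by omega)
  obtain ⟨u, b, l, U, hb1, hb2, hl, hnU⟩ := S.exists_minorFace_opposite Q (by omega) (by omega) m0
  have b1 := mt (S.lt_add_iff F Q U hb1 hb2 (by omega) (by omega)).1 h1
  obtain rfl : b = 1 - l := by omega
  obtain ⟨t, a, j, T, ha1, ha2, hj, -⟩ := S.exists_minorFace_opposite Q (by omega) (by omega) m1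
  have c1 := mt (S.lt_iff (i := 1) F Q T (by omega) (by omega) (by omega) (by omega)).1
    (by norm_num; exact h1.symm)
  obtain rfl : a = 1 := by omega
  have c2 := (S.lt_add_iff F Q T ha1 ha2 (by omega) (by omega)).2 h2
  have c3 := (S.lt_add_iff (i := 2) F Q (h2 ▸ T) (by omega) (by omega) (by omega) (by omega)).2
    (h3.trans h2.symm)
  have c4 := mt (S.lt_add_iff (i := 3) F Q (h3 ▸ T) (by omega) (by omega) (by omega)
    (by omega)).1 h4
  obtain rfl : j = 3 := by omega
  obtain ⟨w, d, r, W, hd1, hd2, hr, hnW⟩ := S.exists_minorFace_opposite Q (by omega) (by omega) m4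
  have d1 := mt (S.lt_iff (i := 4) F Q W (by omega) (by omega) (by omega) (by omega)).1
    (by norm_num; exact h4.symm)
  obtain rfl : d = 4 := by omega
  have k1 := S.lossAt_le_of_three (f := f) (i := 1) m1 T (by omega) (by omega) rfl rfl (by omega)
  have k2 := S.lossAt_le_one (f := f) (i := 2) m1 T (by omega) (by omega) h2
  have k3 := S.lossAt_le_of_three (f := f) (i := 3) m1 T (by omega) (by omega) h3 rfl (by omega)
  have k0 := S.lossAt_le_two_thirds (f := f) (i := 0) m0 U hb1 hb2 rfl (by omega)
  have k4 := S.lossAt_le_two_thirds (f := f) (i := 4) m4 W hd1 hd2 rfl (by omega)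
  have hgt : g 0 ≠ g 4 → (l = 2 → r ≠ 2 → lossAt emb C p f g 4 ≤ 0) ∧
      (r = 2 → l ≠ 2 → lossAt emb C p f g 0 ≤ 0) := by
    intro h04
    constructor <;> intro e1 e2
    · rcases (by omega : r = 3 ∨ 4 ≤ r) with rfl | h
      · exact S.lossAt_le_of_three m4 W hd1 hd2 rfl rfl (by omega)
      · refine S.lossAt_le_zero m4 W hd1 hd2 rfl h ?_
        rw [S.mEdges_eq_one F Q (by omega) (by omega)]
        · norm_num
        · intro i hi1 hi2 hi
          interval_cases i
          exacts [absurd hi h04, absurd (h3.trans hi) h4.symm,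
            absurd (h3.trans (h2.symm.trans hi)) h4.symm, absurd hi.symm h4, rfl]
    · rcases (by omega : l = 3 ∨ 4 ≤ l) with rfl | h
      · exact S.lossAt_le_of_three m0 U hb1 hb2 rfl rfl (by omega)
      · refine S.lossAt_le_zero m0 U hb1 hb2 rfl h ?_
        rw [S.mEdges_eq_one F Q (by omega) (by omega)]
        · norm_num
        · intro i hi1 hi2 hi
          interval_cases i
          exacts [rfl, absurd hi h1, absurd (h2.symm.trans hi) h1, absurd (h3.symm.trans hi) h1,
            absurd hi.symm h04]
  have hne : l ≠ r → g 0 ≠ g 4 := fun hlr h => by rw [h] at hnU; omega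
  have k0 := S.lossAt_le_two_thirds (f := f) (i := 0) m0 U hb1 hb2 rfl (by omega)
  have k4 := S.lossAt_le_two_thirds (f := f) (i := 4) m4 W hd1 hd2 rfl (by omega)
  by_cases hl2 : l = 2
  · subst hl2
    by_cases hr2 : r = 2
    · subst hr2
      exact (S.false_of_two_three_two F U T W (Q.ne 1 (by omega) (by omega))).elim
    · linarith [(hgt (hne (Ne.symm hr2))).1 rfl hr2]
  · by_cases hr2 : r = 2
    · linarith [(hgt (hne (by omega))).2 hr2 hl2]
    · have k0 : lossAt emb C p f g 0 ≤ 1 / 3 := by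
        rcases (by omega : l = 3 ∨ 4 ≤ l) with rfl | h
        · linarith [S.lossAt_le_of_three (f := f) m0 U hb1 hb2 rfl rfl (by omega)]
        · exact S.lossAt_le_of_four_le m0 U hb1 hb2 rfl h
      have k4 : lossAt emb C p f g 4 ≤ 1 / 3 := by
        rcases (by omega : r = 3 ∨ 4 ≤ r) with rfl | h
        · linarith [S.lossAt_le_of_three (f := f) m4 W hd1 hd2 rfl rfl (by omega)]
        · exact S.lossAt_le_of_four_le m4 W hd1 hd2 rfl h
      linarith

end CycleSetup
end Patterns

section TwoTwoOne

variable {V : Type*} {G : SimpleGraph V} {x : V} {C : G.Walk x x} {p : ℤ → V}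
  {emb : PlaneEmbedding G} {f h k : Set (ℝ × ℝ)} {v u w : V} {a j i l : ℤ} {g : ℤ → Set (ℝ × ℝ)}
variable [Fintype V]

theorem OppositeSeq.oppositeFaces (Q : OppositeSeq emb C p f g) (S : CycleSetup C p)
    (F : MinorFace emb C p f v 0 5) (h1 : 0 ≤ i) (h2 : i < 5) : OppositeFaces emb C f (g i) :=
  ⟨Q.ne i h1 h2, _, S.mem_edges_step i, F.incEdge h1 (by omega), Q.inc i h1 h2⟩

namespace CycleSetup

theorem exists_minorFace_left (S : CycleSetup C p) (F : MinorFace emb C p f v 0 5)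
    (Q : OppositeSeq emb C p f g) (hk : MinorFaceH emb C k) (hfk : f ≠ k) (hgk : g 0 ≠ k)
    (hi : i < 0) (hki : incEdge emb k s(p i, p (i + 1))) :
    ∃ t a, MinorFace emb C p k t a (numCEdges emb C k) ∧ a ≤ i ∧ i < a + numCEdges emb C k ∧
      a + numCEdges emb C k ≤ 0 := by
  obtain ⟨t, a, K, h1, h2⟩ := S.exists_minorFace_of_incEdge hk hki
  refine ⟨t, a, K, h1, h2, ?_⟩
  by_contra! h
  exact hgk ((S.incEdge_iff_eq F Q K.face hfk le_rfl (by omega)).1 (K.incEdge (by omega)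
    (by omega)))

theorem not_incEdge_of_eq (S : CycleSetup C p) (F : MinorFace emb C p f v 0 5)
    (Q : OppositeSeq emb C p f g) (h10 : g 1 = g 0) (hk : MinorFaceH emb C k) (hfk : f ≠ k)
    (hgk : g 0 ≠ k) (hi : 0 ≤ i) (hi' : i < 2) : ¬ incEdge emb k s(p i, p (i + 1)) := by
  intro h
  have := (S.incEdge_iff_eq F Q ((S.minorFaceH_iff emb).1 hk).1 hfk hi (by omega)).1 h
  rcases (by omega : i = 0 ∨ i = 1) with rfl | rfl
  exacts [hgk this, hgk (h10.symm.trans this)]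

theorem not_ruleFour (S : CycleSetup C p) (F : MinorFace emb C p f v 0 5)
    (Q : OppositeSeq emb C p f g) (U : MinorFace emb C p (g 0) u (2 - l) l)
    (W : MinorFace emb C p (g 2) w 2 2) (h10 : g 1 = g 0) : ¬ RuleFour emb C f (g 0) := by
  rintro ⟨-, -, -, h4, -, -, k, hk, hk23, hgk, hm⟩
  have hlen := S.len
  have hf5 := F.numCEdges_eq S.toCycleIndex (by omega)
  have hU := U.numCEdges_eq S.toCycleIndex (by omega)
  obtain rfl : l = 4 := by omega
  have hfk : f ≠ k := by
    rintro rfl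
    omega
  have hinc : incEdge emb k s(p (-1), p (-1 + 1)) := by
    by_contra hcon
    rw [U.mEdges_eq S.toCycleIndex (by omega)] at hm
    have : ((Finset.Ico (2 - 4 : ℤ) (2 - 4 + 4)).filter
        fun i => incEdge emb k s(p i, p (i + 1))) ⊆ {-2} := by
      intro i hi
      obtain ⟨h1, h2⟩ := Finset.mem_filter.1 hi
      rw [Finset.mem_Ico] at h1
      rcases (by omega : i = -2 ∨ i = -1 ∨ 0 ≤ i) with rfl | rfl | h3
      · simp
      · exact absurd h2 hcon
      · exact absurd h2 (S.not_incEdge_of_eq F Q h10 hk hfk hgk.1 h3 (by omega))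
    have := Finset.card_le_card this
    rw [hm] at this
    simp at this
  obtain ⟨t, a, K, h1, h2, h3⟩ := S.exists_minorFace_left F Q hk hfk hgk.1 (by omega) hinc
  obtain rfl : a = -(numCEdges emb C k : ℤ) := by omega
  exact S.false_of_four_two F U W K (by omega) (Q.ne 0 (by omega) (by omega))
    (Q.ne 2 (by omega) (by omega)) hgk.1

theorem not_ruleFive (S : CycleSetup C p) (F : MinorFace emb C p f v 0 5)
    (Q : OppositeSeq emb C p f g) (U : MinorFace emb C p (g 0) u (2 - l) l)
    (W : MinorFace emb C p (g 2) w 2 2) (h10 : g 1 = g 0) : ¬ RuleFive emb C f (g 0) := by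
  rintro ⟨-, -, -, h5, -, -, k, k', hkk, hk, hk2, hgk, hk', hk2', hgk'⟩
  have hlen := S.len
  have hf5 := F.numCEdges_eq S.toCycleIndex (by omega)
  have hU := U.numCEdges_eq S.toCycleIndex (by omega)
  obtain rfl : l = 5 := by omega
  have key : ∀ k, MinorFaceH emb C k → numCEdges emb C k = 2 → OppositeFaces emb C (g 0) k →
      incEdge emb k s(p (-3), p (-3 + 1)) := by
    rintro k hk hk2 ⟨hgk, e, he, he1, he2⟩
    have hfk : f ≠ k := by
      rintro rfl
      omega
    obtain ⟨i, h1, h2, rfl⟩ := U.exists_edge_eq S.toCycleIndex (by omega) he he1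
    have hi : i < 0 := by
      by_contra! h3
      exact S.not_incEdge_of_eq F Q h10 hk hfk hgk h3 (by omega) he2
    obtain ⟨t, a, K, h3, h4, h5⟩ := S.exists_minorFace_left F Q hk hfk hgk hi he2
    rw [hk2] at K h4 h5
    push_cast at K h4 h5
    by_cases ha : a = -2
    · subst ha
      exact (S.false_of_five_two F U W K (Q.ne 0 (by omega) (by omega))
        (Q.ne 2 (by omega) (by omega)) hgk).elim
    · exact K.incEdge (by omega) (by omega)
  exact hkk (S.eq_of_incEdge U.face ((S.minorFaceH_iff emb).1 hk).1
    ((S.minorFaceH_iff emb).1 hk').1 (U.incEdge (by omega) (by omega)) (key k hk hk2 hgk)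
    (key k' hk' hk2' hgk') hgk.1 hgk'.1)

theorem lossAt_sum_le_of_two_two_one (S : CycleSetup C p) (hf : MinorFaceH emb C f)
    (F : MinorFace emb C p f v 0 5)
    (Q : OppositeSeq emb C p f g) (M : ∀ i, 0 ≤ i → i < 5 → MinorFaceH emb C (g i))
    (h1 : g 1 = g 0) (h2 : g 2 ≠ g 1) (h3 : g 3 = g 2) (h4 : g 4 ≠ g 3) :
    lossAt emb C p f g 0 + lossAt emb C p f g 1 + lossAt emb C p f g 2 + lossAt emb C p f g 3
      + lossAt emb C p f g 4 ≤ 5 / 3 := by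
  have hlen := S.len
  have hf5 := F.numCEdges_eq S.toCycleIndex (by omega)
  have m0 := M 0 (by omega) (by omega)
  have m2 := M 2 (by omega) (by omega)
  have m4 := M 4 (by omega) (by omega)
  obtain ⟨u, b, l, U, hb1, hb2, hl, hnU⟩ := S.exists_minorFace_opposite Q (by omega) (by omega) m0
  have b1 := (S.lt_add_iff F Q U hb1 hb2 (by omega) (by omega)).2 h1
  have b2 := mt (S.lt_add_iff (i := 1) F Q (h1 ▸ U) (by omega) (by omega) (by omega)
    (by omega)).1 h2
  obtain rfl : b = 2 - l := by omega
  obtain ⟨w, a, j, W, ha1, ha2, hj, hnW⟩ := S.exists_minorFace_opposite Q (by omega) (by omega) m2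
  have c1 := mt (S.lt_iff (i := 2) F Q W (by omega) (by omega) (by omega) (by omega)).1
    (by norm_num; exact h2.symm)
  obtain rfl : a = 2 := by omega
  have c2 := (S.lt_add_iff F Q W ha1 ha2 (by omega) (by omega)).2 h3
  have c3 := mt (S.lt_add_iff (i := 3) F Q (h3 ▸ W) (by omega) (by omega) (by omega)
    (by omega)).1 h4
  obtain rfl : j = 2 := by omega
  obtain ⟨t, d, r, T, hd1, hd2, hr, hnT⟩ := S.exists_minorFace_opposite Q (by omega) (by omega) m4
  have d1 := mt (S.lt_iff (i := 4) F Q T (by omega) (by omega) (by omega) (by omega)).1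
    (by norm_num; exact h4.symm)
  obtain rfl : d = 4 := by omega
  have hfu := Q.ne 0 (by omega) (by omega)
  have hfw := Q.ne 2 (by omega) (by omega)
  have k2 := S.lossAt_le_two_thirds (f := f) (i := 2) m2 W (by omega) (by omega) rfl (by omega)
  have k3 := S.lossAt_le_two_thirds (f := f) (i := 3) m2 W (by omega) (by omega) h3 (by omega)
  rcases (by omega : l = 2 ∨ l = 3 ∨ 4 ≤ l) with rfl | rfl | hl
  · exact (S.false_of_two_two F U W hfu hfw).elim
  · exact (S.false_of_three_two F U W hfu hfw).elim
  have r4 := S.not_ruleFour F Q U W h1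
  have r5 := S.not_ruleFive F Q U W h1
  rw [S.lossAt_eq_of_four_le m0 U rfl hl r4 r5, S.lossAt_eq_of_four_le m0 U h1 hl r4 r5]
  have h0 : (0 : ℚ) ≤ if RuleFive emb C (g 0) f then 1 / 6 else 0 := by split_ifs <;> norm_num
  rcases (by omega : r = 2 ∨ r = 3 ∨ 4 ≤ r) with rfl | rfl | hr
  · have hm : mEdges emb C f (g 0) = 2 := by
      rw [S.mEdges_eq_card F Q U.face hfu, Finset.card_eq_two]
      refine ⟨0, 1, by norm_num, Finset.ext fun i => ?_⟩
      simp only [Finset.mem_filter, Finset.mem_Ico, Finset.mem_insert, Finset.mem_singleton]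
      constructor
      · rintro ⟨⟨hi1, hi2⟩, hi⟩
        have h24 : i ≠ 4 := by
          rintro rfl
          rw [hi] at hnT
          omega
        rcases (by omega : i = 0 ∨ i = 1 ∨ i = 2 ∨ i = 3) with rfl | rfl | rfl | rfl
        exacts [.inl rfl, .inr rfl, absurd (hi.trans h1.symm) h2,
          absurd (h3.symm.trans (hi.trans h1.symm)) h2]
      · rintro (rfl | rfl)
        exacts [⟨by norm_num, rfl⟩, ⟨by norm_num, h1⟩]
    have r5' : RuleFive emb C (g 0) f :=
      ⟨m0, by omega, hf, by omega, Q.oppositeFaces S F (by omega) (by omega), hm, g 2, g 4,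
        fun h => h4 (h3.trans h).symm, m2, by omega, Q.oppositeFaces S F (by omega) (by omega), m4,
        by omega, Q.oppositeFaces S F (by omega) (by omega)⟩
    rw [if_pos r5']
    linarith [S.lossAt_le_two_thirds (f := f) (i := 4) m4 T hd1 hd2 rfl (by omega)]
  · linarith [S.lossAt_le_of_three (f := f) (i := 4) m4 T hd1 hd2 rfl rfl (by omega)]
  · linarith [S.lossAt_le_of_four_le (f := f) (i := 4) m4 T hd1 hd2 rfl hr]

theorem lossAt_sum_le_of_forall_minor (S : CycleSetup C p) (hf : MinorFaceH emb C f)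
    (F : MinorFace emb C p f v 0 5) (Q : OppositeSeq emb C p f g)
    (M : ∀ i, 0 ≤ i → i < 5 → MinorFaceH emb C (g i)) :
    lossAt emb C p f g 0 + lossAt emb C p f g 1 + lossAt emb C p f g 2 + lossAt emb C p f g 3
      + lossAt emb C p f g 4 ≤ 5 / 3 := by
  have key : ∀ i, 1 ≤ i → i ≤ 3 → g (i - 1) ≠ g i → g (i + 1) = g i := by
    intro i h1 h2 h3
    obtain ⟨w, a, j, K, h4, h5, h6, -⟩ := S.exists_minorFace_opposite Q (by omega) (by omega)
      (M i (by omega) (by omega))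
    have h7 := mt (S.lt_iff F Q K h4 h5 h1 (by omega)).1 h3
    exact (S.lt_add_iff F Q K h4 h5 (by omega) (by omega)).1 (by omega)
  have n1 := key 1 (by omega) (by omega)
  have n2 := key 2 (by omega) (by omega)
  have n3 := key 3 (by omega) (by omega)
  norm_num at n1 n2 n3
  have S' := S.reflect 5
  have F' : MinorFace emb C (fun i => p (5 - i)) f v 0 5 := by
    have := F.reflect S.toCycleIndex 5
    norm_num at this
    exact this
  have Q' := Q.reflect
  have M' : ∀ i, 0 ≤ i → i < 5 → MinorFaceH emb C (g (4 - i)) := fun i _ _ =>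
    M _ (by omega) (by omega)
  by_cases e1 : g 1 = g 0
  · by_cases e2 : g 2 = g 1
    · by_cases e3 : g 3 = g 2
      · exact S.lossAt_sum_le_of_first_four_eq F Q M e1 (e2.trans e1) (e3.trans (e2.trans e1))
      · have := S'.lossAt_sum_le_of_two_three F' Q' M' (n3 (Ne.symm e3)).symm (Ne.symm e3) e2.symm
          (e2.trans e1).symm
        simp only [lossAt_reflect] at this
        norm_num at this
        linarith
    · have e3 := n2 (Ne.symm e2)
      by_cases e4 : g 4 = g 3
      · exact S.lossAt_sum_le_of_two_three F Q M e1 e2 e3 (e4.trans e3)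
      · exact S.lossAt_sum_le_of_two_two_one hf F Q M e1 e2 e3 e4
  · have e2 := n1 (Ne.symm e1)
    by_cases e3 : g 3 = g 2
    · by_cases e4 : g 4 = g 3
      · have := S'.lossAt_sum_le_of_first_four_eq F' Q' M' e4.symm (e4.trans e3).symm
          (e4.trans (e3.trans e2)).symm
        simp only [lossAt_reflect] at this
        norm_num at this
        linarith
      · exact S.lossAt_sum_le_of_one_three_one F Q M e1 e2 (e3.trans e2) e4
    · have := S'.lossAt_sum_le_of_two_two_one hf F' Q' M' (n3 (Ne.symm e3)).symm (Ne.symm e3)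
        e2.symm (Ne.symm e1)
      simp only [lossAt_reflect] at this
      norm_num at this
      linarith

theorem lossAt_eq_neg_one (hm : MajorFaceH emb C (g i)) : lossAt emb C p f g i = -1 := by
  rw [lossAt, edgeLoss, if_pos hm]

theorem lossAt_sum_le_of_major (S : CycleSetup C p) (F : MinorFace emb C p f v 0 5)
    (Q : OppositeSeq emb C p f g) {m : ℤ} (hm0 : 0 ≤ m) (hm5 : m < 5)
    (hm : MajorFaceH emb C (g m)) :
    lossAt emb C p f g 0 + lossAt emb C p f g 1 + lossAt emb C p f g 2 + lossAt emb C p f g 3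
      + lossAt emb C p f g 4 ≤ 5 / 3 := by
  have key : ∀ i, 0 ≤ i → i < 5 → lossAt emb C p f g i ≤ 2 / 3 ∨ (lossAt emb C p f g i ≤ 1 ∧
      (1 ≤ i → i - 1 ≠ m ∧ lossAt emb C p f g (i - 1) ≤ 0) ∧
      (i ≤ 3 → i + 1 ≠ m ∧ lossAt emb C p f g (i + 1) ≤ 0)) := by
    intro i h1 h2
    by_cases hi : MajorFaceH emb C (g i)
    · left
      rw [lossAt_eq_neg_one hi]
      norm_num
    have mi : MinorFaceH emb C (g i) := by
      by_contra h
      exact hi ⟨S.drawingH_eq emb ▸ Q.face i h1 h2, h⟩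
    obtain ⟨w, a, j, K, h3, h4, -, -⟩ := S.exists_minorFace_opposite Q h1 h2 mi
    by_cases h5 : i ≠ a + 1 ∨ j ≠ 3
    · exact .inl (S.lossAt_le_two_thirds mi K h3 h4 rfl h5)
    obtain ⟨rfl, rfl⟩ : i = a + 1 ∧ j = 3 := by omega
    refine .inr ⟨S.lossAt_le_one mi K h3 h4 rfl, fun h6 => ?_, fun h6 => ?_⟩
    · have h7 := (S.lt_iff F Q K h3 h4 h6 h2).1 (by omega)
      refine ⟨?_, S.lossAt_le_of_three mi K (by omega) (by omega) h7 rfl (by omega)⟩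
      rintro rfl
      exact hi (h7 ▸ hm)
    · have h7 := (S.lt_add_iff F Q K h3 h4 h1 (by omega)).1 (by omega)
      refine ⟨?_, S.lossAt_le_of_three mi K (by omega) (by omega) h7 rfl (by omega)⟩
      rintro rfl
      exact hi (h7 ▸ hm)
  have k0 := key 0 (by omega) (by omega)
  have k1 := key 1 (by omega) (by omega)
  have k2 := key 2 (by omega) (by omega)
  have k3 := key 3 (by omega) (by omega)
  have k4 := key 4 (by omega) (by omega)
  have hL := lossAt_eq_neg_one (p := p) (f := f) hm
  norm_num at k0 k1 k2 k3 k4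
  interval_cases m <;> grind only

end CycleSetup
end TwoTwoOne

/-- After discharging by rules R1–R5, every minor 5-face of `H` has weight `≥ 10/3`. -/
theorem stmt11_minor_5face
    {V : Type*} [Fintype V] {G : SimpleGraph V}
    (hn : 11 ≤ Fintype.card V) (h4 : EssentiallyFourConnected G)
    (emb : PlaneEmbedding G) {x : V} (C : G.Walk x x)
    (hC : IsLongestIsolatingCycle G C) (hc : 8 ≤ C.length)
    (hVm : (Vminus emb C).Nonempty) (hVp : (Vplus emb C).Nonempty) :
    ∀ f : Set (ℝ × ℝ), MinorFaceH emb C f → numCEdges emb C f = 5 →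
      (10 : ℚ) / 3 ≤ wFace emb C f := by
  intro f hf hf5
  obtain ⟨p, hp⟩ := hC.1.exists_cycleIndex
  have S₀ : CycleSetup C p := { hp with three := h4.1, longest := hC, len := hc }
  obtain ⟨v, a, F₀⟩ := S₀.exists_minorFace hf
  have S := S₀.shift a
  have F := F₀.shift a
  rw [hf5, sub_self] at F
  push_cast at F
  obtain ⟨g, Q⟩ := S.exists_oppositeSeq emb f
  have hle := S.le_wFace hf hf5 F Q
  have hsum : lossAt emb C (fun i => p (i + a)) f g 0 + lossAt emb C (fun i => p (i + a)) f g 1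
      + lossAt emb C (fun i => p (i + a)) f g 2 + lossAt emb C (fun i => p (i + a)) f g 3
      + lossAt emb C (fun i => p (i + a)) f g 4 ≤ 5 / 3 := by
    by_cases hM : ∀ i, 0 ≤ i → i < 5 → MinorFaceH emb C (g i)
    · exact S.lossAt_sum_le_of_forall_minor hf F Q hM
    · push Not at hM
      obtain ⟨i, h1, h2, h3⟩ := hM
      exact S.lossAt_sum_le_of_major F Q h1 h2 ⟨S.drawingH_eq emb ▸ Q.face i h1 h2, h3⟩
  rw [show Finset.Ico (0 : ℤ) 5 = {0, 1, 2, 3, 4} by rfl] at hle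
  change 5 - ∑ i ∈ _, lossAt emb C (fun i => p (i + a)) f g i ≤ _ at hle
  simp only [Finset.sum_insert, Finset.mem_insert, Finset.mem_singleton, Finset.sum_singleton,
    Int.reduceEq, OfNat.zero_ne_ofNat, zero_ne_one, or_self, not_false_eq_true] at hle
  linarith

end
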